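/- Let N = 2p₁^m, where p₁ > 3 is a prime with p₁ ≡ 3 (mod 4) and m ≥ 1. Let p be an odd prime not equal to p₁ with [Z_N^* : ⟨p⟩] = 2. Let f = φ(N)/2, q = p^f, and let χ be a complex multiplicative character of F_q of order N. Write √(p*) for the principal square root of (−1)^{(p−1)/2}·p in C (so √(p*) = √p if p ≡ 1 (mod 4) and √(p*) = i√p if p ≡ 3 (mod 4)). Then there exist integers b and c with 4p^h = b² + p₁c² and b·p^{(f−h)/2} ≡ −2 (mod p₁), where h is the class number of Q(√(−p₁)), such that: for all 0 ≤ t ≤ m−1, G(χ^{p₁^t}) = (−1)^{((p−1)/2)(m−1)} p^{(f−1)/2 − h p₁^t} √(p*) ((b + c·i√(p₁))/2)^{2p₁^t} if p₁ ≡ 3 (mod 8), and G(χ^{p₁^t}) = (−1)^{((p−1)/2)·m} p^{(f−1)/2} √(p*) if p₁ ≡ 7 (mod 8); for all 0 ≤ t ≤ m−1, G(χ^{2p₁^t}) = p^{(f − p₁^t h)/2} ((b + c·i√(p₁))/2)^{p₁^t}; and G(χ^{p₁^m}) = (−1)^{((p−1)/2)((f−1)/2)} p^{(f−1)/2} √(p*).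 -/

import Mathlib

open scoped Classical

/-- The canonical additive character `ψ(x) = exp(2πi·Tr_{q/p}(x)/p)` of a finite field of
characteristic `p`. -/
noncomputable def psi (p : ℕ) {F : Type*} [Field F] [Fintype F] [Algebra (ZMod p) F]
    (x : F) : ℂ :=
  Complex.exp (2 * Real.pi * Complex.I * ((Algebra.trace (ZMod p) F x).val : ℂ) / p)

/-- The Gauss sum `G(χ) = Σ_{x ∈ F_q^*} χ(x) ψ(x)`. -/
noncomputable def gaussSumF (p : ℕ) {F : Type*} [Field F] [Fintype F] [Algebra (ZMod p) F]
    (χ : MulChar F ℂ) : ℂ :=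
  ∑ x : Fˣ, χ (x : F) * psi p (x : F)

section
open Filter Topology

lemma abel_eq (e w : ℕ → ℂ) (C : ℝ) (hC : ∀ n, ‖∑ i ∈ Finset.range n, e i‖ ≤ C)
    (hs : Summable fun n => e n * w n) (hw : Tendsto w atTop (𝓝 0))
    (hd : Summable fun n => (∑ i ∈ Finset.range (n+1), e i) * (w n - w (n+1))) :
    ∑' n, e n * w n = ∑' n, (∑ i ∈ Finset.range (n+1), e i) * (w n - w (n+1)) := by
  have key : ∀ n, ∑ i ∈ Finset.range n, e i * w i =
      ∑ i ∈ Finset.range n, (∑ j ∈ Finset.range (i+1), e j) * (w i - w (i+1)) +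
        (∑ i ∈ Finset.range n, e i) * w n := by
    intro n
    induction n with
    | zero => simp
    | succ n ih => 
      rw [Finset.sum_range_succ, ih, Finset.sum_range_succ (fun i => (∑ j ∈ Finset.range (i+1), e j) * (w i - w (i+1))), Finset.sum_range_succ e]
      ring
  have h1 := hs.hasSum.tendsto_sum_nat
  have h2 := hd.hasSum.tendsto_sum_nat
  have h3 : Tendsto (fun n => (∑ i ∈ Finset.range n, e i) * w n) atTop (𝓝 0) := by
    have hwC : Tendsto (fun n => C * ‖w n‖) atTop (𝓝 0) := by
      simpa using (hw.norm).const_mul C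
    refine squeeze_zero_norm (fun n => ?_) hwC
    rw [norm_mul]
    exact mul_le_mul_of_nonneg_right (hC n) (norm_nonneg _)
  have h4 := h2.add h3
  rw [add_zero] at h4
  refine tendsto_nhds_unique h1 (h4.congr fun n => (key n).symm)

lemma abel_tendsto {ι : Type*} (𝓕 : Filter ι) (e : ℕ → ℂ) (w : ι → ℕ → ℝ) (C : ℝ) (hC : ∀ n, ‖∑ i ∈ Finset.range n, e i‖ ≤ C)
    (hs : ∀ᶠ x in 𝓕, Summable fun n => e n * (w x n : ℂ)) (hw : ∀ᶠ x in 𝓕, Tendsto (w x) atTop (𝓝 0))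
    (hb : ∀ᶠ x in 𝓕, ∀ n, |w x n - w x (n+1)| ≤ 2 / ((n:ℝ) + 1)^2)
    (hl : ∀ n, Tendsto (fun x => w x n) 𝓕 (𝓝 (1 / ((n:ℝ) + 1)))) :
    Tendsto (fun x => ∑' n, e n * (w x n : ℂ)) 𝓕
      (𝓝 (∑' n, (∑ i ∈ Finset.range (n+1), e i) * ((1 / ((n:ℝ) + 1) - 1 / (((n+1 : ℕ):ℝ) + 1) : ℝ) : ℂ))) := by
  have hC0 : 0 ≤ C := (norm_nonneg _).trans (hC 0)
  have hsum : Summable fun n : ℕ => C * (2 / ((n:ℝ) + 1)^2) := by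
    apply Summable.mul_left
    have := (summable_nat_add_iff 1).mpr (Real.summable_one_div_nat_pow.mpr (by norm_num : 1 < 2))
    convert this.mul_left 2 using 2 with n
    push_cast; ring
  have bnd : ∀ᶠ x in 𝓕, ∀ n, ‖(∑ i ∈ Finset.range (n+1), e i) * ((w x n - w x (n+1) : ℝ) : ℂ)‖ ≤ C * (2 / ((n:ℝ) + 1)^2) := by
    filter_upwards [hb] with x hx n
    rw [norm_mul, Complex.norm_real, Real.norm_eq_abs]
    exact mul_le_mul (hC _) (hx n) (abs_nonneg _) hC0
  have := tendsto_tsum_of_dominated_convergence (𝓕 := 𝓕) hsum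
    (f := fun x n => (∑ i ∈ Finset.range (n+1), e i) * ((w x n - w x (n+1) : ℝ) : ℂ))
    (g := fun n => (∑ i ∈ Finset.range (n+1), e i) * ((1 / ((n:ℝ) + 1) - 1 / (((n+1 : ℕ):ℝ) + 1) : ℝ) : ℂ))
    (fun n => by
      apply Tendsto.const_mul
      exact (Complex.continuous_ofReal.tendsto _).comp ((hl n).sub (hl (n+1)))) bnd
  refine this.congr' ?_
  filter_upwards [hs, hw, bnd] with x h1 h2 h3
  rw [abel_eq e (fun n => (w x n : ℂ)) C hC h1]
  · simp
  · exact (Complex.continuous_ofReal.tendsto' 0 0 (by simp)).comp h2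
  · simpa using Summable.of_norm_bounded hsum h3

lemma w1_bound (s : ℝ) (h1 : 1 ≤ s) (h2 : s ≤ 2) (n : ℕ) :
    |((n:ℝ) + 1)^(-s) - (((n+1:ℕ):ℝ) + 1)^(-s)| ≤ 2 / ((n:ℝ) + 1)^2 := by
  have hx : (0:ℝ) < (n:ℝ) + 1 := by positivity
  set x : ℝ := (n:ℝ) + 1 with hxd
  have e1 : (((n+1:ℕ):ℝ) + 1) = x + 1 := by push_cast; ring
  rw [e1]
  have hx1 : 1 ≤ x := by rw [hxd]; linarith [Nat.cast_nonneg (α := ℝ) n]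
  have le1 : (x+1)^(-s) ≤ x^(-s) := Real.rpow_le_rpow_of_nonpos hx (by linarith) (by linarith)
  rw [abs_of_nonneg (by linarith)]
  have r : (x+1)^(-s) = x^(-s) * (x/(x+1))^s := by
    rw [Real.div_rpow hx.le (by linarith), Real.rpow_neg hx.le, Real.rpow_neg (by linarith : 0 ≤ x+1)]
    have := (Real.rpow_pos_of_pos hx s).ne'
    field_simp
  have r2 : (x/(x+1))^(2:ℝ) ≤ (x/(x+1))^s :=
    Real.rpow_le_rpow_of_exponent_ge (by positivity) (by rw [div_le_one (by linarith)]; linarith) h2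
  have r3 : x^(-s) ≤ x⁻¹ := by
    rw [← Real.rpow_neg_one]
    exact Real.rpow_le_rpow_of_exponent_le hx1 (by linarith)
  have r4 : 0 ≤ x^(-s) := by positivity
  rw [r]
  rw [Real.rpow_two] at r2
  have r5 : 1 - (x/(x+1))^2 ≤ 2 / x := by
    rw [div_pow, sub_le_iff_le_add, ← sub_le_iff_le_add', le_div_iff₀ (by positivity), ]
    have : (1 - 2/x) * (x+1)^2 = (x - 2)*(x+1)^2/x := by field_simp
    rw [this, div_le_iff₀ hx]
    nlinarith
  have r6 : 0 ≤ 1 - (x/(x+1))^2 := by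
    have : (x/(x+1))^2 ≤ 1 := pow_le_one₀ (by positivity) (by rw [div_le_one (by linarith)]; linarith)
    linarith
  calc x^(-s) - x^(-s) * (x/(x+1))^s = x^(-s) * (1 - (x/(x+1))^s) := by ring
    _ ≤ x^(-s) * (1 - (x/(x+1))^2) := by gcongr
    _ ≤ x⁻¹ * (2/x) := mul_le_mul r3 r5 r6 (by positivity)
    _ = 2/x^2 := by field_simp

lemma w2_bound (r : ℝ) (h1 : 0 ≤ r) (h2 : r < 1) (n : ℕ) :
    |r^(n+1) / ((n:ℝ) + 1) - r^(n+1+1)/(((n+1:ℕ):ℝ) + 1)| ≤ 2 / ((n:ℝ) + 1)^2 := by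
  have hx : (0:ℝ) < (n:ℝ) + 1 := by positivity
  have k : ((n:ℝ)+1) * (r^(n+1) * (1-r)) ≤ 1 := by
    have g : (∑ i ∈ Finset.range (n+1), r^i) * (1-r) = 1 - r^(n+1) := geom_sum_mul_neg r (n+1)
    have : ((n:ℝ)+1) * r^(n+1) ≤ ∑ i ∈ Finset.range (n+1), r^i := by
      have := Finset.card_nsmul_le_sum (Finset.range (n+1)) (fun i => r^i) (r^(n+1)) (fun i hi => pow_le_pow_of_le_one h1 h2.le (Finset.mem_range.mp hi).le)
      simpa using this
    have p : 0 ≤ r^(n+1) := by positivity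
    nlinarith
  have p : 0 ≤ r^(n+1) := by positivity
  have p1 : r^(n+1) ≤ 1 := pow_le_one₀ h1 h2.le
  have e : r^(n+1) / ((n:ℝ) + 1) - r^(n+1+1)/(((n+1:ℕ):ℝ) + 1) = (r^(n+1)*(1-r))/((n:ℝ)+1) + r^(n+1+1) * (1/((n:ℝ)+1) - 1/((n:ℝ)+2)) := by
    push_cast; field_simp; ring
  have q : 1/((n:ℝ)+1) - 1/((n:ℝ)+2) = 1/(((n:ℝ)+1)*((n:ℝ)+2)) := by field_simp; ring
  have q0 : 1/(((n:ℝ)+1)*((n:ℝ)+2)) ≤ 1/((n:ℝ)+1)^2 := by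
    apply one_div_le_one_div_of_le (by positivity); nlinarith
  have q1 : r^(n+1+1) ≤ 1 := pow_le_one₀ h1 h2.le
  rw [e, q, abs_of_nonneg (by have : 0 ≤ 1-r := by linarith
                              positivity)]
  have a1 : (r^(n+1)*(1-r))/((n:ℝ)+1) ≤ 1/((n:ℝ)+1)^2 := by
    rw [div_le_div_iff₀ hx (by positivity)]; nlinarith
  have a2 : r^(n+1+1) * (1/(((n:ℝ)+1)*((n:ℝ)+2))) ≤ 1 * (1/(((n:ℝ)+1)*((n:ℝ)+2))) := by gcongr
  have : 2 / ((n:ℝ) + 1)^2 = 1/((n:ℝ)+1)^2 + 1/((n:ℝ)+1)^2 := by ring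
  linarith

end

section
open Filter Topology

lemma sum_range_zmod {M : Type*} [AddCommMonoid M] (N : ℕ) [NeZero N] (F : ZMod N → M) :
    ∑ i ∈ Finset.range N, F (i : ZMod N) = ∑ a : ZMod N, F a := by
  refine Finset.sum_nbij' (fun i => (i : ZMod N)) (fun a => a.val) ?_ ?_ ?_ ?_ ?_
  · intros; simp
  · intro a _; simpa using ZMod.val_lt a
  · intro i hi; exact ZMod.val_cast_of_lt (by simpa using hi)
  · intro a _; simp
  · intros; rfl

lemma char_partial_bound (l : ℕ) [NeZero l] (χ : DirichletCharacter ℂ l) (hχ : χ ≠ 1) (n : ℕ) :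
    ‖∑ i ∈ Finset.range n, χ ((i+1 : ℕ) : ZMod l)‖ ≤ l := by
  induction n using Nat.strong_induction_on with
  | _ n ih =>
    by_cases h : n < l
    · refine (norm_sum_le _ _).trans ?_
      refine (Finset.sum_le_card_nsmul _ _ 1 (fun i _ => DirichletCharacter.norm_le_one χ _)).trans ?_
      simp; exact_mod_cast h.le
    · obtain ⟨m, rfl⟩ := Nat.exists_eq_add_of_le' (not_lt.mp h)
      rw [Finset.sum_range_add]
      have : ∑ x ∈ Finset.range l, χ ((m + x + 1 : ℕ) : ZMod l) = 0 := by
        have := sum_range_zmod l (fun a => χ (a + ((m+1 : ℕ) : ZMod l)))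
        rw [show (∑ a : ZMod l, χ (a + ((m+1 : ℕ) : ZMod l))) = ∑ a, χ a from
          Equiv.sum_comp (Equiv.addRight ((m+1 : ℕ) : ZMod l)) χ, MulChar.sum_eq_zero_of_ne_one hχ] at this
        rw [← this]
        refine Finset.sum_congr rfl fun i _ => ?_
        congr 1; push_cast; ring
      rw [this, add_zero]
      exact ih m (by have := NeZero.pos l; omega)

noncomputable def LamLim (l : ℕ) (χ : DirichletCharacter ℂ l) : ℂ :=
  ∑' n : ℕ, (∑ i ∈ Finset.range (n+1), χ ((i+1 : ℕ) : ZMod l)) * ((1 / ((n:ℝ) + 1) - 1 / (((n+1 : ℕ):ℝ) + 1) : ℝ) : ℂ)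

lemma LSeries_tendsto_LamLim (l : ℕ) [NeZero l] (χ : DirichletCharacter ℂ l) (hχ : χ ≠ 1) :
    Tendsto (fun s : ℝ => LSeries (fun n => χ (n : ZMod l)) (s : ℂ)) (𝓝[>] 1) (𝓝 (LamLim l χ)) := by
  have key : ∀ s : ℝ, 1 < s → HasSum (fun n : ℕ => χ ((n+1:ℕ) : ZMod l) * (((n:ℝ)+1)^(-s) : ℝ)) (LSeries (fun n => χ (n : ZMod l)) (s : ℂ)) := by
    intro s hs
    have h1 := (DirichletCharacter.LSeriesSummable_of_one_lt_re χ (s := (s:ℂ)) (by simpa using hs)).LSeriesHasSum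
    have h2 := (hasSum_nat_add_iff' 1).mpr h1
    simp only [Finset.range_one, Finset.sum_singleton, LSeries.term_zero, sub_zero] at h2
    refine h2.congr_fun fun n => ?_
    rw [LSeries.term_of_ne_zero (by omega), Complex.ofReal_cpow (by positivity)]
    push_cast
    rw [Complex.cpow_neg]; rfl
  refine (abel_tendsto (𝓝[>] (1:ℝ)) (fun n => χ ((n+1:ℕ) : ZMod l)) (fun s n => ((n:ℝ)+1)^(-s)) l
    (char_partial_bound l χ hχ) ?_ ?_ ?_ ?_).congr' ?_
  · filter_upwards [self_mem_nhdsWithin] with s hs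
    exact (key s hs).summable
  · filter_upwards [self_mem_nhdsWithin] with s hs
    have hs' : (1:ℝ) < s := hs
    exact (tendsto_rpow_neg_atTop (by linarith)).comp (tendsto_atTop_add_const_right _ _ tendsto_natCast_atTop_atTop)
  · have : Set.Ioc (1:ℝ) 2 ∈ 𝓝[>] (1:ℝ) := Ioc_mem_nhdsGT (by norm_num)
    filter_upwards [this] with s hs n
    exact w1_bound s hs.1.le hs.2 n
  · intro n
    have : ContinuousAt (fun s : ℝ => ((n:ℝ)+1)^(-s)) 1 := by
      apply ContinuousAt.rpow continuousAt_const continuousAt_neg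
      left; positivity
    have h := this.tendsto
    simp only [Real.rpow_neg_one] at h
    rw [one_div]
    exact h.mono_left nhdsWithin_le_nhds
  · filter_upwards [self_mem_nhdsWithin] with s hs
    exact (key s hs).tsum_eq

lemma power_tendsto_LamLim (l : ℕ) [NeZero l] (χ : DirichletCharacter ℂ l) (hχ : χ ≠ 1) (h0 : χ 0 = 0) :
    Tendsto (fun r : ℝ => ∑' n : ℕ, χ (n : ZMod l) * ((r:ℂ)^n / n)) (𝓝[<] 1) (𝓝 (LamLim l χ)) := by
  have ev : Set.Ico (0:ℝ) 1 ∈ 𝓝[<] (1:ℝ) := Ico_mem_nhdsLT (by norm_num)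
  have key : ∀ r : ℝ, r ∈ Set.Ico (0:ℝ) 1 → Summable (fun n : ℕ => χ (n : ZMod l) * ((r:ℂ)^n / n)) := by
    intro r hr
    refine Summable.of_norm_bounded (g := fun n => r^n) (summable_geometric_of_lt_one hr.1 hr.2) fun n => ?_
    rw [norm_mul]
    refine (mul_le_mul_of_nonneg_right (DirichletCharacter.norm_le_one χ _) (norm_nonneg _)).trans ?_
    rw [one_mul, norm_div, norm_pow, Complex.norm_real, Real.norm_of_nonneg hr.1, Complex.norm_natCast]
    rcases Nat.eq_zero_or_pos n with rfl | hn
    · simp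
    · exact div_le_self (pow_nonneg hr.1 _) (by exact_mod_cast hn)
  have key2 : ∀ r : ℝ, r ∈ Set.Ico (0:ℝ) 1 → HasSum (fun n : ℕ => χ ((n+1:ℕ) : ZMod l) * ((r^(n+1) / ((n:ℝ)+1) : ℝ) : ℂ)) (∑' n : ℕ, χ (n : ZMod l) * ((r:ℂ)^n / n)) := by
    intro r hr
    have h2 := (hasSum_nat_add_iff' 1).mpr (key r hr).hasSum
    simp only [Finset.range_one, Finset.sum_singleton, Nat.cast_zero, h0, zero_mul, sub_zero] at h2
    refine h2.congr_fun fun n => ?_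
    push_cast; rfl
  refine (abel_tendsto (𝓝[<] (1:ℝ)) (fun n => χ ((n+1:ℕ) : ZMod l)) (fun r n => r^(n+1) / ((n:ℝ)+1)) l
    (char_partial_bound l χ hχ) ?_ ?_ ?_ ?_).congr' ?_
  · filter_upwards [ev] with r hr
    exact (key2 r hr).summable
  · filter_upwards [ev] with r hr
    have a := (tendsto_pow_atTop_nhds_zero_of_lt_one hr.1 hr.2).comp (tendsto_add_atTop_nat 1)
    refine squeeze_zero (fun n => div_nonneg (pow_nonneg hr.1 _) (by positivity)) (fun n => ?_) a
    exact div_le_self (pow_nonneg hr.1 _) (by linarith [Nat.cast_nonneg (α := ℝ) n])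
  · filter_upwards [ev] with r hr n
    exact w2_bound r hr.1 hr.2 n
  · intro n
    have : Continuous (fun r : ℝ => r^(n+1) / ((n:ℝ)+1)) := by fun_prop
    have h := this.tendsto 1
    simp only [one_pow] at h
    exact h.mono_left nhdsWithin_le_nhds
  · filter_upwards [ev] with r hr
    exact (key2 r hr).tsum_eq

end

section
open Filter Topology

lemma im_log_one_sub (t : ℝ) (h0 : 0 < t) (h1 : t < 1) :
    (Complex.log (1 - Complex.exp (2 * Real.pi * Complex.I * t))).im = Real.pi * t - Real.pi / 2 := by
  rw [Complex.log_im]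
  have hpi := Real.pi_pos
  have hs : 0 < 2 * Real.sin (Real.pi * t) := by
    have := Real.sin_pos_of_pos_of_lt_pi (x := Real.pi * t) (by positivity) (by nlinarith)
    linarith
  rw [← Complex.arg_mul_cos_add_sin_mul_I hs (θ := Real.pi * t - Real.pi / 2) ⟨by nlinarith, by nlinarith⟩]
  congr 1
  rw [show (2 * Real.pi * Complex.I * t : ℂ) = ((2 * (Real.pi * t) : ℝ) : ℂ) * Complex.I by push_cast; ring, Complex.exp_mul_I]
  rw [← Complex.ofReal_cos, ← Complex.ofReal_sin, ← Complex.ofReal_cos, ← Complex.ofReal_sin, Real.cos_two_mul, Real.sin_two_mul,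
    Real.cos_sub_pi_div_two, Real.sin_sub_pi_div_two]
  push_cast
  have := Complex.sin_sq_add_cos_sq (Real.pi * t)
  linear_combination (-2) * this

lemma one_sub_re_pos (z : ℂ) (hz : ‖z‖ = 1) (h : z ≠ 1) : 0 < (1 - z).re := by
  have h1 : z.re ≤ 1 := (Complex.re_le_norm z).trans hz.le
  rcases h1.lt_or_eq with h2 | h2
  · simpa using h2
  · exfalso; apply h
    have : z.re ^ 2 + z.im ^ 2 = 1 := by
      have := Complex.normSq_apply z
      rw [Complex.normSq_eq_norm_sq, hz] at this; nlinarith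
    apply Complex.ext
    · simpa using h2
    · rw [h2] at this; simp only [Complex.one_im]; nlinarith

lemma tau_LamLim (l : ℕ) [Fact l.Prime] (χ : DirichletCharacter ℂ l) (hχ : χ ≠ 1)
    (hq : χ.IsQuadratic) (hodd : χ (-1) = -1) :
    gaussSum χ (ZMod.stdAddChar (N := l)) * LamLim l χ =
      -(Complex.I * Real.pi / l * ∑ a : ZMod l, χ a * (a.val : ℂ)) := by
  set ψ := ZMod.stdAddChar (N := l) with hψ
  have h0 : χ 0 = 0 := MulChar.map_zero χ
  have hτ : ∀ n : ZMod l, ∑ a, χ a * ψ (n * a) = χ n * gaussSum χ ψ := by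
    intro n
    by_cases hn : n = 0
    · subst hn; simp [MulChar.sum_eq_zero_of_ne_one hχ, h0]
    · have := gaussSum_mulShift χ ψ (Units.mk0 n hn)
      rw [← this]
      simp only [Units.val_mk0]
      rw [← mul_assoc, ← sq, ← MulChar.pow_apply' χ two_ne_zero, hq.sq_eq_one, MulChar.one_apply (Ne.isUnit hn), one_mul]
      rfl
  have nz : ∀ a, ‖ψ a‖ = 1 := fun a => AddChar.norm_apply ψ a
  have hps : ∀ r : ℝ, r ∈ Set.Ico (0:ℝ) 1 → gaussSum χ ψ * ∑' n : ℕ, χ (n : ZMod l) * ((r:ℂ)^n / n) = ∑ a, χ a * (-Complex.log (1 - r * ψ a)) := by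
    intro r hr
    have hh : ∀ a : ZMod l, HasSum (fun n : ℕ => χ a * ((r * ψ a)^n / n)) (χ a * (-Complex.log (1 - r * ψ a))) := by
      intro a
      apply HasSum.mul_left
      apply Complex.hasSum_taylorSeries_neg_log
      rw [norm_mul, nz, mul_one, Complex.norm_real, Real.norm_of_nonneg hr.1]; exact hr.2
    have := hasSum_sum (s := Finset.univ) (fun a _ => hh a)
    rw [← this.tsum_eq, ← tsum_mul_left]
    congr 1; ext n
    calc _ = (χ (n : ZMod l) * gaussSum χ ψ) * ((r:ℂ)^n / n) := by ring
      _ = _ := by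
        rw [← hτ, Finset.sum_mul]
        refine Finset.sum_congr rfl fun a _ => ?_
        rw [← nsmul_eq_mul, AddChar.map_nsmul_eq_pow, mul_pow]; ring
  have ev : Set.Ico (0:ℝ) 1 ∈ 𝓝[<] (1:ℝ) := Ico_mem_nhdsLT (by norm_num)
  have ne1 : ∀ a : ZMod l, a ≠ 0 → ψ a ≠ 1 := by
    intro a ha h
    exact ha (ZMod.injective_stdAddChar (by rw [← hψ, h, AddChar.map_zero_eq_one]))
  have t1 : Tendsto (fun r : ℝ => ∑ a, χ a * (-Complex.log (1 - r * ψ a))) (𝓝[<] 1) (𝓝 (∑ a, χ a * (-Complex.log (1 - ψ a)))) := by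
    apply tendsto_finsetSum
    intro a _
    by_cases ha : a = 0
    · subst ha; simp [h0]
    apply Tendsto.const_mul
    apply Tendsto.neg
    have c : ContinuousAt (fun r : ℝ => Complex.log (1 - r * ψ a)) 1 := by
      apply ContinuousAt.clog (by fun_prop)
      left
      simpa using one_sub_re_pos (ψ a) (nz a) (ne1 a ha)
    have := c.tendsto
    simp only [Complex.ofReal_one, one_mul] at this
    exact this.mono_left nhdsWithin_le_nhds
  have t2 := (power_tendsto_LamLim l χ hχ h0).const_mul (gaussSum χ ψ)
  have e1 : gaussSum χ ψ * LamLim l χ = ∑ a, χ a * (-Complex.log (1 - ψ a)) := by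
    refine tendsto_nhds_unique t2 (t1.congr' ?_)
    filter_upwards [ev] with r hr
    exact (hps r hr).symm
  rw [e1]
  set T := ∑ a, χ a * (-Complex.log (1 - ψ a)) with hT
  have e2 : T = ∑ a, χ a * ((starRingEnd ℂ) (Complex.log (1 - ψ a))) := by
    rw [hT, ← Equiv.sum_comp (Equiv.neg (ZMod l))]
    refine Finset.sum_congr rfl fun a _ => ?_
    simp only [Equiv.neg_apply]
    by_cases ha : a = 0
    · subst ha; simp [h0]
    rw [show χ (-a) = - χ a by rw [← neg_one_mul, map_mul, hodd]; ring]
    rw [← Complex.log_conj]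
    · rw [map_sub, map_one, AddChar.map_neg_eq_conj]; ring
    · have := one_sub_re_pos (ψ a) (nz a) (ne1 a ha)
      intro h
      rw [Complex.arg_eq_pi_iff] at h
      linarith [h.1]
  have e3 : 2 * T = ∑ a, χ a * (-(2 * Complex.I * ((Real.pi * ((a.val : ℝ) / l) - Real.pi / 2 : ℝ) : ℂ))) := by
    rw [two_mul]; nth_rewrite 2 [e2]
    rw [hT, ← Finset.sum_add_distrib]
    refine Finset.sum_congr rfl fun a _ => ?_
    by_cases ha : a = 0
    · subst ha; simp [h0]
    have hlp : (0:ℝ) < l := by exact_mod_cast (Fact.out : l.Prime).pos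
    have hv : 0 < a.val := Nat.pos_of_ne_zero (by simpa [ZMod.val_eq_zero] using ha)
    have hv2 : a.val < l := ZMod.val_lt a
    have := im_log_one_sub ((a.val:ℝ)/l) (by positivity) (by rw [div_lt_one hlp]; exact_mod_cast hv2)
    have hza : ψ a = Complex.exp (2 * Real.pi * Complex.I * (((a.val:ℝ)/l : ℝ) : ℂ)) := by
      have := ZMod.stdAddChar_coe (N := l) (a.val : ℤ)
      rw [hψ]
      rw [Int.cast_natCast, ZMod.natCast_zmod_val, Int.cast_natCast] at this
      rw [this]; congr 1; push_cast; ring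
    rw [← hza] at this
    rw [← this]
    set L := Complex.log (1 - ψ a)
    have : L - (starRingEnd ℂ) L = 2 * Complex.I * L.im := by rw [Complex.sub_conj]; push_cast; ring
    rw [← this]; ring
  have s0 : ∑ a, χ a = 0 := MulChar.sum_eq_zero_of_ne_one hχ
  have e4 : ∑ a, χ a * (-(2 * Complex.I * ((Real.pi * ((a.val : ℝ) / l) - Real.pi / 2 : ℝ) : ℂ))) = 
     Complex.I * Real.pi * (∑ a, χ a) - 2 * (Complex.I * Real.pi / l * ∑ a : ZMod l, χ a * (a.val : ℂ)) := by
    rw [Finset.mul_sum, Finset.mul_sum, Finset.mul_sum, ← Finset.sum_sub_distrib]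
    refine Finset.sum_congr rfl fun a _ => ?_
    push_cast; ring
  rw [e4, s0] at e3
  linear_combination (1/2) * e3

end

section
open Filter Topology

lemma rat_of_isIntegral_complex (r : ℚ) (h : IsIntegral ℤ (r : ℂ)) : ∃ n : ℤ, r = n := by
  have h1 : IsIntegral ℤ r := by
    have : IsIntegral ℤ (algebraMap ℚ ℂ r) := by simpa using h
    exact (isIntegral_algebraMap_iff (algebraMap ℚ ℂ).injective).mp this
  obtain ⟨n, hn⟩ := IsIntegrallyClosed.isIntegral_iff.mp h1
  exact ⟨n, by rw [← hn]; simp⟩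

lemma isq_sq (l : ℕ) : (Complex.I * (Real.sqrt (l : ℝ) : ℂ))^2 = -(l : ℂ) := by
  rw [mul_pow, Complex.I_sq, ← Complex.ofReal_pow, Real.sq_sqrt (Nat.cast_nonneg l)]; push_cast; ring

lemma isq_conj (l : ℕ) : (starRingEnd ℂ) (Complex.I * (Real.sqrt (l : ℝ) : ℂ)) = -(Complex.I * (Real.sqrt (l : ℝ) : ℂ)) := by
  simp

lemma quad_int (l : ℕ) (hl : l.Prime) (r s : ℚ)
    (h : IsIntegral ℤ ((r : ℂ) + s * (Complex.I * (Real.sqrt (l : ℝ) : ℂ)))) :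
    ∃ B C : ℤ, 2 * r = B ∧ 2 * s = C ∧ (4 : ℤ) ∣ B^2 + l * C^2 := by
  set z : ℂ := (r : ℂ) + s * (Complex.I * (Real.sqrt (l : ℝ) : ℂ)) with hz
  have hc : (starRingEnd ℂ) z = r - s * (Complex.I * (Real.sqrt (l : ℝ) : ℂ)) := by
    rw [hz, map_add, map_mul, isq_conj]; simp [sub_eq_add_neg]
  have hci : IsIntegral ℤ ((starRingEnd ℂ) z) := by
    have := h.map (Complex.conjAe.toAlgHom.restrictScalars ℤ)
    exact this
  obtain ⟨B, hB⟩ := rat_of_isIntegral_complex (2 * r) (by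
    have := h.add hci
    rw [hc, hz] at this
    have e : (((2 * r : ℚ)) : ℂ) = ((r : ℂ) + s * (Complex.I * (Real.sqrt (l : ℝ) : ℂ))) + (r - s * (Complex.I * (Real.sqrt (l : ℝ) : ℂ))) := by
      push_cast; ring
    rw [e]; exact this)
  obtain ⟨n, hn⟩ := rat_of_isIntegral_complex (r^2 + l * s^2) (by
    have := h.mul hci
    rw [hc, hz] at this
    have e : (((r^2 + l * s^2 : ℚ)) : ℂ) = ((r : ℂ) + s * (Complex.I * (Real.sqrt (l : ℝ) : ℂ))) * (r - s * (Complex.I * (Real.sqrt (l : ℝ) : ℂ))) := by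
      push_cast
      linear_combination ((s:ℂ)^2) * isq_sq l
    rw [e]; exact this)
  have e1 : (l * (2 * s))^2 = ((l * (4 * n - B^2) : ℤ) : ℚ) := by
    push_cast; rw [← hn, ← hB]; ring
  obtain ⟨D, hD⟩ := rat_of_isIntegral_complex (l * (2 * s)) (by
    apply IsIntegral.of_pow (n := 2) two_pos
    have : ((((l * (2 * s))^2 : ℚ)) : ℂ) = ((l * (4 * n - B^2) : ℤ) : ℂ) := by rw [e1]; push_cast; rfl
    rw [← Rat.cast_pow, this]
    exact isIntegral_algebraMap (R := ℤ) (A := ℂ) (x := (l * (4 * n - B^2) : ℤ)))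
  have e2 : D^2 = l * (4 * n - B^2) := by
    rw [hD] at e1; exact_mod_cast e1
  have : (l : ℤ) ∣ D := (Nat.prime_iff_prime_int.mp hl).dvd_of_dvd_pow ⟨_, e2⟩
  obtain ⟨C, rfl⟩ := this
  have hl0 : (l : ℚ) ≠ 0 := by exact_mod_cast hl.ne_zero
  have hC : 2 * s = C := by
    push_cast at hD; exact mul_left_cancel₀ hl0 hD
  refine ⟨B, C, hB, hC, n, ?_⟩
  have hl0' : (l : ℤ) ≠ 0 := by exact_mod_cast hl.ne_zero
  have : (l : ℤ) * C^2 = 4 * n - B^2 := mul_left_cancel₀ hl0' (by rw [← e2]; ring)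
  linarith

lemma quad_repr (l : ℕ) (K : Type*) [Field K] [NumberField K] (α : K) (hα : α ^ 2 = -(l : K)) (hKα : Algebra.adjoin ℚ {α} = ⊤) (x : K) : ∃ r s : ℚ, x = r + s * α := by
  have hx : x ∈ Algebra.adjoin ℚ {α} := hKα ▸ Algebra.mem_top
  induction hx using Algebra.adjoin_induction with
  | mem x hx => simp at hx; subst hx; exact ⟨0, 1, by simp⟩
  | algebraMap r => exact ⟨r, 0, by simp⟩
  | add x y _ _ h1 h2 =>
    obtain ⟨r, s, rfl⟩ := h1; obtain ⟨r', s', rfl⟩ := h2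
    exact ⟨r + r', s + s', by push_cast; ring⟩
  | mul x y _ _ h1 h2 =>
    obtain ⟨r, s, rfl⟩ := h1; obtain ⟨r', s', rfl⟩ := h2
    refine ⟨r * r' - l * (s * s'), r * s' + s * r', ?_⟩
    push_cast; linear_combination (s * s' : K) * hα

lemma quad_embed (l : ℕ) (K : Type*) [Field K] [NumberField K] (α : K) (hα : α ^ 2 = -(l : K)) (σ : K →+* ℂ) : ∃ u : ℤ, (u = 1 ∨ u = -1) ∧ σ α = u * (Complex.I * (Real.sqrt (l : ℝ) : ℂ)) := by
  have : (σ α)^2 = (Complex.I * (Real.sqrt (l : ℝ) : ℂ))^2 := by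
    rw [← map_pow, hα, isq_sq]; simp
  rcases sq_eq_sq_iff_eq_or_eq_neg.mp this with h | h
  · exact ⟨1, Or.inl rfl, by rw [h]; simp⟩
  · exact ⟨-1, Or.inr rfl, by rw [h]; simp⟩

lemma quad_indep (l : ℕ) [Fact l.Prime] (K : Type*) [Field K] [NumberField K] (α : K) (hα : α ^ 2 = -(l : K)) (r s : ℚ) (h : (r : K) + s * α = 0) : r = 0 ∧ s = 0 := by
  have hs : s = 0 := by
    by_contra hs
    have hsK : (s : K) ≠ 0 := by exact_mod_cast hs
    have : (r : K)^2 = - (l * s^2) := by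
      have : (r:K) = - (s * α) := by linear_combination h
      rw [this]; linear_combination (s:K)^2 * hα
    have h2 : r^2 = -(l * s^2) := by exact_mod_cast this
    have hl : (0:ℚ) < l := by exact_mod_cast (Fact.out : l.Prime).pos
    have : 0 < l * s^2 := by positivity
    nlinarith [sq_nonneg r]
  subst hs
  simpa using h

open NumberField

lemma quad_basis (l : ℕ) [Fact l.Prime] (c : ℕ) (hc : l + 1 = 4 * c) (K : Type*) [Field K] [NumberField K] (α : K) (hα : α ^ 2 = -(l : K)) (hKα : Algebra.adjoin ℚ {α} = ⊤) : ∃ b : Module.Basis (Fin 2) ℤ (𝓞 K), b 0 = 1 ∧ (b 1)^2 = b 1 - (c : 𝓞 K) ∧ algebraMap (𝓞 K) K (b 1) = (1 + α)/2 := by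
  have hcK : (l : K) + 1 = 4 * c := by exact_mod_cast congrArg (Nat.cast (R := K)) hc
  have h2 : (2:K) ≠ 0 := two_ne_zero
  have hq : ((1 + α)/2)^2 = (1 + α)/2 - (c : K) := by
    field_simp
    linear_combination hα - hcK
  have hintg : IsIntegral ℤ ((1 + α)/2) := by
    refine ⟨Polynomial.X^2 - Polynomial.X + Polynomial.C (c:ℤ), ?_, ?_⟩
    · monicity!
    · simp [hq]
  let ω : 𝓞 K := ⟨(1 + α)/2, hintg⟩
  have hωK : algebraMap (𝓞 K) K ω = (1 + α)/2 := rfl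
  have li : LinearIndependent ℤ ![(1 : 𝓞 K), ω] := by
    rw [LinearIndependent.pair_iff]
    intro s t h
    have h' := congrArg (algebraMap (𝓞 K) K) h
    simp only [zsmul_eq_mul, mul_one, map_add, map_mul, map_intCast, map_zero] at h'
    rw [hωK] at h'
    have := quad_indep l K α hα (s + t/2) (t/2) (by push_cast; linear_combination h')
    have ht : (t:ℚ) = 0 := by linarith [this.2]
    have hs : (s:ℚ) = 0 := by linarith [this.1]
    exact ⟨by exact_mod_cast hs, by exact_mod_cast ht⟩
  have sp : ⊤ ≤ Submodule.span ℤ (Set.range ![(1 : 𝓞 K), ω]) := by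
    intro x _
    obtain ⟨r, s, hx⟩ := quad_repr l K α hα hKα (x : K)
    obtain ⟨σ⟩ : Nonempty (K →+* ℂ) := inferInstance
    obtain ⟨u, hu, hσ⟩ := quad_embed l K α hα σ
    have hi : IsIntegral ℤ (σ (x : K)) := x.isIntegral_coe.map σ.toIntAlgHom
    obtain ⟨B, C, hB, hC, hd⟩ := quad_int l Fact.out r (s * u) (by
      rw [hx] at hi; convert hi using 1
      simp [hσ]; ring)
    have hpar : (2:ℤ) ∣ B - u * C := by
      have hc' : (l : ℤ) = 4 * c - 1 := by have := congrArg (Nat.cast (R := ℤ)) hc; push_cast at this; linarith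
      have : (4:ℤ) ∣ (B - C) * (B + C) := by
        obtain ⟨k, hk⟩ := hd
        refine ⟨k - c * C^2, ?_⟩
        rw [hc'] at hk; linear_combination hk
      have h22 : (2:ℤ) ∣ (B - C) * (B + C) := Dvd.dvd.trans (by norm_num) this
      rcases hu with rfl | rfl <;> rcases Int.prime_two.dvd_or_dvd h22 with h | h <;> omega
    obtain ⟨A, hA⟩ := hpar
    have hu2 : (u:ℚ)^2 = 1 := by rcases hu with rfl | rfl <;> norm_num
    have hs2 : 2 * s = u * C := by rw [← hC]; linear_combination (-2 * s) * hu2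
    have hA' : (B:ℚ) - u * C = 2 * A := by exact_mod_cast hA
    have : x = A • (1 : 𝓞 K) + (u * C) • ω := by
      apply RingOfIntegers.coe_injective
      simp only [zsmul_eq_mul, mul_one, map_add, map_mul, map_intCast]
      have hx' : algebraMap (𝓞 K) K x = r + s * α := hx
      rw [hωK, hx']
      have e1 : r = A + u * C / 2 := by linarith
      have e2 : s = u * C / 2 := by linarith
      rw [e1, e2]; push_cast; ring
    rw [this]
    apply Submodule.add_mem <;> apply Submodule.smul_mem <;> apply Submodule.subset_span <;> simp
  refine ⟨Module.Basis.mk li sp, by simp, ?_, by simp [hωK]⟩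
  rw [Module.Basis.mk_apply]
  apply RingOfIntegers.coe_injective
  simp [hωK, hq]

end

section
open Filter Topology

open NumberField in
lemma quad_totallyComplex (l : ℕ) [Fact l.Prime] (K : Type*) [Field K] [NumberField K] (α : K)
    (hα : α ^ 2 = -(l : K)) : IsTotallyComplex K := by
  refine ⟨fun w => ?_⟩
  rw [← InfinitePlace.not_isReal_iff_isComplex, InfinitePlace.isReal_iff]
  intro h
  obtain ⟨u, hu, hσ⟩ := quad_embed l K α hα w.embedding
  have h1 : (starRingEnd ℂ) (w.embedding α) = w.embedding α := by
    have := RingHom.congr_fun h α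
    simpa using this
  rw [hσ, map_mul, isq_conj] at h1
  have hl : (0:ℝ) < l := by exact_mod_cast (Fact.out : l.Prime).pos
  have hne : Complex.I * (Real.sqrt (l : ℝ) : ℂ) ≠ 0 := by
    have := (Real.sqrt_pos.mpr hl).ne'
    simp
    exact_mod_cast (Fact.out : l.Prime).ne_zero
  have hu0 : ((u : ℤ) : ℂ) ≠ 0 := by rcases hu with rfl | rfl <;> norm_num
  have hcu : (starRingEnd ℂ) ((u : ℤ) : ℂ) = u := by simp
  rw [hcu] at h1
  have : ((u : ℤ) : ℂ) * (Complex.I * (Real.sqrt (l : ℝ) : ℂ)) = 0 := by linear_combination (-1/2 : ℂ) * h1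
  exact (mul_ne_zero hu0 hne) this

open NumberField in
lemma quad_discr (l : ℕ) [Fact l.Prime] (c : ℕ) (hc : l + 1 = 4 * c) (K : Type*) [Field K]
    [NumberField K] (b : Module.Basis (Fin 2) ℤ (𝓞 K)) (h0 : b 0 = 1)
    (h1 : (b 1)^2 = b 1 - (c : 𝓞 K)) : NumberField.discr K = - l := by
  rw [← NumberField.discr_eq_discr K b, Algebra.discr_def, Matrix.det_fin_two]
  simp only [Algebra.traceMatrix_apply, Algebra.traceForm_apply, h0, mul_one, one_mul]
  have t1 : Algebra.trace ℤ (𝓞 K) 1 = 2 := by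
    rw [Algebra.trace_eq_matrix_trace b, map_one]; simp
  have t2 : Algebra.trace ℤ (𝓞 K) (b 1) = 1 := by
    rw [Algebra.trace_eq_matrix_trace b, Matrix.trace_fin_two]
    rw [Algebra.leftMulMatrix_eq_repr_mul, Algebra.leftMulMatrix_eq_repr_mul, h0, mul_one, ← sq, h1]
    have : (c : 𝓞 K) = (c:ℤ) • b 0 := by rw [h0]; simp
    rw [this, map_sub, map_smul]
    simp
  have t3 : Algebra.trace ℤ (𝓞 K) (b 1 * b 1) = 1 - 2 * c := by
    have : (c : 𝓞 K) = (c:ℤ) • 1 := by simp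
    rw [← sq, h1, map_sub, t2, this, map_smul, t1]; simp [mul_comm]
  rw [t1, t2, t3]
  have : (l : ℤ) + 1 = 4 * c := by exact_mod_cast hc
  linarith

open NumberField in
lemma quad_torsion (l : ℕ) [Fact l.Prime] (h4 : 4 < l) (K : Type*) [Field K]
    [NumberField K] (α : K) (hα : α ^ 2 = -(l : K)) (hKα : Algebra.adjoin ℚ {α} = ⊤) :
    Units.torsionOrder K = 2 := by
  have key : ∀ u ∈ Units.torsion K, u = 1 ∨ u = -1 := by
    intro v hv
    obtain ⟨σ⟩ : Nonempty (K →+* ℂ) := inferInstance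
    obtain ⟨r, s, hx⟩ := quad_repr l K α hα hKα (algebraMap (𝓞 K) K (v : 𝓞 K))
    obtain ⟨u, hu, hσ⟩ := quad_embed l K α hα σ
    have hi : IsIntegral ℤ (σ (algebraMap (𝓞 K) K (v : 𝓞 K))) := (v : 𝓞 K).isIntegral_coe.map σ.toIntAlgHom
    have hval : σ (algebraMap (𝓞 K) K (v : 𝓞 K)) = (r : ℂ) + ((s * u : ℚ) : ℂ) * (Complex.I * (Real.sqrt (l : ℝ) : ℂ)) := by
      rw [hx]; simp [hσ]; ring
    obtain ⟨B, C, hB, hC, hd⟩ := quad_int l Fact.out r (s * u) (by rwa [← hval])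
    have hn : ‖σ (algebraMap (𝓞 K) K (v : 𝓞 K))‖ = 1 := by
      have := (Units.mem_torsion K).mp hv (InfinitePlace.mk σ)
      simpa using this
    have hn2 : r^2 + l * (s * u)^2 = 1 := by
      have h1 : σ (algebraMap (𝓞 K) K (v : 𝓞 K)) * (starRingEnd ℂ) (σ (algebraMap (𝓞 K) K (v : 𝓞 K))) = 1 := by
        rw [Complex.mul_conj, Complex.normSq_eq_norm_sq, hn]; simp
      rw [hval, map_add, map_mul, isq_conj] at h1
      simp only [map_ratCast] at h1
      have h2 : ((r^2 + l * (s*u)^2 : ℚ) : ℂ) = 1 := by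
        push_cast at h1 ⊢
        linear_combination h1 + ((s:ℂ)*u)^2 * isq_sq l
      exact_mod_cast h2
    have e : B^2 + l * C^2 = 4 := by
      have : ((B^2 + l * C^2 : ℤ) : ℚ) = 4 := by push_cast; rw [← hB, ← hC]; linarith
      exact_mod_cast this
    have hl4 : (4:ℤ) < l := by exact_mod_cast h4
    have hC0 : C = 0 := by
      by_contra h
      have : 0 < C^2 := by positivity
      nlinarith [sq_nonneg B]
    have hu0 : (u:ℚ) ≠ 0 := by rcases hu with rfl | rfl <;> norm_num
    have hs : s = 0 := by
      rw [hC0] at hC; simpa [hu0] using hC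
    have hB2 : B = 2 ∨ B = -2 := by
      rw [hC0] at e
      have : (B-2)*(B+2) = 0 := by linarith
      rcases mul_eq_zero.mp this with h | h <;> omega
    have hx2 : algebraMap (𝓞 K) K (v : 𝓞 K) = r := by rw [hx, hs]; simp
    rcases hB2 with h | h
    · left
      have : r = 1 := by rw [h] at hB; push_cast at hB; linarith
      apply Units.ext; apply RingOfIntegers.coe_injective; rw [hx2, this]; simp
    · right
      have : r = -1 := by rw [h] at hB; push_cast at hB; linarith
      apply Units.ext; apply RingOfIntegers.coe_injective; rw [hx2, this]; simp
  have hle : Units.torsionOrder K ≤ 2 := by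
    rw [Units.torsionOrder, ← SetLike.coe_sort_coe, Nat.card_coe_set_eq]
    calc _ ≤ ({1, -1} : Set (𝓞 K)ˣ).ncard := Set.ncard_le_ncard (fun x hx => by simpa using key x hx)
      _ ≤ 2 := (Set.ncard_insert_le _ _).trans (by simp)
  have h1 := Units.torsionOrder_pos K
  obtain ⟨k, hk⟩ := Units.even_torsionOrder K
  omega

lemma det_isEmpty_aux {n : Type*} (he : IsEmpty n) (i1 : DecidableEq n) (i2 : Fintype n)
    (A : Matrix n n ℝ) : @Matrix.det n i1 i2 ℝ _ A = 1 := Matrix.det_isEmpty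

open NumberField in
lemma quad_residue (l : ℕ) [Fact l.Prime] (h4 : 4 < l) (hl : l % 4 = 3) (K : Type*) [Field K]
    [NumberField K] (α : K) (hα : α ^ 2 = -(l : K)) (hKα : Algebra.adjoin ℚ {α} = ⊤) :
    dedekindZeta_residue K = Real.pi * classNumber K / Real.sqrt l := by
  obtain ⟨b, h0, h1, -⟩ := quad_basis l ((l+1)/4) (by omega) K α hα hKα
  have hd := quad_discr l ((l+1)/4) (by omega) K b h0 h1
  have htc := quad_totallyComplex l K α hα
  have hr0 := IsTotallyComplex.nrRealPlaces_eq_zero K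
  have hfr : Module.finrank ℚ K = 2 := by
    rw [← RingOfIntegers.rank, Module.finrank_eq_card_basis b]; simp
  have hc1 : InfinitePlace.nrComplexPlaces K = 1 := by
    have := InfinitePlace.card_add_two_mul_card_eq_rank K
    omega
  have hreg : Units.regulator K = 1 := by
    obtain ⟨w⟩ : Nonempty (InfinitePlace K) := inferInstance
    have hcard : Fintype.card (InfinitePlace K) = 1 := by
      rw [InfinitePlace.card_eq_nrRealPlaces_add_nrComplexPlaces]; omega
    have hemp : IsEmpty {w' // w' ≠ w} := by
      have hsub : Subsingleton (InfinitePlace K) := Fintype.card_le_one_iff_subsingleton.mp hcard.le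
      exact ⟨fun x => x.2 (Subsingleton.elim _ _)⟩
    have hrk : Units.rank K = 0 := by rw [Units.rank, hcard]
    have hrk' : IsEmpty (Fin (Units.rank K)) := by rw [hrk]; infer_instance
    have := Units.regulator_eq_det K w (Equiv.equivOfIsEmpty _ _)
    rw [this]
    rw [det_isEmpty_aux hemp]; simp
  rw [dedekindZeta_residue_def, hr0, hc1, hreg, quad_torsion l h4 K α hα hKα, hd]
  simp
  field_simp

end

section
open Filter Topology

open NumberField Ideal in
lemma card_ideal_mul (K : Type*) [Field K] [NumberField K] (m n : ℕ) (hmn : m.Coprime n) 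
    (hm : m ≠ 0) (hn : n ≠ 0) :
    Nat.card {I : Ideal (𝓞 K) // absNorm I = m * n} =
      Nat.card {I : Ideal (𝓞 K) // absNorm I = m} * Nat.card {I : Ideal (𝓞 K) // absNorm I = n} := by
  rw [← Nat.card_prod]
  have hbez : ∀ x : 𝓞 K, ∃ u v : 𝓞 K, x = u * m + v * n := by
    intro x
    obtain ⟨u, v, h⟩ : IsCoprime (m : 𝓞 K) (n : 𝓞 K) := hmn.cast
    exact ⟨x * u, x * v, by linear_combination (-x) * h⟩
  symm
  refine Nat.card_congr (Equiv.ofBijective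
    (fun x => ⟨x.1.1 * x.2.1, by rw [map_mul, x.1.2, x.2.2]⟩) ⟨?_, ?_⟩)
  · have key : ∀ I J : Ideal (𝓞 K), ∀ m n : ℕ, (∀ x : 𝓞 K, ∃ u v : 𝓞 K, x = u * m + v * n) →  absNorm I = m → absNorm J = n → I * J ⊔ span {(m : 𝓞 K)} = I := by
      intro I J m n hb hI hJ
      apply le_antisymm
      · apply sup_le Ideal.mul_le_left
        rw [span_singleton_le_iff_mem, ← hI]; exact absNorm_mem I
      · intro x hx
        obtain ⟨u, v, h⟩ := hb x
        obtain ⟨u', v', h'⟩ := hb 1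
        rw [Submodule.mem_sup]
        refine ⟨x * (v' * n), Ideal.mul_mem_mul hx (Ideal.mul_mem_left _ _ (hJ ▸ absNorm_mem J)), x * (u' * m), ?_, by linear_combination (-x) * h'⟩
        rw [mem_span_singleton]; exact ⟨x * u', by ring⟩
    rintro ⟨⟨I, hI⟩, ⟨J, hJ⟩⟩ ⟨⟨I', hI'⟩, ⟨J', hJ'⟩⟩ h
    simp only [Subtype.mk.injEq] at h
    have h1 : I = I' := by
      rw [← key I J m n hbez hI hJ, h, key I' J' m n hbez hI' hJ']
    have hbez' : ∀ x : 𝓞 K, ∃ u v : 𝓞 K, x = u * n + v * m := fun x => by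
      obtain ⟨u, v, h⟩ := hbez x; exact ⟨v, u, by rw [h]; ring⟩
    have h2 : J = J' := by
      rw [← key J I n m hbez' hJ hI, mul_comm, h, mul_comm, key J' I' n m hbez' hJ' hI']
    subst h1 h2; rfl
  · rintro ⟨X, hX⟩
    have hXmn : ((m * n : ℕ) : 𝓞 K) ∈ X := hX ▸ absNorm_mem X
    have hprod : (X ⊔ span {(m : 𝓞 K)}) * (X ⊔ span {(n : 𝓞 K)}) = X := by
      apply le_antisymm
      · rw [Ideal.sup_mul, Ideal.mul_sup, Ideal.mul_sup]
        refine sup_le (sup_le Ideal.mul_le_right Ideal.mul_le_left) (sup_le Ideal.mul_le_right ?_)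
        rw [span_singleton_mul_span_singleton, span_singleton_le_iff_mem]
        exact_mod_cast hXmn
      · intro x hx
        obtain ⟨u, v, h⟩ := hbez 1
        have : x = (u * m) * x + x * (v * n) := by linear_combination x * h
        rw [this]
        apply Ideal.add_mem
        · exact Ideal.mul_mem_mul (Ideal.mul_mem_left _ _ (Ideal.mem_sup_right (mem_span_singleton_self _))) (Ideal.mem_sup_left hx)
        · exact Ideal.mul_mem_mul (Ideal.mem_sup_left hx) (Ideal.mul_mem_left _ _ (Ideal.mem_sup_right (mem_span_singleton_self _)))
    have hN := congrArg absNorm hprod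
    rw [map_mul, hX] at hN
    have hsp : ∀ k : ℕ, absNorm (X ⊔ span {(k : 𝓞 K)}) ∣ k ^ Module.finrank ℤ (𝓞 K) := by
      intro k
      have : absNorm (X ⊔ span {(k : 𝓞 K)}) ∣ absNorm (span {(k : 𝓞 K)}) := absNorm_dvd_absNorm_of_le le_sup_right
      rwa [absNorm_span_natCast] at this
    have h1 : absNorm (X ⊔ span {(m : 𝓞 K)}) ∣ m := by
      apply Nat.Coprime.dvd_of_dvd_mul_right (n := n)
      · exact Nat.Coprime.coprime_dvd_left (hsp m) (hmn.pow_left _)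
      · rw [← hN]; exact dvd_mul_right _ _
    have h2 : absNorm (X ⊔ span {(n : 𝓞 K)}) ∣ n := by
      apply Nat.Coprime.dvd_of_dvd_mul_left (m := m)
      · exact Nat.Coprime.coprime_dvd_left (hsp n) (hmn.symm.pow_left _)
      · rw [← hN]; exact dvd_mul_left _ _
    have h3 : absNorm (X ⊔ span {(m : 𝓞 K)}) = m := by
      obtain ⟨a, ha⟩ := h1
      obtain ⟨b, hb⟩ := h2
      set A := absNorm (X ⊔ span {(m : 𝓞 K)})
      set B := absNorm (X ⊔ span {(n : 𝓞 K)})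
      have : A * B * 1 = A * B * (a * b) := by
        rw [mul_one]; nlinarith [congrArg (· * n) ha, congrArg (A * a * ·) hb]
      have hAB : A * B ≠ 0 := by rw [hN]; positivity
      have := mul_left_cancel₀ hAB this
      have := Nat.eq_one_of_mul_eq_one_right this.symm
      rw [ha, this, mul_one]
    have h4 : absNorm (X ⊔ span {(n : 𝓞 K)}) = n := by
      rw [h3] at hN; exact mul_left_cancel₀ hm hN
    exact ⟨⟨⟨_, h3⟩, ⟨_, h4⟩⟩, Subtype.ext hprod⟩

open NumberField Ideal in
lemma card_ideal_inert (K : Type*) [Field K] [NumberField K] (hK : Module.finrank ℤ (𝓞 K) = 2)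
    (q : ℕ) (hq : q.Prime) (h0 : ∀ I : Ideal (𝓞 K), absNorm I ≠ q) (k : ℕ) :
    Nat.card {I : Ideal (𝓞 K) // absNorm I = q ^ k} = if Even k then 1 else 0 := by
  have hnq : absNorm (span {(q : 𝓞 K)}) = q ^ 2 := by rw [absNorm_span_natCast, hK]
  have hP : Prime (span {(q : 𝓞 K)}) := by
    rw [← irreducible_iff_prime]
    refine ⟨?_, ?_⟩
    · rw [Ideal.isUnit_iff, ← absNorm_eq_one_iff, hnq]
      have := hq.one_lt
      nlinarith
    · intro A B hAB
      have : absNorm A * absNorm B = q ^ 2 := by rw [← map_mul, ← hAB, hnq]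
      obtain ⟨i, hi, hA⟩ := (Nat.dvd_prime_pow hq).mp (Dvd.intro _ this)
      rw [Ideal.isUnit_iff, Ideal.isUnit_iff, ← absNorm_eq_one_iff, ← absNorm_eq_one_iff]
      interval_cases i
      · left; simpa using hA
      · exact absurd (by simpa using hA) (h0 A)
      · right
        rw [hA] at this
        exact Nat.eq_of_mul_eq_mul_left (pow_pos hq.pos 2) (by rw [this, mul_one])
  have hform : ∀ I : Ideal (𝓞 K), absNorm I = q ^ k → ∃ i, k = 2 * i ∧ I = span {(q : 𝓞 K)} ^ i := by
    intro I hI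
    have hd : I ∣ span {(q : 𝓞 K)} ^ k := by
      rw [Ideal.dvd_iff_le, span_singleton_pow, span_singleton_le_iff_mem]
      have := absNorm_mem I
      rw [hI] at this; exact_mod_cast this
    obtain ⟨i, hi, hA⟩ := (dvd_prime_pow hP k).mp hd
    have hIe : I = span {(q : 𝓞 K)} ^ i := associated_iff_eq.mp hA
    refine ⟨i, ?_, hIe⟩
    rw [hIe, map_pow, hnq, ← pow_mul] at hI
    exact (Nat.pow_right_injective hq.two_le hI).symm
  split_ifs with hk
  · obtain ⟨j, hj⟩ := hk
    rw [Nat.card_eq_one_iff_unique]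
    refine ⟨⟨?_⟩, ⟨⟨span {(q : 𝓞 K)} ^ j, by rw [map_pow, hnq, ← pow_mul]; congr 1; omega⟩⟩⟩
    rintro ⟨I, hI⟩ ⟨J, hJ⟩
    obtain ⟨i, hi, h1⟩ := hform I hI
    obtain ⟨i', hi', h2⟩ := hform J hJ
    have : i = i' := by omega
    subst this
    exact Subtype.ext (h1.trans h2.symm)
  · rw [Nat.card_eq_zero]; left
    refine ⟨fun ⟨I, hI⟩ => ?_⟩
    obtain ⟨i, hi, h1⟩ := hform I hI
    exact hk ⟨i, by omega⟩

open NumberField Ideal in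
lemma card_ideal_split (K : Type*) [Field K] [NumberField K] (hK : Module.finrank ℤ (𝓞 K) = 2)
    (q : ℕ) (hq : q.Prime) (P : Ideal (𝓞 K)) (hPq : absNorm P = q) :
    (Nat.card {I : Ideal (𝓞 K) // absNorm I = q} = 1 ∧ ∀ k, Nat.card {I : Ideal (𝓞 K) // absNorm I = q ^ k} = 1) ∨
    (Nat.card {I : Ideal (𝓞 K) // absNorm I = q} = 2 ∧ ∀ k, Nat.card {I : Ideal (𝓞 K) // absNorm I = q ^ k} = k + 1) := by
  have hnq : absNorm (span {(q : 𝓞 K)}) = q ^ 2 := by rw [absNorm_span_natCast, hK]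
  have hprime : ∀ I : Ideal (𝓞 K), absNorm I = q → Prime I := by
    intro I hI
    have h0 : I ≠ ⊥ := by
      rintro rfl; rw [absNorm_bot] at hI; exact hq.ne_zero hI.symm
    exact (Ideal.prime_iff_isPrime h0).mpr (isPrime_of_irreducible_absNorm (by rw [hI]; exact hq))
  obtain ⟨Q, hQ⟩ : P ∣ span {(q : 𝓞 K)} := by
    rw [Ideal.dvd_iff_le, span_singleton_le_iff_mem, ← hPq]; exact absNorm_mem P
  have hQq : absNorm Q = q := by
    have := congrArg absNorm hQ
    rw [hnq, map_mul, hPq] at this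
    exact (Nat.eq_of_mul_eq_mul_left hq.pos (by rw [← this]; ring)).symm
  have hP := hprime P hPq
  have hQp := hprime Q hQq
  have hform : ∀ k, ∀ I : Ideal (𝓞 K), absNorm I = q ^ k → ∃ i, i ≤ k ∧ I = P ^ i * Q ^ (k - i) := by
    intro k I hI
    have hd : I ∣ P ^ k * Q ^ k := by
      rw [← mul_pow, ← hQ, Ideal.dvd_iff_le, span_singleton_pow, span_singleton_le_iff_mem]
      have := absNorm_mem I
      rw [hI] at this; exact_mod_cast this
    obtain ⟨A, B, hA, hB, hAB⟩ := exists_dvd_and_dvd_of_dvd_mul hd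
    obtain ⟨i, hi, hA⟩ := (dvd_prime_pow hP k).mp hA
    obtain ⟨j, hj, hB⟩ := (dvd_prime_pow hQp k).mp hB
    rw [associated_iff_eq] at hA hB
    subst hA hB
    rw [hAB, map_mul, map_pow, map_pow, hPq, hQq, ← pow_add] at hI
    have := Nat.pow_right_injective hq.two_le hI
    exact ⟨i, by omega, by rw [hAB]; congr 2; omega⟩
  have hN : ∀ k i, i ≤ k → absNorm (P ^ i * Q ^ (k - i)) = q ^ k := by
    intro k i hi
    rw [map_mul, map_pow, map_pow, hPq, hQq, ← pow_add]; congr 1; omega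
  by_cases hPQ : P = Q
  · left
    have : ∀ k, Nat.card {I : Ideal (𝓞 K) // absNorm I = q ^ k} = 1 := by
      intro k
      rw [Nat.card_eq_one_iff_unique]
      refine ⟨⟨?_⟩, ⟨⟨P ^ k, by rw [map_pow, hPq]⟩⟩⟩
      have : ∀ I : Ideal (𝓞 K), absNorm I = q ^ k → I = P ^ k := by
        intro I hI
        obtain ⟨i, hi, h⟩ := hform k I hI
        rw [h, ← hPQ, ← pow_add]; congr 1; omega
      rintro ⟨I, hI⟩ ⟨J, hJ⟩
      exact Subtype.ext ((this I hI).trans (this J hJ).symm)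
    exact ⟨by simpa using this 1, this⟩
  · right
    have hnd : ¬ P ∣ Q := by
      intro h
      exact hPQ (associated_iff_eq.mp ((hP.dvd_prime_iff_associated hQp).mp h))
    have : ∀ k, Nat.card {I : Ideal (𝓞 K) // absNorm I = q ^ k} = k + 1 := by
      intro k
      have : Nat.card (Fin (k+1)) = k + 1 := by simp
      rw [← this]
      symm
      refine Nat.card_congr (Equiv.ofBijective
        (fun i => ⟨P ^ (i:ℕ) * Q ^ (k - i), hN k i (by omega)⟩) ⟨?_, ?_⟩)
      · have aux : ∀ i j : ℕ, i < j → j ≤ k → P ^ i * Q ^ (k - i) ≠ P ^ j * Q ^ (k - j) := by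
          intro i j hij hj h
          have hpi : P ^ i ≠ 0 := pow_ne_zero _ hP.ne_zero
          have e : P ^ j = P ^ i * P ^ (j - i) := by rw [← pow_add]; congr 1; omega
          rw [e, mul_assoc] at h
          have h' := mul_left_cancel₀ hpi h
          have : P ∣ Q ^ (k - i) := by
            rw [h']; exact Dvd.dvd.mul_right (dvd_pow_self _ (by omega)) _
          exact hnd (hP.dvd_of_dvd_pow this)
        intro i j h
        simp only [Subtype.mk.injEq] at h
        rcases lt_trichotomy i.1 j.1 with hlt | heq | hlt
        · exact absurd h (aux _ _ hlt (by omega))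
        · exact Fin.ext heq
        · exact absurd h.symm (aux _ _ hlt (by omega))
      · rintro ⟨I, hI⟩
        obtain ⟨i, hi, h⟩ := hform k I hI
        exact ⟨⟨i, by omega⟩, Subtype.ext h.symm⟩
    exact ⟨by simpa using this 1, this⟩

end

section
open Filter Topology

open NumberField Ideal in
lemma card_ideal_prime (K : Type*) [Field K] [NumberField K] (c : ℕ)
    (b : Module.Basis (Fin 2) ℤ (𝓞 K)) (h0 : b 0 = 1)
    (h1 : (b 1)^2 = b 1 - (c : 𝓞 K)) (q : ℕ) [Fact q.Prime] :
    Nat.card {I : Ideal (𝓞 K) // absNorm I = q} = Nat.card {r : ZMod q // r^2 = r - c} := by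
  have hsum : ∀ x : 𝓞 K, x = (b.repr x 0 : 𝓞 K) + (b.repr x 1 : 𝓞 K) * b 1 := by
    intro x
    conv_lhs => rw [← b.sum_repr x]
    rw [Fin.sum_univ_two, h0]; simp
  have hrep : ∀ u v : ℤ, b.repr ((u : 𝓞 K) + v * b 1) 0 = u ∧ b.repr ((u : 𝓞 K) + v * b 1) 1 = v := by
    intro u v
    have : (u : 𝓞 K) + v * b 1 = u • b 0 + v • b 1 := by rw [h0]; simp
    rw [this, map_add, map_smul, map_smul]; simp
  have hmul : ∀ x y : 𝓞 K, x * y = ((b.repr x 0 * b.repr y 0 - c * (b.repr x 1 * b.repr y 1) : ℤ) : 𝓞 K)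
      + ((b.repr x 0 * b.repr y 1 + b.repr x 1 * b.repr y 0 + b.repr x 1 * b.repr y 1 : ℤ) : 𝓞 K) * b 1 := by
    intro x y
    conv_lhs => rw [hsum x, hsum y]
    push_cast
    linear_combination ((b.repr x 1 : 𝓞 K) * (b.repr y 1 : 𝓞 K)) * h1
  have hhom : ∀ r : ZMod q, r^2 = r - c → ∃ φ : 𝓞 K →+* ZMod q, φ (b 1) = r := by
    intro r hr
    refine ⟨{ toFun := fun x => (b.repr x 0 : ZMod q) + (b.repr x 1 : ZMod q) * r
              map_one' := ?_, map_mul' := ?_, map_zero' := by simp, map_add' := ?_ }, ?_⟩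
    · rw [← h0]; simp
    · intro x y
      rw [hmul x y, (hrep _ _).1, (hrep _ _).2]
      push_cast
      linear_combination (-(b.repr x 1 : ZMod q) * (b.repr y 1 : ZMod q)) * hr
    · intro x y; simp; ring
    · simp
  choose φ hφ using hhom
  have hsurj : ∀ g : 𝓞 K →+* ZMod q, Function.Surjective g := ZMod.ringHom_surjective
  symm
  refine Nat.card_congr (Equiv.ofBijective
    (fun r => ⟨RingHom.ker (φ r.1 r.2), ?_⟩) ⟨?_, ?_⟩)
  · rw [absNorm_apply, Submodule.cardQuot_apply]
    have e := RingHom.quotientKerEquivOfSurjective (hsurj (φ r.1 r.2))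
    rw [Nat.card_congr e.toEquiv]; simp
  · rintro ⟨r, hr⟩ ⟨s, hs⟩ h
    simp only [Subtype.mk.injEq] at h
    obtain ⟨z, hz⟩ := ZMod.intCast_surjective r
    have : b 1 - (z : 𝓞 K) ∈ RingHom.ker (φ r hr) := by
      rw [RingHom.mem_ker, map_sub, hφ r hr, map_intCast, hz, sub_self]
    rw [h, RingHom.mem_ker, map_sub, hφ s hs, map_intCast, hz, sub_eq_zero] at this
    exact Subtype.ext this.symm
  · rintro ⟨I, hI⟩
    have hcard : Nat.card (𝓞 K ⧸ I) = q := by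
      rw [← hI, absNorm_apply, Submodule.cardQuot_apply]
    have : Finite (𝓞 K ⧸ I) := Nat.finite_of_card_ne_zero (by rw [hcard]; exact (Fact.out : q.Prime).ne_zero)
    have := Fintype.ofFinite (𝓞 K ⧸ I)
    let e : ZMod q ≃+* (𝓞 K ⧸ I) := ZMod.ringEquivOfPrime _ Fact.out (by rw [← Nat.card_eq_fintype_card, hcard])
    let g : 𝓞 K →+* ZMod q := (e.symm : (𝓞 K ⧸ I) →+* ZMod q).comp (Ideal.Quotient.mk I)
    have hg : (g (b 1))^2 = g (b 1) - c := by rw [← map_pow, h1, map_sub, map_natCast]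
    have hgI : RingHom.ker g = I := by
      ext x; rw [RingHom.mem_ker]; simp [g, Ideal.Quotient.eq_zero_iff_mem]
    refine ⟨⟨g (b 1), hg⟩, Subtype.ext ?_⟩
    simp only
    have : φ (g (b 1)) hg = g := by
      ext x
      rw [hsum x]
      simp only [map_add, map_mul, map_intCast, hφ _ hg]
    rw [this, hgI]

lemma card_roots_two_aux0 : Nat.card {r : ZMod 2 // r^2 = r - ((0 : ℕ) : ZMod 2)} = 2 := by
  rw [Nat.card_eq_fintype_card]; decide

lemma card_roots_two_aux1 : Nat.card {r : ZMod 2 // r^2 = r - ((1 : ℕ) : ZMod 2)} = 0 := by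
  rw [Nat.card_eq_fintype_card]; decide

lemma card_roots (l : ℕ) [Fact l.Prime] (c : ℕ) (hc : l + 1 = 4 * c) (q : ℕ) [Fact q.Prime] :
    (Nat.card {r : ZMod q // r^2 = r - c} : ℤ) = 1 + quadraticChar (ZMod l) (q : ZMod l) := by
  have hl2 : l ≠ 2 := by rintro rfl; omega
  by_cases hq2 : q = 2
  · subst hq2
    have e2 := quadraticChar_two (F := ZMod l) (by rwa [ZMod.ringChar_zmod_n])
    rw [ZMod.card] at e2
    have hcm : (c : ZMod 2) = ((c % 2 : ℕ) : ZMod 2) := by simp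
    have h8 : (l : ZMod 8) = ((l % 8 : ℕ) : ZMod 8) := by simp
    have e2' : quadraticChar (ZMod l) ((2:ℕ) : ZMod l) = ZMod.χ₈ (l : ZMod 8) := by exact_mod_cast e2
    rw [e2', hcm, h8]
    rcases Nat.mod_two_eq_zero_or_one c with h | h
    · have : l % 8 = 7 := by omega
      rw [h, this, card_roots_two_aux0]; decide
    · have : l % 8 = 3 := by omega
      rw [h, this, card_roots_two_aux1]; decide
  · have hF : ringChar (ZMod q) ≠ 2 := by rwa [ZMod.ringChar_zmod_n]
    have h2 : (2 : ZMod q) ≠ 0 := Ring.two_ne_zero hF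
    have hcq : (l : ZMod q) + 1 = 4 * c := by exact_mod_cast congrArg (Nat.cast (R := ZMod q)) hc
    have hcard : Nat.card {r : ZMod q // r^2 = r - c} = Nat.card {y : ZMod q // y ^ 2 = -(l : ZMod q)} := by
      refine Nat.card_congr ⟨fun r => ⟨2 * r.1 - 1, ?_⟩, fun y => ⟨(y.1 + 1) / 2, ?_⟩, ?_, ?_⟩
      · linear_combination 4 * r.2 + hcq
      · have := y.2
        field_simp
        linear_combination this - hcq
      · rintro ⟨r, hr⟩; apply Subtype.ext; simp; field_simp
      · rintro ⟨r, hr⟩; apply Subtype.ext; simp; field_simp; ring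
    rw [hcard]
    have h3 := quadraticChar_card_sqrts hF (-(l : ZMod q))
    have h4 : Nat.card {y : ZMod q // y ^ 2 = -(l : ZMod q)} = ({x | x ^ 2 = -(l:ZMod q)} : Set (ZMod q)).toFinset.card := by
      rw [Nat.card_eq_fintype_card, Set.toFinset_card]; rfl
    rw [h4, h3, add_comm]
    congr 1
    have e1 : quadraticChar (ZMod q) (-(l : ZMod q)) = legendreSym q (-(l:ℤ)) := by
      rw [legendreSym]; push_cast; rfl
    have e2 : quadraticChar (ZMod l) (q : ZMod l) = legendreSym l (q : ℤ) := by
      rw [legendreSym]; push_cast; rfl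
    rw [e1, e2]
    by_cases hql : q = l
    · subst hql; rw [legendreSym, legendreSym]; simp
    rw [neg_eq_neg_one_mul, legendreSym.mul, legendreSym.at_neg_one hq2, legendreSym.quadratic_reciprocity' hl2 hq2]
    have hl' : l / 2 % 2 = 1 := by omega
    rw [ZMod.χ₄_eq_neg_one_pow ((Nat.Prime.eq_two_or_odd Fact.out).resolve_left hq2), pow_mul,
      Odd.neg_one_pow (Nat.odd_iff.mpr hl'), ← mul_assoc, ← mul_pow]
    simp

open NumberField Ideal in
lemma card_ideal_prime_pow (l : ℕ) [Fact l.Prime] (c : ℕ) (hc : l + 1 = 4 * c) (K : Type*) [Field K] [NumberField K] 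
    (b : Module.Basis (Fin 2) ℤ (𝓞 K)) (h0 : b 0 = 1)
    (h1 : (b 1)^2 = b 1 - (c : 𝓞 K)) (q : ℕ) [Fact q.Prime] (k : ℕ) :
    (Nat.card {I : Ideal (𝓞 K) // absNorm I = q ^ k} : ℤ) =
      ∑ j ∈ Finset.range (k+1), (quadraticChar (ZMod l) (q : ZMod l)) ^ j := by
  have hK : Module.finrank ℤ (𝓞 K) = 2 := by rw [Module.finrank_eq_card_basis b]; simp
  have hq : q.Prime := Fact.out
  have key := card_roots l c hc q
  rw [← card_ideal_prime K c b h0 h1 q] at key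
  by_cases hex : ∃ P : Ideal (𝓞 K), absNorm P = q
  · obtain ⟨P, hP⟩ := hex
    rcases card_ideal_split K hK q hq P hP with ⟨e1, e2⟩ | ⟨e1, e2⟩
    · rw [e1] at key
      have : quadraticChar (ZMod l) (q : ZMod l) = 0 := by push_cast at key; linarith
      rw [e2, this, Finset.sum_range_succ']; simp
    · rw [e1] at key
      have : quadraticChar (ZMod l) (q : ZMod l) = 1 := by push_cast at key; linarith
      rw [e2, this]; simp
  · push Not at hex
    have h0 : Nat.card {I : Ideal (𝓞 K) // absNorm I = q} = 0 := by
      rw [Nat.card_eq_zero]; left; exact ⟨fun I => hex I.1 I.2⟩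
    rw [h0] at key
    have : quadraticChar (ZMod l) (q : ZMod l) = -1 := by push_cast at key; linarith
    rw [this, card_ideal_inert K hK q hq hex k, neg_one_geom_sum]
    rcases Nat.even_or_odd k with h | h
    · have : ¬ Even (k+1) := by simpa [Nat.even_add_one] using h
      rw [if_pos h, if_neg this]; rfl
    · have : Even (k+1) := h.add_one
      rw [if_neg (Nat.not_even_iff_odd.mpr h), if_pos this]; rfl

end

section
open Filter Topology

/-- The complex quadratic character modulo `l`. -/
noncomputable def quadC (l : ℕ) [Fact l.Prime] : DirichletCharacter ℂ l :=
  (quadraticChar (ZMod l)).ringHomComp (Int.castRingHom ℂ)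

lemma quadC_apply (l : ℕ) [Fact l.Prime] (a : ZMod l) :
    quadC l a = ((quadraticChar (ZMod l) a : ℤ) : ℂ) := rfl

/-- number of ideals as an arithmetic function -/
noncomputable def idealAF (K : Type*) [Field K] [NumberField K] : ArithmeticFunction ℂ where
  toFun n := if n = 0 then 0 else
    (Nat.card {I : Ideal (NumberField.RingOfIntegers K) // Ideal.absNorm I = n} : ℂ)
  map_zero' := by simp

/-- the quadratic character as an arithmetic function -/
noncomputable def quadAF (l : ℕ) [Fact l.Prime] : ArithmeticFunction ℂ where
  toFun n := quadC l (n : ZMod l)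
  map_zero' := by simp [quadC_apply]

open NumberField Ideal ArithmeticFunction in
lemma idealAF_eq (l : ℕ) [Fact l.Prime] (c : ℕ) (hc : l + 1 = 4 * c) (K : Type*) [Field K] [NumberField K] 
    (b : Module.Basis (Fin 2) ℤ (𝓞 K)) (h0 : b 0 = 1)
    (h1 : (b 1)^2 = b 1 - (c : 𝓞 K)) :
    idealAF K = ((ArithmeticFunction.zeta : ArithmeticFunction ℕ) : ArithmeticFunction ℂ) * quadAF l := by
  have hm1 : (idealAF K).IsMultiplicative := by
    rw [IsMultiplicative.iff_ne_zero]
    refine ⟨?_, ?_⟩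
    · simp only [idealAF, coe_mk, one_ne_zero, if_false]
      have : Nat.card {I : Ideal (𝓞 K) // absNorm I = 1} = 1 := by
        rw [Nat.card_eq_one_iff_unique]
        refine ⟨⟨fun I J => Subtype.ext ?_⟩, ⟨⟨⊤, by simp⟩⟩⟩
        rw [absNorm_eq_one_iff.mp I.2, absNorm_eq_one_iff.mp J.2]
      rw [this]; simp
    · intro m n hm hn hmn
      simp only [idealAF, coe_mk, hm, hn, mul_eq_zero, or_self, if_false]
      rw [card_ideal_mul K m n hmn hm hn]; push_cast; rfl
  have hm2 : (quadAF l).IsMultiplicative := by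
    refine ⟨by simp [quadAF], fun {m n} _ => by simp [quadAF]⟩
  rw [IsMultiplicative.eq_iff_eq_on_prime_powers _ hm1 _ (isMultiplicative_zeta.natCast.mul hm2)]
  intro q i hq
  have : Fact q.Prime := ⟨hq⟩
  rw [coe_zeta_mul_apply, Nat.sum_divisors_prime_pow hq]
  simp only [idealAF, coe_mk, pow_eq_zero_iff', hq.ne_zero, false_and, if_false]
  have := card_ideal_prime_pow l c hc K b h0 h1 q i
  have := congrArg (Int.cast (R := ℂ)) this
  push_cast at this
  rw [this]
  apply Finset.sum_congr rfl
  intro j _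
  have : quadAF l (q ^ j) = quadC l (((q ^ j : ℕ)) : ZMod l) := rfl
  rw [this, Nat.cast_pow, map_pow, quadC_apply]

open NumberField ArithmeticFunction in
lemma class_number_formula (l : ℕ) [Fact l.Prime] (h4 : 4 < l) (hl : l % 4 = 3) (K : Type*) [Field K]
    [NumberField K] (α : K) (hα : α ^ 2 = -(l : K)) (hKα : Algebra.adjoin ℚ {α} = ⊤) :
    (l : ℤ) * classNumber K = |∑ a : ZMod l, quadraticChar (ZMod l) a * (a.val : ℤ)| := by
  have hl2 : l ≠ 2 := by omega
  have hF : ringChar (ZMod l) ≠ 2 := by rwa [ZMod.ringChar_zmod_n]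
  obtain ⟨b, h0, h1, -⟩ := quad_basis l ((l+1)/4) (by omega) K α hα hKα
  have haf := idealAF_eq l ((l+1)/4) (by omega) K b h0 h1
  have hne : quadC l ≠ 1 := by
    intro h
    obtain ⟨a, ha⟩ := quadraticChar_exists_neg_one hF
    have h2 := congrArg (fun χ : DirichletCharacter ℂ l => χ a) h
    simp only [quadC_apply, ha] at h2
    have ha0 : a ≠ 0 := by rintro rfl; simp at ha
    rw [MulChar.one_apply (isUnit_iff_ne_zero.mpr ha0)] at h2
    norm_num at h2
  have hquad : (quadC l).IsQuadratic := by
    intro a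
    rw [quadC_apply]
    rcases quadraticChar_isQuadratic (ZMod l) a with h | h | h <;> rw [h] <;> simp
  have hm1 : quadC l (-1) = -1 := by
    rw [quadC_apply, quadraticChar_neg_one hF, ZMod.card, ZMod.χ₄_nat_three_mod_four hl]; simp
  have hzeta : ∀ s : ℝ, 1 < s → dedekindZeta K s = riemannZeta s * LSeries (fun n => quadC l (n : ZMod l)) (s : ℂ) := by
    intro s hs
    have hs' : 1 < (s : ℂ).re := by simpa using hs
    have e1 : dedekindZeta K s = LSeries (fun n => idealAF K n) s := by
      rw [dedekindZeta]
      apply LSeries_congr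
      intro n hn
      simp [idealAF, hn]
    rw [e1, haf]
    have hz : LSeriesSummable (fun n => ((ArithmeticFunction.zeta : ArithmeticFunction ℕ) : ArithmeticFunction ℂ) n) (s:ℂ) := by
      have := LSeriesSummable_zeta_iff.mpr hs'
      exact this
    have hq : LSeriesSummable (fun n => quadAF l n) (s:ℂ) := 
      DirichletCharacter.LSeriesSummable_of_one_lt_re (quadC l) hs'
    have := ArithmeticFunction.LSeries_mul' hz hq
    rw [this]
    congr 1
    exact LSeries_zeta_eq_riemannZeta hs'
  have t1 := tendsto_sub_one_mul_dedekindZeta_nhdsGT K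
  have t2 := LSeries_tendsto_LamLim l (quadC l) hne
  have t3 : Tendsto (fun s : ℝ => ((s:ℂ) - 1) * riemannZeta s) (𝓝[>] 1) (𝓝 1) := by
    have hm : Tendsto (fun s : ℝ => (s : ℂ)) (𝓝[>] 1) (𝓝[≠] 1) := by
      apply tendsto_nhdsWithin_of_tendsto_nhds_of_eventually_within
      · exact (Complex.continuous_ofReal.tendsto' 1 1 (by simp)).mono_left nhdsWithin_le_nhds
      · filter_upwards [self_mem_nhdsWithin] with s hs
        have : s ≠ 1 := ne_of_gt hs
        simpa using this
    exact riemannZeta_residue_one.comp hm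
  have hres : (dedekindZeta_residue K : ℂ) = LamLim l (quadC l) := by
    have t4 := t3.mul t2
    rw [one_mul] at t4
    refine tendsto_nhds_unique (t1.congr' ?_) t4
    filter_upwards [self_mem_nhdsWithin] with s hs
    rw [hzeta s hs, mul_assoc]
  have ht := tau_LamLim l (quadC l) hne hquad hm1
  rw [← hres, quad_residue l h4 hl K α hα hKα] at ht
  have hsq := gaussSum_sq hne hquad (ZMod.isPrimitive_stdAddChar l)
  rw [hm1, ZMod.card] at hsq
  have hnorm : ‖gaussSum (quadC l) (ZMod.stdAddChar (N := l))‖ = Real.sqrt l := by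
    have := congrArg norm hsq
    rw [norm_pow] at this
    simp at this
    rw [← this, Real.sqrt_sq (norm_nonneg _)]
  have hn := congrArg norm ht
  rw [norm_mul, hnorm, norm_neg, norm_mul] at hn
  have hS : ∑ a : ZMod l, quadC l a * (a.val : ℂ) = ((∑ a : ZMod l, quadraticChar (ZMod l) a * (a.val : ℤ) : ℤ) : ℂ) := by
    push_cast; rfl
  rw [hS] at hn
  have hl0 : (0:ℝ) < l := by exact_mod_cast (Fact.out : l.Prime).pos
  have hsl := Real.sqrt_pos.mpr hl0
  have hpi := Real.pi_pos
  set S : ℤ := ∑ a : ZMod l, quadraticChar (ZMod l) a * (a.val : ℤ)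
  have e1 : ‖((Real.pi * classNumber K / Real.sqrt l : ℝ) : ℂ)‖ = Real.pi * classNumber K / Real.sqrt l := by
    rw [Complex.norm_real, Real.norm_of_nonneg (by positivity)]
  have e2 : ‖Complex.I * Real.pi / l‖ = Real.pi / l := by
    rw [norm_div, norm_mul, Complex.norm_I, one_mul, Complex.norm_real, Real.norm_of_nonneg hpi.le, Complex.norm_natCast]
  have e3 : ‖((S : ℤ) : ℂ)‖ = ((|S| : ℤ) : ℝ) := by
    rw [Complex.norm_intCast]; push_cast; rfl
  rw [e1, e2, e3] at hn
  have : ((l * classNumber K : ℤ) : ℝ) = ((|S| : ℤ) : ℝ) := by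
    field_simp at hn
    push_cast at hn ⊢
    linarith
  exact_mod_cast this

end

section
open Finset

lemma zmod_sum_pow_poly (p n : ℕ) [Fact p.Prime] (hn : p = 2 * n + 1) (hn1 : 1 ≤ n)
    (P : Polynomial (ZMod p)) (hP : P.natDegree ≤ n) :
    ∑ x : ZMod p, x ^ n * P.eval x = - P.coeff n := by
  have hcard : Fintype.card (ZMod p) - 1 = 2 * n := by rw [ZMod.card]; omega
  have hs : ∀ k, k ≤ n → ∑ x : ZMod p, x ^ (n + k) = if k = n then -1 else 0 := by
    intro k hk
    split_ifs with h
    · subst h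
      have h1 := FiniteField.sum_pow_units (ZMod p) (k + k)
      rw [if_pos (by rw [hcard]; exact ⟨1, by ring⟩)] at h1
      rw [← h1]
      symm
      rw [← Finset.sum_subset (Finset.subset_univ (Finset.univ.filter (fun x : ZMod p => x ≠ 0)))]
      · refine Finset.sum_bij (fun u _ => (u : ZMod p)) ?_ ?_ ?_ ?_
        · intro u _; simp
        · intro u _ v _ h; exact Units.ext h
        · intro x hx; simp at hx; exact ⟨Units.mk0 x hx, by simp, rfl⟩
        · intro u _; rfl
      · intro x _ hx
        simp at hx; subst hx
        exact zero_pow (by omega)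
    · exact FiniteField.sum_pow_lt_card_sub_one _ _ (by rw [hcard]; omega)
  simp_rw [Polynomial.eval_eq_sum_range' (Nat.lt_succ_of_le hP), Finset.mul_sum]
  rw [Finset.sum_comm]
  have : ∀ i ∈ range n.succ, ∑ x : ZMod p, x ^ n * (P.coeff i * x ^ i) = P.coeff i * (if i = n then -1 else 0) := by
    intro i hi
    rw [← hs i (by simp at hi; omega), Finset.mul_sum]
    apply Finset.sum_congr rfl; intro x _; ring
  rw [Finset.sum_congr rfl this]
  simp

/-- power sums against binomials -/
noncomputable def quadBinom (p j : ℕ) [Fact p.Prime] : ℤ :=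
  ∑ x ∈ range p, quadraticChar (ZMod p) (x : ZMod p) * (x.choose j : ℤ)

lemma quadBinom_mod (p n : ℕ) [Fact p.Prime] (hn : p = 2 * n + 1) (hn1 : 1 ≤ n) (j : ℕ) (hj : j ≤ n) :
    (p : ℤ) ∣ (j.factorial : ℤ) * quadBinom p j + (if j = n then 1 else 0) := by
  rw [← ZMod.intCast_zmod_eq_zero_iff_dvd]
  have hF : ringChar (ZMod p) ≠ 2 := by rw [ZMod.ringChar_zmod_n]; omega
  have h1 : ((((j.factorial : ℤ) * quadBinom p j : ℤ)) : ZMod p) = ∑ x : ZMod p, x ^ n * (descPochhammer (ZMod p) j).eval x := by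
    rw [← sum_range_zmod p (fun x => x ^ n * (descPochhammer (ZMod p) j).eval x)]
    rw [quadBinom, Finset.mul_sum, Int.cast_sum]
    apply Finset.sum_congr rfl
    intro x _
    rw [descPochhammer_eval_eq_descFactorial, Nat.descFactorial_eq_factorial_mul_choose]
    have := quadraticChar_eq_pow_of_char_ne_two' hF (x : ZMod p)
    rw [ZMod.card, show p / 2 = n by omega] at this
    push_cast
    rw [this]; ring
  push_cast at h1 ⊢
  rw [h1, zmod_sum_pow_poly p n hn hn1 _ (by rw [descPochhammer_natDegree]; exact hj)]
  split_ifs with h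
  · subst h
    have := monic_descPochhammer (ZMod p) j
    rw [Polynomial.Monic, Polynomial.leadingCoeff, descPochhammer_natDegree] at this
    rw [this]; simp
  · rw [Polynomial.coeff_eq_zero_of_natDegree_lt (by rw [descPochhammer_natDegree]; omega)]; simp

lemma pi_pow_dvd_p {R : Type*} [CommRing R] [IsDomain R] (p : ℕ) (hp : p.Prime) (ζ : R) (hζ : IsPrimitiveRoot ζ p) :
    (1 - ζ) ^ (p - 1) ∣ (p : R) := by
  obtain ⟨z, hz⟩ : ∃ n, p = n + 1 := ⟨p - 1, by have := hp.pos; omega⟩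
  subst hz
  have := hζ.prod_one_sub_pow_eq_order
  push_cast
  rw [← this]
  have h2 : (1 - ζ) ^ z = ∏ k ∈ range z, (1 - ζ) := by simp
  rw [h2]
  exact Finset.prod_dvd_prod_of_dvd _ _ (fun k _ => by simpa using sub_dvd_pow_sub_pow 1 ζ (k+1))

lemma tau_congr {R : Type*} [CommRing R] [IsDomain R] (p n : ℕ) [Fact p.Prime] (hn : p = 2 * n + 1) (hn1 : 1 ≤ n)
    (ζ : R) (hζ : IsPrimitiveRoot ζ p) :
    (1 - ζ) ^ (n + 1) ∣ (n.factorial : R) * (∑ x ∈ range p, ((quadraticChar (ZMod p) (x : ZMod p) : ℤ) : R) * ζ ^ x) + (-(1 - ζ)) ^ n := by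
  set π := 1 - ζ with hπ
  have hpd : π ^ (n+1) ∣ (p : R) := (pow_dvd_pow _ (by omega)).trans (pi_pow_dvd_p p Fact.out ζ hζ)
  have hpow : ∀ x ∈ range p, ζ ^ x = ∑ j ∈ range p, (-π) ^ j * (x.choose j : R) := by
    intro x hx
    have : ζ = -π + 1 := by rw [hπ]; ring
    conv_lhs => rw [this, add_pow]
    simp only [one_pow, mul_one]
    apply Finset.sum_subset
    · intro j hj; simp at hj hx ⊢; omega
    · intro j _ hj
      rw [Nat.choose_eq_zero_of_lt (by simpa using hj)]; simp
  have e1 : (∑ x ∈ range p, ((quadraticChar (ZMod p) (x : ZMod p) : ℤ) : R) * ζ ^ x) = ∑ j ∈ range p, (-π)^j * ((quadBinom p j : ℤ) : R) := by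
    rw [Finset.sum_congr rfl (fun x hx => by rw [hpow x hx, Finset.mul_sum]), Finset.sum_comm]
    apply Finset.sum_congr rfl; intro j _
    rw [quadBinom]; push_cast; rw [Finset.mul_sum]
    apply Finset.sum_congr rfl; intro x _; ring
  have hsplit : ∑ j ∈ range p, (-π)^j * ((quadBinom p j : ℤ) : R) = (∑ j ∈ range n, (-π)^j * ((quadBinom p j : ℤ) : R)) + (-π)^n * ((quadBinom p n : ℤ) : R) + ∑ j ∈ Ico (n+1) p, (-π)^j * ((quadBinom p j : ℤ) : R) := by
    rw [← Finset.sum_range_succ, Finset.sum_range_add_sum_Ico _ (by omega)]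
  rw [e1, hsplit]
  have d1 : π ^ (n+1) ∣ (n.factorial : R) * ∑ j ∈ range n, (-π)^j * ((quadBinom p j : ℤ) : R) := by
    rw [Finset.mul_sum]
    apply Finset.dvd_sum
    intro j hj
    have hj' : j < n := by simpa using hj
    have h := quadBinom_mod p n hn hn1 j hj'.le
    rw [if_neg hj'.ne, add_zero] at h
    have h3 : (p : ℤ) ∣ (n.factorial : ℤ) * quadBinom p j := by
      obtain ⟨k, hk⟩ := Nat.factorial_dvd_factorial hj'.le
      rw [hk]; push_cast
      have : (j.factorial : ℤ) * k * quadBinom p j = k * (j.factorial * quadBinom p j) := by ring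
      rw [this]; exact Dvd.dvd.mul_left h _
    have h4 : (p : R) ∣ (n.factorial : R) * ((quadBinom p j : ℤ) : R) := by
      have := (Int.castRingHom R).map_dvd h3; simpa using this
    have : (n.factorial : R) * ((-π)^j * ((quadBinom p j : ℤ) : R)) = (-π)^j * ((n.factorial : R) * ((quadBinom p j : ℤ) : R)) := by ring
    rw [this]; exact Dvd.dvd.mul_left (hpd.trans h4) _
  have d2 : π ^ (n+1) ∣ (n.factorial : R) * ∑ j ∈ Ico (n+1) p, (-π)^j * ((quadBinom p j : ℤ) : R) := by
    apply Dvd.dvd.mul_left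
    apply Finset.dvd_sum
    intro j hj
    apply Dvd.dvd.mul_right
    rw [neg_pow]
    apply Dvd.dvd.mul_left
    exact pow_dvd_pow _ (by simp at hj; omega)
  have d3 : π ^ (n+1) ∣ (n.factorial : R) * ((-π)^n * ((quadBinom p n : ℤ) : R)) + (-π)^n := by
    have h := quadBinom_mod p n hn hn1 n le_rfl
    rw [if_pos rfl] at h
    have h4 : (p : R) ∣ (n.factorial : R) * ((quadBinom p n : ℤ) : R) + 1 := by
      have := (Int.castRingHom R).map_dvd h; simpa using this
    have : (n.factorial : R) * ((-π)^n * ((quadBinom p n : ℤ) : R)) + (-π)^n = (-π)^n * ((n.factorial : R) * ((quadBinom p n : ℤ) : R) + 1) := by ring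
    rw [this]; exact Dvd.dvd.mul_left (hpd.trans h4) _
  have := dvd_add (dvd_add d1 d2) d3
  convert this using 1; ring

lemma pr_congr {R : Type*} [CommRing R] [IsDomain R] (p n : ℕ) [Fact p.Prime] (hn : p = 2 * n + 1) (hn1 : 1 ≤ n)
    (ζ : R) (hζ : IsPrimitiveRoot ζ p) :
    (1 - ζ) ^ (n + 1) ∣ (n.factorial : R) * (∏ k ∈ range n, (ζ ^ (2*k+1) - ζ ^ (p - (2*k+1)))) + (-(1 - ζ)) ^ n := by
  set π := 1 - ζ with hπ
  have hpd : π ∣ (p : R) := (dvd_pow_self _ (by omega)).trans (pi_pow_dvd_p p Fact.out ζ hζ)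
  have h1 : ∀ a : ℕ, ∃ w, ζ ^ a = 1 - a * π + π^2 * w := by
    intro a
    induction a with
    | zero => exact ⟨0, by simp⟩
    | succ a ih =>
      obtain ⟨w, hw⟩ := ih
      refine ⟨w * ζ + a, ?_⟩
      rw [pow_succ, hw]; push_cast; rw [hπ]; ring
  have h2 : ∀ k ∈ range n, ∃ w, ζ ^ (2*k+1) - ζ ^ (p - (2*k+1)) = π * (((-2 * (2 * k + 1) : ℤ) : R) + π * w) := by
    intro k hk
    have hk' : k < n := by simpa using hk
    obtain ⟨w1, e1⟩ := h1 (2*k+1)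
    obtain ⟨w2, e2⟩ := h1 (p - (2*k+1))
    obtain ⟨z, hz⟩ := hpd
    have hcast : ((p - (2*k+1) : ℕ) : R) = p - (2 * k + 1) := by
      rw [Nat.cast_sub (by omega)]; push_cast; ring
    refine ⟨w1 - w2 + z, ?_⟩
    rw [e1, e2, hcast]; push_cast; linear_combination π * hz
  choose! w hw using h2
  rw [Finset.prod_congr rfl hw, Finset.prod_mul_distrib]
  have h3 : π ∣ (∏ k ∈ range n, (((-2 * (2 * k + 1) : ℤ) : R) + π * w k)) - ∏ k ∈ range n, ((-2 * (2 * k + 1) : ℤ) : R) := by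
    rw [← Ideal.mem_span_singleton, ← Ideal.Quotient.eq, map_prod, map_prod]
    apply Finset.prod_congr rfl
    intro k _
    rw [Ideal.Quotient.eq, Ideal.mem_span_singleton]; exact ⟨w k, by ring⟩
  obtain ⟨z, hz⟩ := h3
  have h4 : ∀ n : ℕ, (n.factorial : ℤ) * ∏ k ∈ range n, (-2 * (2 * (k:ℤ) + 1)) = (-1)^n * ((2*n).factorial : ℤ) := by
    intro n
    induction n with
    | zero => simp
    | succ n ih =>
      rw [Finset.prod_range_succ, show 2 * (n+1) = (2*n+1)+1 by ring, Nat.factorial_succ, Nat.factorial_succ, Nat.factorial_succ]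
      push_cast
      linear_combination ((n:ℤ) + 1) * (-2 * (2 * (n:ℤ) + 1)) * ih
  have h5 : (p : ℤ) ∣ ((2*n).factorial : ℤ) + 1 := by
    rw [← ZMod.intCast_zmod_eq_zero_iff_dvd]
    have := ZMod.wilsons_lemma p
    rw [show p - 1 = 2 * n by omega] at this
    push_cast; rw [this]; ring
  have h6 : π ∣ ((2*n).factorial : R) + 1 := by
    refine hpd.trans ?_
    have := (Int.castRingHom R).map_dvd h5; simpa using this
  obtain ⟨y, hy⟩ := h6
  have h7 : (n.factorial : R) * ∏ k ∈ range n, ((-2 * (2 * k + 1) : ℤ) : R) = (-1)^n * ((2*n).factorial : R) := by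
    exact_mod_cast congrArg (Int.cast (R := R)) (h4 n)
  refine ⟨(n.factorial : R) * z + (-1)^n * y, ?_⟩
  have hc : ∏ i ∈ range n, π = π ^ n := by simp
  rw [hc, neg_pow]
  have e1 : ∏ k ∈ range n, (((-2 * (2 * k + 1) : ℤ) : R) + π * w k) = ∏ k ∈ range n, ((-2 * (2 * k + 1) : ℤ) : R) + π * z := by rw [← hz]; ring
  rw [e1]
  have : ((2*n).factorial : R) = π * y - 1 := by rw [← hy]; ring
  rw [this] at h7
  linear_combination π^n * h7

lemma tau_eq_pr {R : Type*} [CommRing R] [IsDomain R] (p n : ℕ) [Fact p.Prime] (hn : p = 2 * n + 1) (hn1 : 1 ≤ n)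
    (ζ : R) (hζ : IsPrimitiveRoot ζ p) (hu : ¬ IsUnit (1 - ζ)) 
    (hsq : (∑ x ∈ range p, ((quadraticChar (ZMod p) (x : ZMod p) : ℤ) : R) * ζ ^ x)^2 = (∏ k ∈ range n, (ζ ^ (2*k+1) - ζ ^ (p - (2*k+1))))^2) :
    (∑ x ∈ range p, ((quadraticChar (ZMod p) (x : ZMod p) : ℤ) : R) * ζ ^ x) = ∏ k ∈ range n, (ζ ^ (2*k+1) - ζ ^ (p - (2*k+1))) := by
  rcases sq_eq_sq_iff_eq_or_eq_neg.mp hsq with h | h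
  · exact h
  exfalso
  have h1 := tau_congr p n hn hn1 ζ hζ
  have h2 := pr_congr p n hn hn1 ζ hζ
  rw [h] at h1
  have h3 := dvd_add h1 h2
  have h4 : (1 - ζ) ^ n * (1 - ζ) ∣ (1 - ζ) ^ n * ((-1)^n * 2) := by
    have e : (-(1-ζ))^n = (-1)^n*(1-ζ)^n := neg_pow _ _
    rw [e] at h3
    rw [← pow_succ]; convert h3 using 1; ring
  have hne : (1 - ζ) ^ n ≠ 0 := by
    apply pow_ne_zero
    rw [sub_ne_zero]
    exact (hζ.ne_one (by omega)).symm
  have h5 := (mul_dvd_mul_iff_left hne).mp h4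
  have h6 : (1 - ζ) ∣ 2 := by
    have := Dvd.dvd.mul_left h5 ((-1)^n)
    rwa [← mul_assoc, ← mul_pow, neg_one_mul, neg_neg, one_pow, one_mul] at this
  have hpd : (1 - ζ) ∣ (p : R) := (dvd_pow_self _ (by omega)).trans (pi_pow_dvd_p p Fact.out ζ hζ)
  apply hu
  rw [isUnit_iff_dvd_one]
  have : (1 : R) = p - 2 * n := by rw [hn]; push_cast; ring
  have h9 := dvd_sub hpd (Dvd.dvd.mul_right h6 (n : R))
  rwa [← this] at h9

end

section
open Finset

lemma prod_range_two_mul {M : Type*} [CommMonoid M] (g : ℕ → M) (n : ℕ) :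
    ∏ j ∈ range (2*n), g j = (∏ k ∈ range n, g (2*k)) * ∏ k ∈ range n, g (2*k+1) := by
  induction n with
  | zero => simp
  | succ n ih =>
    rw [show 2*(n+1) = 2*n+1+1 by ring, prod_range_succ, prod_range_succ, ih, prod_range_succ, prod_range_succ]
    generalize (∏ k ∈ range n, g (2 * k)) = A
    generalize (∏ k ∈ range n, g (2 * k + 1)) = B
    generalize g (2*n) = C
    generalize g (2*n+1) = D
    rw [mul_assoc, mul_assoc, mul_assoc]
    rw [mul_left_comm B C D]

lemma pr_sq {R : Type*} [CommRing R] [IsDomain R] (p n : ℕ) [Fact p.Prime] (hn : p = 2 * n + 1)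
    (ζ : R) (hζ : IsPrimitiveRoot ζ p) :
    (∏ k ∈ range n, (ζ ^ (2*k+1) - ζ ^ (p - (2*k+1))))^2 = (-1)^n * (p : R) := by
  have h2 : IsPrimitiveRoot (ζ^2) (2*n+1) := by
    rw [← hn]
    apply hζ.pow_of_coprime
    rw [hn]; simp
  have h := h2.prod_one_sub_pow_eq_order
  rw [prod_range_two_mul, ← prod_range_reflect (fun k => 1 - (ζ^2)^(2*k+1+1)), ← prod_mul_distrib] at h
  have hp : (p:R) = ((2*n : ℕ) : R) + 1 := by rw [hn]; push_cast; ring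
  rw [hp, ← h, ← prod_pow]
  have : (-1:R)^n = ∏ k ∈ range n, (-1) := by simp
  rw [this, ← prod_mul_distrib]
  apply prod_congr rfl
  intro k hk
  have hk' : k < n := by simpa using hk
  obtain ⟨b, hb⟩ : ∃ b, p = 2*k+1+b := ⟨p - (2*k+1), by omega⟩
  have e1 : p - (2*k+1) = b := by omega
  have e2 : 2*(n-1-k)+1+1 = b := by omega
  rw [e1, e2]
  have h1 : ζ^(2*k+1) * ζ^b = 1 := by rw [← pow_add, ← hb]; exact hζ.pow_eq_one
  rw [pow_right_comm ζ 2, pow_right_comm ζ 2]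
  linear_combination (ζ^(2*k+1)*ζ^b - 1) * h1

lemma one_sub_pow_dvd {R : Type*} [CommRing R] [IsDomain R] (p : ℕ) [Fact p.Prime] (ζ : R) (hζ : IsPrimitiveRoot ζ p) (k : ℕ) (hk : k.Coprime p) :
    1 - ζ ^ k ∣ 1 - ζ := by
  have h1 := hζ.pow_of_coprime k hk
  haveI : NeZero p := ⟨(Fact.out : p.Prime).ne_zero⟩
  obtain ⟨i, -, hi⟩ := h1.eq_pow_of_pow_eq_one hζ.pow_eq_one
  have := sub_dvd_pow_sub_pow 1 (ζ^k) i
  rwa [hi, one_pow] at this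

lemma p_dvd_pi_pow {R : Type*} [CommRing R] [IsDomain R] (p : ℕ) [Fact p.Prime] (ζ : R) (hζ : IsPrimitiveRoot ζ p) :
    (p : R) ∣ (1 - ζ) ^ (p - 1) := by
  have hp : p.Prime := Fact.out
  obtain ⟨z, hz⟩ : ∃ n, p = n + 1 := ⟨p - 1, by have := hp.pos; omega⟩
  have hζ' := hζ
  rw [hz] at hζ'
  have h := hζ'.prod_one_sub_pow_eq_order
  have e : (p : R) = z + 1 := by rw [hz]; push_cast; rfl
  have h2 : (1 - ζ) ^ (p-1) = ∏ k ∈ range z, (1 - ζ) := by rw [hz]; simp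
  rw [e, ← h, h2]
  apply Finset.prod_dvd_prod_of_dvd
  intro k hk
  apply one_sub_pow_dvd p ζ hζ
  have hk' : k < z := by simpa using hk
  exact (Nat.coprime_of_lt_prime (by omega) (by omega) hp).symm

lemma one_sub_nonunit (p : ℕ) [Fact p.Prime] (ζ : integralClosure ℤ ℂ) (hζ : IsPrimitiveRoot ζ p) :
    ¬ IsUnit (1 - ζ) := by
  intro hu
  have hp : p.Prime := Fact.out
  have hpu : IsUnit ((p : integralClosure ℤ ℂ)) := isUnit_of_dvd_unit (p_dvd_pi_pow p ζ hζ) (hu.pow _)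
  obtain ⟨y, hy⟩ := isUnit_iff_exists_inv.mp hpu
  have hy' : (p : ℂ) * (y : ℂ) = 1 := by
    have := congrArg (Subtype.val) hy
    simpa using this
  have hp0 : (p : ℂ) ≠ 0 := by exact_mod_cast hp.ne_zero
  have hy2 : (y : ℂ) = (((p : ℚ)⁻¹ : ℚ) : ℂ) := by
    push_cast; field_simp; rw [mul_comm]; exact hy'
  obtain ⟨n, hn⟩ := rat_of_isIntegral_complex ((p:ℚ)⁻¹) (by rw [← hy2]; exact y.2)
  have hp0' : (p : ℚ) ≠ 0 := by exact_mod_cast hp.ne_zero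
  have h3 : (p : ℚ) * n = 1 := by rw [← hn]; field_simp
  have h4 : (p : ℤ) * n = 1 := by exact_mod_cast h3
  have h5 : (p:ℤ) ∣ 1 := ⟨n, h4.symm⟩
  have h6 : p ∣ 1 := by exact_mod_cast h5
  exact hp.one_lt.ne' (Nat.dvd_one.mp h6)

/-- The standard quadratic Gauss sum. -/
noncomputable def tauC (p : ℕ) [Fact p.Prime] : ℂ := gaussSum (quadC p) (ZMod.stdAddChar (N := p))

lemma tauC_eq (p : ℕ) [Fact p.Prime] : tauC p = ∑ x ∈ range p, ((quadraticChar (ZMod p) (x : ZMod p) : ℤ) : ℂ) * (Complex.exp (2 * Real.pi * Complex.I / p)) ^ x := by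
  rw [tauC, gaussSum, ← sum_range_zmod p]
  apply sum_congr rfl
  intro x _
  have := ZMod.stdAddChar_coe (N := p) (x : ℤ)
  push_cast at this
  rw [quadC_apply, this, ← Complex.exp_nat_mul]
  congr 2; ring

lemma tauC_sq (p : ℕ) [Fact p.Prime] (n : ℕ) (hn : p = 2 * n + 1) : tauC p ^ 2 = (-1)^n * (p : ℂ) := by
  have hF : ringChar (ZMod p) ≠ 2 := by rw [ZMod.ringChar_zmod_n]; omega
  have hquad : (quadC p).IsQuadratic := (quadraticChar_isQuadratic (ZMod p)).comp _
  have hne : quadC p ≠ 1 := by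
    rw [quadC, ne_eq, MulChar.ringHomComp_eq_one_iff (Int.cast_injective)]
    exact quadraticChar_ne_one hF
  have h := gaussSum_sq hne hquad (ZMod.isPrimitive_stdAddChar p)
  rw [tauC, h, ZMod.card, quadC_apply, quadraticChar_neg_one hF, ZMod.card, ZMod.χ₄_eq_neg_one_pow (by omega)]
  rw [show p / 2 = n by omega]; push_cast; ring

lemma pr_value (p n : ℕ) [Fact p.Prime] (hn : p = 2 * n + 1) :
    (∏ k ∈ range n, (Complex.exp (2 * Real.pi * Complex.I / p) ^ (2*k+1) - Complex.exp (2 * Real.pi * Complex.I / p) ^ (p - (2*k+1)))) =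
     Complex.I ^ n * (((-1 : ℝ)^(n/2) * Real.sqrt p : ℝ) : ℂ) := by
  have hp : p.Prime := Fact.out
  have hp0 : (p : ℂ) ≠ 0 := by exact_mod_cast hp.ne_zero
  have hprim := Complex.isPrimitiveRoot_exp p hp.ne_zero
  have hsq := pr_sq p n hn _ hprim
  have h1 : ∀ k ∈ range n, (Complex.exp (2 * Real.pi * Complex.I / p) ^ (2*k+1) - Complex.exp (2 * Real.pi * Complex.I / p) ^ (p - (2*k+1))) = Complex.I * ((2 * Real.sin (2 * Real.pi * (2 * k + 1) / p) : ℝ) : ℂ) := by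
    intro k hk
    have hk' : k < n := by simpa using hk
    have e1 : Complex.exp (2 * Real.pi * Complex.I / p) ^ (p - (2*k+1)) = Complex.exp (-((2 * Real.pi * (2*k+1)/p)) * Complex.I) := by
      rw [← Complex.exp_nat_mul, Nat.cast_sub (by omega), Complex.exp_eq_exp_iff_exists_int]
      exact ⟨1, by push_cast; field_simp; ring⟩
    have e2 : Complex.exp (2 * Real.pi * Complex.I / p) ^ (2*k+1) = Complex.exp (((2 * Real.pi * (2*k+1)/p)) * Complex.I) := by
      rw [← Complex.exp_nat_mul]; congr 1; push_cast; ring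
    rw [e1, e2]
    push_cast
    rw [Complex.sin]
    linear_combination (Complex.exp (((2 * Real.pi * (2*k+1)/p)) * Complex.I) - Complex.exp (-((2 * Real.pi * (2*k+1)/p)) * Complex.I)) * (Complex.I_sq)
  rw [prod_congr rfl h1, prod_mul_distrib] at hsq ⊢
  have hc : ∏ i ∈ range n, Complex.I = Complex.I ^ n := by simp
  rw [hc, ← Complex.ofReal_prod] at hsq ⊢
  congr 2
  set r := ∏ k ∈ range n, (2 * Real.sin (2 * Real.pi * (2 * k + 1) / p)) with hr
  have hr2 : r^2 = p := by
    rw [mul_pow, ← pow_mul, mul_comm n 2, pow_mul, Complex.I_sq] at hsq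
    have := mul_left_cancel₀ (pow_ne_zero n (by norm_num : (-1:ℂ) ≠ 0)) hsq
    exact_mod_cast this
  have hpr : (0:ℝ) < p := by exact_mod_cast hp.pos
  have hpr' : (p:ℝ) = 2 * n + 1 := by rw [hn]; push_cast; ring
  have hsplit : r = (∏ k ∈ range ((n+1)/2), (2 * Real.sin (2 * Real.pi * (2 * k + 1) / p))) * ∏ k ∈ Ico ((n+1)/2) n, (2 * Real.sin (2 * Real.pi * (2 * k + 1) / p)) := by
    rw [hr, Finset.prod_range_mul_prod_Ico _ (by omega)]
  have hpos1 : 0 < (∏ k ∈ range ((n+1)/2), (2 * Real.sin (2 * Real.pi * (2 * k + 1) / p))) := by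
    apply prod_pos
    intro k hk
    have hk' : k < (n+1)/2 := by simpa using hk
    have hk2 : (2 * (k:ℝ) + 1) ≤ n := by
      have : 2 * k + 1 ≤ n := by omega
      exact_mod_cast this
    apply mul_pos two_pos
    apply Real.sin_pos_of_pos_of_lt_pi
    · have := Real.pi_pos; positivity
    · rw [div_lt_iff₀ hpr]
      have := Real.pi_pos
      rw [hpr']; nlinarith
  have hpos2 : 0 < (-1:ℝ)^(n/2) * ∏ k ∈ Ico ((n+1)/2) n, (2 * Real.sin (2 * Real.pi * (2 * k + 1) / p)) := by
    have : (-1:ℝ)^(n/2) = ∏ k ∈ Ico ((n+1)/2) n, (-1) := by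
      rw [prod_const, Nat.card_Ico]; congr 1; omega
    rw [this, ← prod_mul_distrib]
    apply prod_pos
    intro k hk
    rw [mem_Ico] at hk
    have hk2 : (n : ℝ) + 1 ≤ (2 * (k:ℝ) + 1) := by
      have : n + 1 ≤ 2 * k + 1 := by omega
      exact_mod_cast this
    have hk3 : (k : ℝ) + 1 ≤ n := by exact_mod_cast hk.2
    have hpi := Real.pi_pos
    have : Real.sin (2 * Real.pi * (2 * k + 1) / p) < 0 := by
      rw [← neg_pos, ← Real.sin_sub_pi]
      apply Real.sin_pos_of_pos_of_lt_pi
      · rw [sub_pos, lt_div_iff₀ hpr, hpr']; nlinarith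
      · rw [sub_lt_iff_lt_add, div_lt_iff₀ hpr, hpr']; nlinarith
    linarith
  have hs : (-1:ℝ)^(n/2) * r = Real.sqrt p := by
    have h0 : 0 < (-1:ℝ)^(n/2) * r := by rw [hsplit]; nlinarith [mul_pos hpos1 hpos2]
    rw [← hr2]
    have : ((-1:ℝ)^(n/2))^2 = 1 := by rw [← pow_mul, mul_comm, pow_mul]; simp
    rw [← Real.sqrt_sq h0.le, mul_pow, this, one_mul]
  rw [← hs, ← mul_assoc, ← pow_add, ← two_mul, pow_mul]; simp

lemma tauC_value (p : ℕ) [Fact p.Prime] (hp2 : p ≠ 2) : tauC p = if p % 4 = 1 then ((Real.sqrt p : ℝ) : ℂ)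
      else Complex.I * ((Real.sqrt p : ℝ) : ℂ) := by
  have hp : p.Prime := Fact.out
  obtain ⟨n, hn⟩ := hp.odd_of_ne_two hp2
  have hn1 : 1 ≤ n := by have := hp.two_le; omega
  have hprim := Complex.isPrimitiveRoot_exp p hp.ne_zero
  set z := Complex.exp (2 * Real.pi * Complex.I / p) with hz
  have hzi : IsIntegral ℤ z := hprim.isIntegral hp.pos
  let ζ : integralClosure ℤ ℂ := ⟨z, hzi⟩
  have hζ : IsPrimitiveRoot ζ p := by
    apply IsPrimitiveRoot.of_map_of_injective (f := (integralClosure ℤ ℂ).val) (h := hprim) Subtype.val_injective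
  have hc1 : (((∑ x ∈ range p, ((quadraticChar (ZMod p) (x : ZMod p) : ℤ) : integralClosure ℤ ℂ) * ζ ^ x) : integralClosure ℤ ℂ) : ℂ) = tauC p := by
    rw [tauC_eq]; push_cast; rfl
  have hc2 : (((∏ k ∈ range n, (ζ ^ (2*k+1) - ζ ^ (p - (2*k+1)))) : integralClosure ℤ ℂ) : ℂ) = ∏ k ∈ range n, (z ^ (2*k+1) - z ^ (p - (2*k+1))) := by
    push_cast; rfl
  have h := tau_eq_pr p n hn hn1 ζ hζ (one_sub_nonunit p ζ hζ) (by
    apply Subtype.ext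
    push_cast [hc1, hc2]
    have e1 := tauC_sq p n hn
    have e2 := pr_sq p n hn z hprim
    rw [e1, e2])
  have h' := congrArg (Subtype.val) h
  rw [hc1, hc2, hz, pr_value p n hn] at h'
  rw [h']
  rcases Nat.even_or_odd n with he | ho
  · obtain ⟨k, hk⟩ := he
    rw [if_pos (by omega), show n / 2 = k by omega, hk, ← two_mul, pow_mul, Complex.I_sq]
    push_cast
    rw [← mul_assoc, ← mul_pow]; simp
  · obtain ⟨k, hk⟩ := ho
    rw [if_neg (by omega), show n / 2 = k by omega, hk, pow_succ, pow_mul, Complex.I_sq]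
    push_cast
    have : ((-1:ℂ)^k)^2 = 1 := by rw [← pow_mul, mul_comm, pow_mul]; simp
    linear_combination Complex.I * (Real.sqrt p : ℂ) * this

end

section
open Finset

/-- complex quadratic character of a finite field -/
noncomputable def etaC (F : Type*) [Field F] [Fintype F] [DecidableEq F] : MulChar F ℂ :=
  (quadraticChar F).ringHomComp (Int.castRingHom ℂ)

lemma etaC_apply (F : Type*) [Field F] [Fintype F] [DecidableEq F] (a : F) : etaC F a = ((quadraticChar F a : ℤ) : ℂ) := rfl

/-- canonical additive character -/
noncomputable def psiC (p : ℕ) [Fact p.Prime] (F : Type*) [Field F] [Algebra (ZMod p) F] : AddChar F ℂ :=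
  (ZMod.stdAddChar (N := p)).compAddMonoidHom (Algebra.trace (ZMod p) F).toAddMonoidHom

lemma psiC_apply (p : ℕ) [Fact p.Prime] (F : Type*) [Field F] [Algebra (ZMod p) F] (x : F) :
    psiC p F x = ZMod.stdAddChar (N := p) (Algebra.trace (ZMod p) F x) := rfl

lemma psiC_ne_one (p : ℕ) [Fact p.Prime] (F : Type*) [Field F] [Fintype F] [Algebra (ZMod p) F] : psiC p F ≠ 1 := by
  intro h
  have h1 : (ZMod.stdAddChar (N := p)) ≠ 1 := by
    intro h2
    have h3 := ZMod.isPrimitive_stdAddChar p (one_ne_zero)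
    apply h3
    rw [AddChar.mulShift_one, h2]
  apply h1
  ext x
  obtain ⟨y, hy⟩ := Algebra.trace_surjective (ZMod p) F x
  rw [← hy, ← psiC_apply, h]; rfl

lemma psiC_prim (p : ℕ) [Fact p.Prime] (F : Type*) [Field F] [Fintype F] [Algebra (ZMod p) F] : (psiC p F).IsPrimitive :=
  AddChar.IsPrimitive.of_ne_one (psiC_ne_one p F)

lemma sum_comp_sq {F : Type*} [Field F] [Fintype F] [DecidableEq F] (hF : ringChar F ≠ 2) (g : F → ℂ) :
    ∑ x : F, g (x^2) = ∑ a : F, (1 + etaC F a) * g a := by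
  rw [← Finset.sum_fiberwise_of_maps_to (s := univ) (t := univ) (g := fun x : F => x^2) (fun _ _ => mem_univ _)]
  apply sum_congr rfl
  intro a _
  rw [Finset.sum_congr rfl (g := fun _ => g a) (fun x hx => by simp at hx; rw [hx]), sum_const, nsmul_eq_mul]
  congr 1
  have := quadraticChar_card_sqrts hF a
  rw [etaC_apply, add_comm]
  have h2 : ((univ.filter (fun x : F => x^2 = a)).card : ℤ) = quadraticChar F a + 1 := by
    rw [← this]; congr 2; ext x; simp
  exact_mod_cast congrArg (Int.cast (R := ℂ)) h2

lemma sum_psi_sq {F : Type*} [Field F] [Fintype F] [DecidableEq F] (hF : ringChar F ≠ 2) (ψ : AddChar F ℂ) (hψ : ψ ≠ 1) :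
    ∑ x : F, ψ (x^2) = gaussSum (etaC F) ψ := by
  rw [sum_comp_sq hF (fun x => ψ x)]
  simp_rw [add_mul, one_mul, sum_add_distrib]
  rw [AddChar.sum_eq_zero_of_ne_one hψ, zero_add]; rfl

lemma sum_std_sq (p : ℕ) [Fact p.Prime] (hp2 : p ≠ 2) (w : ZMod p) (hw : w ≠ 0) :
    ∑ x : ZMod p, ZMod.stdAddChar (N := p) (w * x^2) = quadC p w * tauC p := by
  have hF : ringChar (ZMod p) ≠ 2 := by rw [ZMod.ringChar_zmod_n]; exact hp2
  have h1 := sum_psi_sq hF ((ZMod.stdAddChar (N := p)).mulShift w) (ZMod.isPrimitive_stdAddChar p hw)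
  simp_rw [AddChar.mulShift_apply] at h1
  rw [h1]
  have h2 := gaussSum_mulShift (quadC p) (ZMod.stdAddChar (N := p)) (Units.mk0 w hw)
  rw [tauC, ← h2, Units.val_mk0, ← mul_assoc]
  have : quadC p w * quadC p w = 1 := by
    rw [← sq, quadC_apply]
    have := quadraticChar_sq_one hw
    exact_mod_cast congrArg (Int.cast (R := ℂ)) this
  rw [this, one_mul]; rfl

lemma addChar_map_sum {A ι : Type*} [AddCommMonoid A] (ψ : AddChar A ℂ) (s : Finset ι) (g : ι → A) :
    ψ (∑ i ∈ s, g i) = ∏ i ∈ s, ψ (g i) := by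
  classical
  induction s using Finset.induction_on with
  | empty => simp
  | insert a s ha ih => rw [sum_insert ha, prod_insert ha, AddChar.map_add_eq_mul, ih]

lemma discr_isSquare (p : ℕ) [Fact p.Prime] (F : Type*) [Field F] [Fintype F] [Algebra (ZMod p) F]
    (hodd : Odd (Module.finrank (ZMod p) F)) (v : Module.Basis (Fin (Module.finrank (ZMod p) F)) (ZMod p) F) :
    ∃ d : ZMod p, Algebra.discr (ZMod p) v = d^2 := by
  classical
  let E := AlgebraicClosure (ZMod p)
  have hc := AlgHom.card (ZMod p) F E
  let e : Fin (Module.finrank (ZMod p) F) ≃ (F →ₐ[ZMod p] E) := (Fintype.equivFinOfCardEq hc).symm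
  have h := Algebra.discr_eq_det_embeddingsMatrixReindex_pow_two (ZMod p) E v e
  set M := Algebra.embeddingsMatrixReindex (ZMod p) E v e with hM
  haveI : CharP E p := charP_of_injective_algebraMap (algebraMap (ZMod p) E).injective p
  let φ : E →ₐ[ZMod p] E := FiniteField.frobeniusAlgHom (ZMod p) E
  have hφ : ∀ x, φ x = x ^ p := by
    intro x
    have : φ x = x ^ (Fintype.card (ZMod p)) := rfl
    rw [this, ZMod.card]
  have hinj : Function.Injective (fun σ : F →ₐ[ZMod p] E => φ.comp σ) := by
    intro σ σ' h
    ext x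
    have := congrArg (fun g : F →ₐ[ZMod p] E => g x) h
    exact φ.injective this
  let P : Equiv.Perm (F →ₐ[ZMod p] E) := Equiv.ofBijective _ ((Finite.injective_iff_bijective).mp hinj)
  have hPk : ∀ k : ℕ, ∀ σ x, (P^k) σ x = (σ x)^(p^k) := by
    intro k
    induction k with
    | zero => intro σ x; simp
    | succ k ih =>
      intro σ x
      rw [pow_succ', Equiv.Perm.mul_apply]
      have : P ((P^k) σ) x = φ ((P^k) σ x) := rfl
      rw [this, ih, hφ, ← pow_mul, ← pow_succ]
  have hcard : Fintype.card F = p ^ Module.finrank (ZMod p) F := by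
    rw [Module.card_eq_pow_finrank (K := ZMod p), ZMod.card]
  have hP1 : P ^ (Module.finrank (ZMod p) F) = 1 := by
    ext σ x
    rw [hPk, ← hcard, ← map_pow, FiniteField.pow_card]; rfl
  let Q : Equiv.Perm (Fin (Module.finrank (ZMod p) F)) := (e.trans P).trans e.symm
  have hsign : Equiv.Perm.sign Q = 1 := by
    have h1 : Equiv.Perm.sign Q = Equiv.Perm.sign P := Equiv.Perm.sign_symm_trans_trans P e.symm
    rw [h1]
    have h2 := congrArg Equiv.Perm.sign hP1
    rw [map_pow, map_one] at h2
    rcases Int.units_eq_one_or (Equiv.Perm.sign P) with h3 | h3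
    · exact h3
    · rw [h3, hodd.neg_one_pow] at h2; exact absurd h2 (by decide)
  have hdet : M.det ^ p = M.det := by
    rw [← hφ]
    have h1 : φ M.det = (M.submatrix id Q).det := by
      rw [AlgHom.map_det]
      congr 1
      ext i j
      simp [hM, Algebra.embeddingsMatrixReindex, Algebra.embeddingsMatrix, Q]
      rfl
    rw [h1, Matrix.det_permute', hsign]; simp
  have hmem : M.det ∈ (⊥ : Subfield E) := (Subfield.mem_bot_iff_pow_eq_self E p).mpr hdet
  rw [← ZMod.fieldRange_castHom_eq_bot p] at hmem
  obtain ⟨d, hd⟩ := hmem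
  refine ⟨d, ?_⟩
  apply (algebraMap (ZMod p) E).injective
  rw [h, map_pow, ← hd]
  have hs : algebraMap (ZMod p) E = ZMod.castHom (dvd_refl p) E := Subsingleton.elim _ _
  rw [hs]

lemma gauss_eta (p : ℕ) [Fact p.Prime] (hp2 : p ≠ 2) (F : Type*) [Field F] [Fintype F] [DecidableEq F] [Algebra (ZMod p) F]
    (f : ℕ) (hcard : Fintype.card F = p ^ f) (hodd : Odd f) :
    gaussSum (etaC F) (psiC p F) = tauC p ^ f := by
  have hp : p.Prime := Fact.out
  have hfr : Module.finrank (ZMod p) F = f := by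
    have := Module.card_eq_pow_finrank (K := ZMod p) (V := F)
    rw [ZMod.card, hcard] at this
    exact (Nat.pow_right_injective hp.two_le this).symm
  haveI : CharP F p := charP_of_injective_algebraMap (algebraMap (ZMod p) F).injective p
  have hF : ringChar F ≠ 2 := by rw [ringChar.eq F p]; exact hp2
  rw [← sum_psi_sq hF _ (psiC_ne_one p F)]
  haveI : Invertible (2 : ZMod p) := by
    apply invertibleOfNonzero
    have : ((2:ℕ) : ZMod p) ≠ 0 := by
      rw [ne_eq, ZMod.natCast_eq_zero_iff]
      intro h
      exact hp2 ((Nat.prime_dvd_prime_iff_eq hp Nat.prime_two).mp h)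
    exact_mod_cast this
  obtain ⟨v, hv⟩ := LinearMap.BilinForm.exists_orthogonal_basis (B := Algebra.traceForm (ZMod p) F) ⟨fun x y => by simp [Algebra.traceForm_apply, mul_comm]⟩
  obtain ⟨d, hd⟩ := discr_isSquare p F (hfr ▸ hodd) v
  set w : Fin (Module.finrank (ZMod p) F) → ZMod p := fun i => Algebra.trace (ZMod p) F (v i * v i) with hw
  have hdisc : Algebra.discr (ZMod p) v = ∏ i, w i := by
    rw [Algebra.discr_def]
    have : Algebra.traceMatrix (ZMod p) v = Matrix.diagonal w := by
      ext i j
      rw [Algebra.traceMatrix_apply, Matrix.diagonal_apply]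
      split_ifs with hij
      · rw [hij]; rfl
      · exact hv hij
    rw [this, Matrix.det_diagonal]
  have hne : ∏ i, w i ≠ 0 := by rw [← hdisc]; exact Algebra.discr_not_zero_of_basis _ v
  have hwi : ∀ i, w i ≠ 0 := fun i => (Finset.prod_ne_zero_iff.mp hne) i (mem_univ _)
  have hx : ∀ c : Fin (Module.finrank (ZMod p) F) → ZMod p, psiC p F ((v.equivFun.symm c)^2) = ∏ i, ZMod.stdAddChar (N := p) (w i * (c i)^2) := by
    intro c
    rw [psiC_apply, ← addChar_map_sum]
    congr 1
    rw [Module.Basis.equivFun_symm_apply, sq, Finset.sum_mul, map_sum]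
    apply sum_congr rfl
    intro i _
    rw [Finset.mul_sum, map_sum, Finset.sum_eq_single i]
    · rw [smul_mul_smul_comm, map_smul, smul_eq_mul]; simp only [hw]; ring
    · intro j _ hj
      have := hv hj.symm
      rw [smul_mul_smul_comm, map_smul]
      have h2 : Algebra.trace (ZMod p) F (v i * v j) = 0 := this
      rw [h2, smul_zero]
    · simp
  rw [← Equiv.sum_comp v.equivFun.symm.toEquiv]
  have : ∀ c, psiC p F ((v.equivFun.symm.toEquiv c)^2) = ∏ i, ZMod.stdAddChar (N := p) (w i * (c i)^2) := hx
  simp_rw [this]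
  rw [← Fintype.piFinset_univ, ← Finset.prod_univ_sum (fun _ => univ) (fun i x => ZMod.stdAddChar (N := p) (w i * x^2))]
  simp_rw [fun i => sum_std_sq p hp2 (w i) (hwi i)]
  rw [prod_mul_distrib, ← map_prod, ← hdisc, hd]
  have hd0 : d ≠ 0 := by
    rintro rfl
    apply hne; rw [← hdisc, hd]; simp
  rw [quadC_apply, quadraticChar_sq_one' hd0]
  simp [hfr]

end

section
open Finset

lemma integral_mem (V : ValuationSubring ℂ) (x : ℂ) (hx : IsIntegral ℤ x) : x ∈ V := by
  have h1 : IsIntegral V x := hx.tower_top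
  obtain ⟨y, hy⟩ := IsIntegrallyClosed.isIntegral_iff.mp h1
  rw [← hy]; exact y.2

lemma mulChar_integral {F : Type*} [Field F] [Fintype F] (χ : MulChar F ℂ) (x : F) : IsIntegral ℤ (χ x) := by
  by_cases hx : x = 0
  · rw [hx, MulChar.map_zero]; exact isIntegral_zero
  · refine ⟨Polynomial.X ^ (Fintype.card F - 1) - 1, ?_, ?_⟩
    · apply Polynomial.monic_X_pow_sub_C
      have := Fintype.one_lt_card (α := F); omega
    · have := FiniteField.pow_card_sub_one_eq_one x hx
      simp [← map_pow, this]

lemma natCast_unit_V (p : ℕ) (V : ValuationSubring ℂ) (hV : V.valuation (p:ℂ) < 1) (n : ℕ) (hn : Nat.Coprime n p) :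
    V.valuation (n : ℂ) = 1 := by
  have hintg : ∀ z : ℤ, V.valuation (z : ℂ) ≤ 1 := fun z => 
    (V.valuation_le_one_iff _).mpr (integral_mem V _ (by simpa using isIntegral_algebraMap (R := ℤ) (A := ℂ) (x := z)))
  apply le_antisymm
  · simpa using hintg n
  · by_contra hlt
    push Not at hlt
    have hb : (n : ℤ) * n.gcdA p + p * n.gcdB p = 1 := by
      rw [← Nat.gcd_eq_gcd_ab, hn]; rfl
    have hb' : (n : ℂ) * (n.gcdA p : ℂ) + (p:ℂ) * (n.gcdB p : ℂ) = 1 := by exact_mod_cast hb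
    have h1 : V.valuation ((n : ℂ) * (n.gcdA p : ℂ) + (p:ℂ) * (n.gcdB p : ℂ)) < 1 := by
      apply Valuation.map_add_lt
      · rw [map_mul]; exact mul_lt_one_of_lt_of_le hlt (hintg _)
      · rw [map_mul]; exact mul_lt_one_of_lt_of_le hV (hintg _)
    rw [hb', map_one] at h1
    exact lt_irrefl _ h1

open Polynomial in
lemma teich (p : ℕ) [Fact p.Prime] (F : Type*) [Field F] [Fintype F] [Algebra (ZMod p) F]
    (f : ℕ) (hcard : Fintype.card F = p ^ f) (V : ValuationSubring ℂ) (hV : V.valuation (p:ℂ) < 1) :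
    ∃ (ι : F →+* IsLocalRing.ResidueField V) (ω : MulChar F ℂ) (hω : ∀ x, ω x ∈ V),
      (∀ x, IsLocalRing.residue V ⟨ω x, hω x⟩ = ι x) ∧ orderOf ω = Fintype.card F - 1 ∧
      (∀ χ : MulChar F ℂ, ∃ k : ℕ, χ = ω ^ k) := by
  classical
  have hp : p.Prime := Fact.out
  have hq1 := Fintype.one_lt_card (α := F)
  set q := Fintype.card F with hq
  have hf0 : f ≠ 0 := by rintro rfl; simp at hcard; omega
  set n := q - 1 with hn
  have hn0 : n ≠ 0 := by omega
  have hqn : q = n + 1 := by omega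
  let k := IsLocalRing.ResidueField V
  have hpk : (p : k) = 0 := by
    have : IsLocalRing.residue V (p : V) = 0 := by
      rw [IsLocalRing.residue_eq_zero_iff, ValuationSubring.valuation_lt_one_iff]
      simpa using hV
    simpa using this
  haveI : CharP k p := by
    rcases CharP.exists k with ⟨c, hc⟩
    have h1 : c ∣ p := (CharP.cast_eq_zero_iff k c p).mp hpk
    rcases (Nat.dvd_prime hp).mp h1 with h | h
    · exact absurd h (CharP.char_ne_one k c)
    · rw [← h]; exact hc
  letI : Algebra (ZMod p) k := ZMod.algebra k p
  have hζC := Complex.isPrimitiveRoot_exp n hn0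
  set z := Complex.exp (2 * Real.pi * Complex.I / n) with hz
  let ζ : V := ⟨z, integral_mem V z (hζC.isIntegral (by omega))⟩
  have hζ : IsPrimitiveRoot ζ n := 
    IsPrimitiveRoot.of_map_of_injective (f := V.subtype) (h := hζC) Subtype.val_injective
  have hcop : Nat.Coprime n p := by
    have : Nat.Coprime q n := by rw [hqn]; simp
    rw [hcard] at this
    exact (Nat.Coprime.coprime_dvd_left (dvd_pow_self p hf0) this).symm
  have hnu : IsUnit (n : V) := by
    rw [ValuationSubring.valuation_eq_one_iff]
    simpa using natCast_unit_V p V hV n hcop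
  set r := IsLocalRing.residue V ζ with hr
  have hrprim : IsPrimitiveRoot r n := by
    rw [IsPrimitiveRoot.iff (by omega)]
    refine ⟨by rw [hr, ← map_pow, hζ.pow_eq_one, map_one], ?_⟩
    intro l hl0 hln h1
    have h2 : ¬ IsUnit (1 - ζ^l) := by
      have : (1 - ζ^l) ∈ IsLocalRing.maximalIdeal V := by
        rw [← IsLocalRing.residue_eq_zero_iff, map_sub, map_one, map_pow, ← hr, h1, sub_self]
      exact this
    apply h2
    refine isUnit_of_dvd_unit ?_ hnu
    obtain ⟨s, hs⟩ : ∃ s, n = s + 1 := ⟨n - 1, by omega⟩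
    have hζ' := hζ
    rw [hs] at hζ'
    have h3 := hζ'.prod_one_sub_pow_eq_order
    have e : (n : V) = s + 1 := by rw [hs]; push_cast; rfl
    rw [e, ← h3]
    have h4 := Finset.dvd_prod_of_mem (fun k => (1 - ζ^(k+1))) (a := l - 1) (s := range s) (by simp; omega)
    rwa [show l - 1 + 1 = l by omega] at h4
  have hsplit : (Polynomial.map (algebraMap (ZMod p) k) (X ^ q - X)).Splits := by
    have e : Polynomial.map (algebraMap (ZMod p) k) (X ^ q - X) = X * (X ^ n - 1) := by
      rw [hqn]; simp; ring
    rw [e]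
    have h5 := X_pow_sub_C_splits_of_isPrimitiveRoot hrprim (α := 1) (a := 1) (one_pow n)
    rw [map_one] at h5
    exact Polynomial.Splits.X.mul h5
  haveI := FiniteField.isSplittingField_sub F (ZMod p)
  let ι : F →ₐ[ZMod p] k := IsSplittingField.lift F (X ^ q - X : (ZMod p)[X]) hsplit
  obtain ⟨g, hg⟩ := IsCyclic.exists_generator (α := Fˣ)
  have hgord : orderOf g = n := by
    rw [orderOf_eq_card_of_forall_mem_zpowers hg, Nat.card_eq_fintype_card, Fintype.card_units]
  have hgprim : IsPrimitiveRoot (ι (g : F)) n := by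
    have h1 : IsPrimitiveRoot g n := by rw [← hgord]; exact IsPrimitiveRoot.orderOf g
    exact (IsPrimitiveRoot.coe_units_iff.mpr h1).map_of_injective ι.injective
  haveI : NeZero n := ⟨hn0⟩
  obtain ⟨i, hi, hi2⟩ := hrprim.eq_pow_of_pow_eq_one hgprim.pow_eq_one
  have hicop : Nat.Coprime i n := (hrprim.pow_iff_coprime (by omega) i).mp (by rw [hi2]; exact hgprim)
  have hzi := hζC.pow_of_coprime i hicop
  have hmem : hzi.toRootsOfUnity.1 ∈ rootsOfUnity (Fintype.card Fˣ) ℂ := by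
    rw [Fintype.card_units]; exact hzi.toRootsOfUnity.2
  let ω := MulChar.ofRootOfUnity hmem hg
  have hωg : ω g = z^i := by
    rw [MulChar.ofRootOfUnity_spec]; rfl
  have hω : ∀ x, ω x ∈ V := fun x => integral_mem V _ (mulChar_integral ω x)
  refine ⟨ι, ω, hω, ?_, ?_, ?_⟩
  · intro x
    by_cases hx : x = 0
    · subst hx
      have : (⟨ω 0, hω 0⟩ : V) = 0 := Subtype.ext (MulChar.map_zero ω)
      rw [this]; simp
    · obtain ⟨l, hl⟩ := (mem_powers_iff_mem_zpowers.mpr (hg (Units.mk0 x hx)))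
      have hx' : x = (g : F)^l := by
        have := congrArg Units.val hl
        simpa using this.symm
      have : (⟨ω x, hω x⟩ : V) = (ζ^i)^l := Subtype.ext (by 
        push_cast; rw [hx', map_pow, hωg])
      rw [this, map_pow, map_pow, ← hr, hi2, hx']; simp
  · rw [orderOf_eq_iff (by omega)]
    refine ⟨?_, ?_⟩
    · rw [MulChar.eq_iff hg, MulChar.pow_apply_coe, hωg, hzi.pow_eq_one]; simp
    · intro l hl hl0 h1
      rw [MulChar.eq_iff hg, MulChar.pow_apply_coe, hωg] at h1
      simp only [MulChar.one_apply_coe] at h1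
      have := Nat.le_of_dvd hl0 (hzi.dvd_of_pow_eq_one l h1)
      omega
  · intro χ
    have h1 : (χ g)^n = 1 := by
      rw [← map_pow, ← Units.val_pow_eq_pow_val, ← hgord, pow_orderOf_eq_one]; simp
    obtain ⟨l, -, hl⟩ := hzi.eq_pow_of_pow_eq_one h1
    refine ⟨l, ?_⟩
    rw [MulChar.eq_iff hg, MulChar.pow_apply_coe, hωg, hl]

end

section
open Finset

/-- Gauss sums with respect to the canonical character. -/
noncomputable def gs (p : ℕ) [Fact p.Prime] {F : Type*} [Field F] [Fintype F] [Algebra (ZMod p) F] (χ : MulChar F ℂ) : ℂ :=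
  gaussSum χ (psiC p F)

/-- the standard primitive root of unity -/
noncomputable def zt (p : ℕ) : ℂ := Complex.exp (2 * Real.pi * Complex.I / p)

lemma zt_prim (p : ℕ) [Fact p.Prime] : IsPrimitiveRoot (zt p) p := Complex.isPrimitiveRoot_exp p (Fact.out : p.Prime).ne_zero

lemma std_eq (p : ℕ) [Fact p.Prime] (a : ZMod p) : ZMod.stdAddChar (N := p) a = zt p ^ a.val := by
  have := ZMod.stdAddChar_coe (N := p) (a.val : ℤ)
  push_cast at this
  rw [ZMod.natCast_zmod_val] at this
  rw [this, zt, ← Complex.exp_nat_mul]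
  congr 1; ring

lemma psiC_eq (p : ℕ) [Fact p.Prime] {F : Type*} [Field F] [Algebra (ZMod p) F] (x : F) :
    psiC p F x = zt p ^ (Algebra.trace (ZMod p) F x).val := by
  rw [psiC_apply, std_eq]

section
variable (p : ℕ) [Fact p.Prime] {F : Type*} [Field F] [Fintype F] [Algebra (ZMod p) F]

lemma psiC_integral (x : F) : IsIntegral ℤ (psiC p F x) := by
  rw [psiC_eq]
  exact ((zt_prim p).isIntegral (Fact.out : p.Prime).pos).pow _

lemma gs_integral (χ : MulChar F ℂ) : IsIntegral ℤ (gs p χ) := by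
  apply IsIntegral.sum
  intro x _
  exact (mulChar_integral χ x).mul (psiC_integral p x)

lemma psiC_frob (x : F) : psiC p F (x^p) = psiC p F x := by
  rw [psiC_apply, psiC_apply]
  congr 1
  have h := Algebra.trace_eq_of_algEquiv (FiniteField.frobeniusAlgEquivOfAlgebraic (ZMod p) F) x
  have e : FiniteField.frobeniusAlgEquivOfAlgebraic (ZMod p) F x = x ^ p := by
    have : FiniteField.frobeniusAlgEquivOfAlgebraic (ZMod p) F x = x ^ Fintype.card (ZMod p) := rfl
    rw [this, ZMod.card]
  rw [e] at h; exact h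

lemma gs_frob (χ : MulChar F ℂ) : gs p (χ^p) = gs p χ := by
  have hp : p.Prime := Fact.out
  rw [gs, gs, gaussSum, gaussSum]
  have e : ∀ x, FiniteField.frobeniusAlgEquivOfAlgebraic (ZMod p) F x = x ^ p := by
    intro x
    have : FiniteField.frobeniusAlgEquivOfAlgebraic (ZMod p) F x = x ^ Fintype.card (ZMod p) := rfl
    rw [this, ZMod.card]
  rw [← Equiv.sum_comp (FiniteField.frobeniusAlgEquivOfAlgebraic (ZMod p) F).toEquiv (fun x => χ x * psiC p F x)]
  apply sum_congr rfl
  intro x _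
  have e' : (FiniteField.frobeniusAlgEquivOfAlgebraic (ZMod p) F).toEquiv x = x ^ p := e x
  rw [e', psiC_frob, map_pow, MulChar.pow_apply' χ hp.ne_zero]

lemma gs_frob_pow (χ : MulChar F ℂ) (i : ℕ) : gs p (χ^(p^i)) = gs p χ := by
  induction i with
  | zero => simp
  | succ i ih => rw [pow_succ, pow_mul, gs_frob, ih]

lemma gs_mul_inv (χ : MulChar F ℂ) (hχ : χ ≠ 1) : gs p χ * gs p χ⁻¹ = χ (-1) * (Fintype.card F : ℂ) := by
  have h1 := gaussSum_mul_gaussSum_eq_card hχ (psiC_prim p F)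
  have h2 := mul_gaussSum_inv_eq_gaussSum χ⁻¹ (psiC p F)
  rw [gs, gs, ← h2]
  rw [← h1]
  have h3 : χ⁻¹ (-1) = χ (-1) := by rw [MulChar.inv_apply', inv_neg, inv_one]
  rw [h3]; ring

lemma mulChar_neg_one_sq (χ : MulChar F ℂ) : χ (-1) = 1 ∨ χ (-1) = -1 := by
  have : χ (-1) * χ (-1) = 1 := by rw [← map_mul]; simp
  exact mul_self_eq_one_iff.mp this

lemma gs_conj (χ : MulChar F ℂ) : (starRingEnd ℂ) (gs p χ) = χ (-1) * gs p χ⁻¹ := by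
  have h := star_gaussSum_eq χ (psiC p F)
  have h2 := mul_gaussSum_inv_eq_gaussSum χ⁻¹ (psiC p F)
  have h3 : χ⁻¹ (-1) = χ (-1) := by rw [MulChar.inv_apply', inv_neg, inv_one]
  have h4 : χ (-1) * χ (-1) = 1 := by rw [← map_mul]; simp
  rw [h3] at h2
  rw [gs, gs, ← h2, ← mul_assoc, h4, one_mul]
  exact h

lemma gs_ne_zero (χ : MulChar F ℂ) (hχ : χ ≠ 1) : gs p χ ≠ 0 := by
  intro h
  have := gs_mul_inv p χ hχ
  rw [h, zero_mul] at this
  have h2 : (Fintype.card F : ℂ) ≠ 0 := by exact_mod_cast Fintype.card_ne_zero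
  rcases mulChar_neg_one_sq χ with h3 | h3
  · rw [h3] at this; apply h2; linear_combination -this
  · rw [h3] at this; apply h2; linear_combination this

lemma val_pi (V : ValuationSubring ℂ) : V.valuation (p:ℂ) = V.valuation (1 - zt p) ^ (p - 1) := by
  have hp : p.Prime := Fact.out
  let ζ : V := ⟨zt p, integral_mem V _ ((zt_prim p).isIntegral hp.pos)⟩
  have hζ : IsPrimitiveRoot ζ p := 
    IsPrimitiveRoot.of_map_of_injective (f := V.subtype) (h := zt_prim p) Subtype.val_injective
  obtain ⟨a, ha⟩ := p_dvd_pi_pow p ζ hζ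
  obtain ⟨b, hb⟩ := pi_pow_dvd_p p hp ζ hζ
  have ha' : (1 - zt p)^(p-1) = (p : ℂ) * a := by
    have := congrArg Subtype.val ha; simpa using this
  have hb' : (p : ℂ) = (1 - zt p)^(p-1) * b := by
    have := congrArg Subtype.val hb; simpa using this
  rw [← map_pow]
  apply le_antisymm
  · conv_lhs => rw [hb', map_mul]
    exact mul_le_of_le_one_right' (V.valuation_le_one b)
  · conv_lhs => rw [ha', map_mul]
    exact mul_le_of_le_one_right' (V.valuation_le_one a)

lemma val_pi_lt (V : ValuationSubring ℂ) (hV : V.valuation (p:ℂ) < 1) : V.valuation (1 - zt p) < 1 := by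
  rw [val_pi] at hV
  by_contra h
  push Not at h
  exact absurd hV (not_lt.mpr (one_le_pow₀ h))

lemma val_gs_omega (hp2 : p ≠ 2) (f : ℕ) (hcard : Fintype.card F = p ^ f) (V : ValuationSubring ℂ) (hV : V.valuation (p:ℂ) < 1)
    (ι : F →+* IsLocalRing.ResidueField V) (ω : MulChar F ℂ) (hω : ∀ x, ω x ∈ V)
    (hι : ∀ x, IsLocalRing.residue V ⟨ω x, hω x⟩ = ι x) (hord : orderOf ω = Fintype.card F - 1) :
    V.valuation (gs p ω⁻¹) = V.valuation (1 - zt p) := by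
  classical
  have hp : p.Prime := Fact.out
  have hq1 := Fintype.one_lt_card (α := F)
  have hfr : Module.finrank (ZMod p) F = f := by
    have := Module.card_eq_pow_finrank (K := ZMod p) (V := F)
    rw [ZMod.card, hcard] at this
    exact (Nat.pow_right_injective hp.two_le this).symm
  have hf0 : f ≠ 0 := by rintro rfl; simp at hcard; omega
  have hq2 : 2 < Fintype.card F := by
    rw [hcard]
    calc 2 < p := lt_of_le_of_ne hp.two_le (Ne.symm hp2)
      _ ≤ p ^ f := Nat.le_self_pow hf0 p
  have hω1 : ω⁻¹ ≠ 1 := by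
    intro h
    rw [inv_eq_one] at h
    rw [h, orderOf_one] at hord; omega
  let ζ : V := ⟨zt p, integral_mem V _ ((zt_prim p).isIntegral hp.pos)⟩
  set π : V := 1 - ζ with hπ
  have hπv : ((π : V) : ℂ) = 1 - zt p := by rw [hπ]; push_cast; rfl
  have hπm : π ∈ IsLocalRing.maximalIdeal V := by
    rw [ValuationSubring.valuation_lt_one_iff, hπv]; exact val_pi_lt p V hV
  have h1 : ∀ a : ℕ, ∃ w, ζ ^ a = 1 - a * π + π^2 * w := by
    intro a
    induction a with
    | zero => exact ⟨0, by simp⟩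
    | succ a ih =>
      obtain ⟨w, hw⟩ := ih
      refine ⟨w * ζ + a, ?_⟩
      rw [pow_succ, hw]; push_cast; rw [hπ]; ring
  choose w hw using h1
  let θ : F → V := fun x => ⟨ω x⁻¹, hω _⟩
  let a : F → ℕ := fun x => (Algebra.trace (ZMod p) F x).val
  have hG : gs p ω⁻¹ = ((∑ x, θ x * ζ ^ (a x) : V) : ℂ) := by
    rw [gs, gaussSum]; push_cast
    apply sum_congr rfl
    intro x _
    rw [psiC_eq, MulChar.inv_apply']
  have hs0 : ∑ x, θ x = 0 := by
    apply Subtype.ext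
    push_cast
    rw [← MulChar.sum_eq_zero_of_ne_one hω1]
    apply sum_congr rfl
    intro x _
    rw [MulChar.inv_apply']
  have hG2 : (∑ x, θ x * ζ ^ (a x) : V) = π * (- (∑ x, θ x * (a x : V)) + π * ∑ x, θ x * w (a x)) := by
    calc (∑ x, θ x * ζ ^ (a x) : V) = ∑ x, (θ x - π * (θ x * (a x : V)) + π^2 * (θ x * w (a x))) := by
          apply sum_congr rfl; intro x _; rw [hw]; ring
      _ = _ := by
          rw [sum_add_distrib, sum_sub_distrib, hs0, ← mul_sum, ← mul_sum]; ring
  have hres : IsLocalRing.residue V (∑ x, θ x * (a x : V)) = -1 := by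
    have e1 : ∀ x, IsLocalRing.residue V (θ x * (a x : V)) = ι (∑ i ∈ range f, x⁻¹ * x ^ (p^i)) := by
      intro x
      rw [map_mul, hι, map_natCast, ← mul_sum, map_mul]
      congr 1
      have h2 := FiniteField.algebraMap_trace_eq_sum_pow (ZMod p) F x
      rw [hfr, Nat.card_zmod] at h2
      rw [← h2]
      have h3 : algebraMap (ZMod p) F (Algebra.trace (ZMod p) F x) = ((a x : ℕ) : F) := by
        conv_lhs => rw [← ZMod.natCast_zmod_val (Algebra.trace (ZMod p) F x)]
        rw [map_natCast]
      rw [h3, map_natCast]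
    rw [map_sum, sum_congr rfl (fun x _ => e1 x), ← map_sum, sum_comm]
    have e2 : ∀ i ∈ range f, ∑ x : F, x⁻¹ * x ^ (p^i) = if i = 0 then -1 else 0 := by
      intro i hi
      have hi' : i < f := by simpa using hi
      have hppos : 0 < p^i := Nat.pow_pos hp.pos
      have h4 : ∑ x : F, x⁻¹ * x ^ (p^i) = ∑ u : Fˣ, (u : F) ^ (p^i - 1) := by
        rw [← Finset.sum_subset (Finset.subset_univ (Finset.univ.filter (fun x : F => x ≠ 0)))]
        · symm
          refine Finset.sum_bij (fun u _ => (u : F)) ?_ ?_ ?_ ?_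
          · intro u _; simp
          · intro u _ v _ h; exact Units.ext h
          · intro x hx; simp at hx; exact ⟨Units.mk0 x hx, by simp, rfl⟩
          · intro u _
            obtain ⟨s, hs⟩ : ∃ s, p^i = s + 1 := ⟨p^i - 1, by omega⟩
            rw [hs, pow_succ', ← mul_assoc, inv_mul_cancel₀ u.ne_zero, one_mul]; rfl
        · intro x _ hx
          simp at hx; subst hx; simp
      rw [h4, FiniteField.sum_pow_units]
      congr 1
      apply propext
      constructor
      · intro hd
        by_contra hi0
        have h5 : p^i < p^f := Nat.pow_lt_pow_right hp.one_lt hi'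
        have h6 : 1 < p^i := Nat.one_lt_pow hi0 hp.one_lt
        have := Nat.le_of_dvd (by omega) hd
        rw [hcard] at this
        omega
      · rintro rfl; simp
    rw [sum_congr rfl e2, sum_ite_eq' (range f) 0, if_pos (by simp; omega)]
    simp
  have hunit : IsUnit (- (∑ x, θ x * (a x : V)) + π * ∑ x, θ x * w (a x)) := by
    rw [← IsLocalRing.residue_ne_zero_iff_isUnit, map_add, map_neg, hres, map_mul, (IsLocalRing.residue_eq_zero_iff π).mpr hπm]
    simp
  rw [hG, hG2]
  push_cast
  rw [map_mul, ← hπv]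
  have := (ValuationSubring.valuation_eq_one_iff V _).mp hunit
  push_cast at this
  rw [this, mul_one]
end

end

section
open Finset

/-- sum of digits -/
def sd (p k : ℕ) : ℕ := (Nat.digits p k).sum

lemma sd_rec (p : ℕ) (hp : 1 < p) (k : ℕ) : sd p k = k % p + sd p (k / p) := by
  rcases Nat.eq_zero_or_pos k with h | h
  · subst h; simp [sd]
  · rw [sd, Nat.digits_def' hp h]; simp [sd]

lemma sd_mul (p : ℕ) (hp : 1 < p) (k : ℕ) : sd p (p * k) = sd p k := by
  rw [sd_rec p hp, Nat.mul_mod_right, Nat.mul_div_cancel_left k (by omega), zero_add]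

lemma sd_succ (p : ℕ) (hp : 1 < p) (k : ℕ) (h : ¬ p ∣ k + 1) : sd p (k + 1) = sd p k + 1 := by
  rw [sd_rec p hp (k+1), sd_rec p hp k, Nat.succ_div, if_neg h]
  have : (k+1) % p = k % p + 1 := by
    have h1 := Nat.mod_add_div k p
    have h2 := Nat.mod_add_div (k+1) p
    rw [Nat.succ_div, if_neg h, add_zero] at h2
    omega
  rw [this]; ring

lemma sd_floor (p : ℕ) (hp : 1 < p) (f : ℕ) : ∀ k, k < p^f → (sd p k : ℤ) = k - (p - 1) * ∑ j ∈ range f, ((k / p^(j+1) : ℕ) : ℤ) := by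
  induction f with
  | zero => intro k hk; simp at hk; subst hk; simp [sd]
  | succ f ih =>
    intro k hk
    have hk' : k / p < p ^ f := by
      rw [Nat.div_lt_iff_lt_mul (by omega), ← pow_succ]; exact hk
    rw [sd_rec p hp, sum_range_succ']
    have h1 : ∀ j, k / p^(j+1+1) = (k/p) / p^(j+1) := by
      intro j; rw [Nat.div_div_eq_div_mul]; congr 1; ring
    simp_rw [h1]
    push_cast
    have h2 := ih _ hk'
    have h3 : ((k % p : ℕ) : ℤ) + p * ((k / p : ℕ) : ℤ) = k := by exact_mod_cast Nat.mod_add_div k p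
    push_cast at h2 h3
    rw [h2]
    simp only [zero_add, pow_one]
    linear_combination h3

lemma mul_pow_mod (p : ℕ) (hp : 1 < p) (f k i : ℕ) (hi : i < f) (hk : k < p^f - 1) :
    ((k * p^i) % (p^f - 1) : ℕ) + (k / p^(f-i)) * (p^f-1) = k * p^i := by
  have hP : p^(f-i) * p^i = p^f := by rw [← pow_add]; congr 1; omega
  have hP0 : 0 < p^(f-i) := Nat.pow_pos (by omega)
  have hQ0 : 0 < p^i := Nat.pow_pos (by omega)
  rw [← hP] at hk ⊢
  generalize p^(f-i) = P at *
  generalize p^i = Q at *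
  have hdm := Nat.div_add_mod k P
  have hb := Nat.mod_lt k hP0
  have ha : k / P < Q := by
    rw [Nat.div_lt_iff_lt_mul hP0, mul_comm]; omega
  generalize k / P = a at *
  generalize k % P = b at *
  subst hdm
  obtain ⟨c, hc⟩ : ∃ c, P * Q = c + 1 := ⟨P*Q - 1, by have := Nat.mul_pos hP0 hQ0; omega⟩
  rw [hc, Nat.add_sub_cancel] at hk ⊢
  have hlt : a + b * Q < c := by
    by_contra hge
    push Not at hge
    have hbP : b + 1 = P := by
      by_contra hne
      have : b + 2 ≤ P := by omega
      have h2 : (b+2) * Q ≤ P * Q := Nat.mul_le_mul_right _ this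
      nlinarith
    subst hbP
    have h3 : a + 1 = Q := by nlinarith
    subst h3
    nlinarith
  have e : (P * a + b) * Q = (a + b * Q) + a * c := by
    have : P * Q * a = (c+1) * a := by rw [hc]
    nlinarith
  rw [e, Nat.add_mul_mod_self_right, Nat.mod_eq_of_lt hlt]

lemma sd_T (p : ℕ) (hp : 1 < p) (f k : ℕ) (hk : k < p^f - 1) :
    (p^f-1) * sd p k = (p-1) * ∑ i ∈ range f, (k * p^i) % (p^f - 1) := by
  have h1 := sd_floor p hp f k (by omega)
  have h2 : ∑ i ∈ range f, (((k * p^i) % (p^f - 1) : ℕ) : ℤ) = k * (∑ i ∈ range f, (p:ℤ)^i) - (∑ j ∈ range f, ((k / p^(j+1) : ℕ) : ℤ)) * ((p:ℤ)^f - 1) := by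
    rw [← sum_range_reflect (fun j => ((k / p^(j+1) : ℕ) : ℤ)), mul_sum, sum_mul, ← sum_sub_distrib]
    apply sum_congr rfl
    intro i hi
    have hi' : i < f := by simpa using hi
    have := mul_pow_mod p hp f k i hi' hk
    rw [show f - 1 - i + 1 = f - i by omega]
    have h4 : ((p^f - 1 : ℕ) : ℤ) = (p:ℤ)^f - 1 := by
      rw [Nat.cast_sub (Nat.one_le_pow _ _ (by omega))]; push_cast; rfl
    rw [← h4]
    have h5 := congrArg (Nat.cast (R := ℤ)) this
    push_cast at h5 ⊢
    linarith
  have h3 := mul_geom_sum (p : ℤ) f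
  have h4 : ((p^f - 1 : ℕ) : ℤ) = (p:ℤ)^f - 1 := by
    rw [Nat.cast_sub (Nat.one_le_pow _ _ (by omega))]; push_cast; rfl
  have h5 : ((p - 1 : ℕ) : ℤ) = (p:ℤ) - 1 := by
    rw [Nat.cast_sub (by omega)]; push_cast; rfl
  have : (((p^f-1) * sd p k : ℕ) : ℤ) = (((p-1) * ∑ i ∈ range f, (k * p^i) % (p^f - 1) : ℕ) : ℤ) := by
    rw [Nat.cast_mul, Nat.cast_mul, h4, h5, Nat.cast_sum, h2, h1]
    linear_combination (-(k:ℤ)) * h3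
  exact_mod_cast this

lemma sd_compl (p : ℕ) (hp : 1 < p) (f k : ℕ) (hk0 : 0 < k) (hk : k < p^f - 1) :
    sd p k + sd p (p^f - 1 - k) = (p-1) * f := by
  have h1 := sd_T p hp f k hk
  have h2 := sd_T p hp f (p^f-1-k) (by omega)
  set n := p^f - 1 with hn
  have hn0 : 0 < n := by omega
  have hcop : Nat.Coprime n p := by
    have hf : f ≠ 0 := by rintro rfl; simp at hn; omega
    have hpf : p^f = n + 1 := by have := Nat.one_le_pow f p (by omega); omega
    have : Nat.Coprime (p^f) n := by rw [hpf]; simp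
    exact (Nat.Coprime.coprime_dvd_left (dvd_pow_self p hf) this).symm
  have h3 : ∀ i ∈ range f, (k * p^i) % n + ((n - k) * p^i) % n = n := by
    intro i _
    have hnd : ¬ n ∣ k * p^i := by
      intro h
      have := (Nat.Coprime.pow_right i hcop).dvd_of_dvd_mul_right h
      exact absurd (Nat.le_of_dvd hk0 this) (by omega)
    have hnd' : ¬ n ∣ (n-k) * p^i := by
      intro h
      have := (Nat.Coprime.pow_right i hcop).dvd_of_dvd_mul_right h
      exact absurd (Nat.le_of_dvd (by omega) this) (by omega)
    have hd : n ∣ (k * p^i) % n + ((n - k) * p^i) % n := by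
      rw [Nat.dvd_iff_mod_eq_zero, ← Nat.add_mod, ← add_mul, show k + (n-k) = n by omega, Nat.mul_mod_right]
    have p1 : 0 < (k * p^i) % n := Nat.pos_of_ne_zero (fun h => hnd (Nat.dvd_of_mod_eq_zero h))
    have l1 := Nat.mod_lt (k * p^i) hn0
    have l2 := Nat.mod_lt ((n-k) * p^i) hn0
    obtain ⟨c, hc⟩ := hd
    have : c = 1 := by
      have c1 : 0 < c := by rcases Nat.eq_zero_or_pos c with h | h; (subst h; omega); exact h
      have c2 : c < 2 := by by_contra h; push Not at h; nlinarith
      omega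
    rw [hc, this, mul_one]
  apply Nat.eq_of_mul_eq_mul_left hn0
  rw [mul_add, h1, h2, ← mul_add, ← sum_add_distrib, sum_congr rfl h3]
  simp; ring

section
variable (p : ℕ) [Fact p.Prime] {F : Type*} [Field F] [Fintype F] [Algebra (ZMod p) F]

lemma gs_one : gs p (1 : MulChar F ℂ) = -1 := gaussSum_one_left (psiC_ne_one p F)

lemma gs_lower (V : ValuationSubring ℂ) (χ φ : MulChar F ℂ) (h : χ * φ ≠ 1) :
    V.valuation (gs p χ) * V.valuation (gs p φ) ≤ V.valuation (gs p (χ * φ)) := by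
  have h1 := jacobiSum_mul_nontrivial h (psiC p F)
  rw [← map_mul, gs, gs, ← h1, map_mul]
  apply mul_le_of_le_one_right'
  rw [V.valuation_le_one_iff]
  apply integral_mem
  apply IsIntegral.sum
  intro x _
  exact (mulChar_integral χ _).mul (mulChar_integral φ _)

lemma stick_lower (f : ℕ) (hcard : Fintype.card F = p ^ f) (V : ValuationSubring ℂ) 
    (ω : MulChar F ℂ) (hord : orderOf ω = Fintype.card F - 1) (h1 : V.valuation (gs p ω⁻¹) = V.valuation (1 - zt p)) :
    ∀ k, k < p^f - 1 → V.valuation (1 - zt p) ^ (sd p k) ≤ V.valuation (gs p (ω⁻¹ ^ k)) := by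
  have hp : p.Prime := Fact.out
  intro k
  induction k using Nat.strong_induction_on with
  | _ k ih =>
    intro hk
    rcases Nat.eq_zero_or_pos k with h0 | h0
    · subst h0; simp [sd, gs_one]
    by_cases hd : p ∣ k
    · obtain ⟨c, rfl⟩ := hd
      have hc0 : 0 < c := Nat.pos_of_mul_pos_left h0
      have hlt : c < p * c := by nlinarith [hp.two_le]
      rw [sd_mul p hp.one_lt, mul_comm p c, pow_mul, gs_frob]
      exact ih c hlt (by omega)
    · obtain ⟨c, rfl⟩ : ∃ c, k = c + 1 := ⟨k - 1, by omega⟩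
      rw [sd_succ p hp.one_lt c hd, pow_succ, pow_succ]
      refine le_trans ?_ (gs_lower p V _ _ ?_)
      · rw [h1]
        exact mul_le_mul_left (ih c (by omega) (by omega)) _
      · rw [← pow_succ]
        intro h
        have h2 := orderOf_dvd_of_pow_eq_one h
        rw [orderOf_inv, hord, hcard] at h2
        have := Nat.le_of_dvd h0 h2
        omega

lemma stick (hp2 : p ≠ 2) (f : ℕ) (hcard : Fintype.card F = p ^ f) (V : ValuationSubring ℂ) (hV : V.valuation (p:ℂ) < 1)
    (ι : F →+* IsLocalRing.ResidueField V) (ω : MulChar F ℂ) (hω : ∀ x, ω x ∈ V)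
    (hι : ∀ x, IsLocalRing.residue V ⟨ω x, hω x⟩ = ι x) (hord : orderOf ω = Fintype.card F - 1) 
    (k : ℕ) (hk0 : 0 < k) (hk : k < p^f - 1) :
    V.valuation (gs p (ω⁻¹ ^ k)) = V.valuation (1 - zt p) ^ (sd p k) := by
  have hp : p.Prime := Fact.out
  have h1 := val_gs_omega p hp2 f hcard V hV ι ω hω hι hord
  have hl := stick_lower p f hcard V ω hord h1
  have a1 := hl k hk
  have a2 := hl (p^f-1-k) (by omega)
  have hne : ω⁻¹ ^ k ≠ 1 := by
    intro h
    have h2 := orderOf_dvd_of_pow_eq_one h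
    rw [orderOf_inv, hord, hcard] at h2
    have := Nat.le_of_dvd hk0 h2
    omega
  have hinv : (ω⁻¹ ^ k)⁻¹ = ω⁻¹ ^ (p^f-1-k) := by
    rw [inv_eq_iff_mul_eq_one, ← pow_add, show k + (p^f-1-k) = p^f-1 by omega, ← hcard, ← hord, inv_pow, pow_orderOf_eq_one, inv_one]
  have hm := gs_mul_inv p (ω⁻¹^k) hne
  rw [hinv] at hm
  have hv := congrArg V.valuation hm
  have hneg : V.valuation ((ω⁻¹ ^ k) (-1)) = 1 := by
    rcases mulChar_neg_one_sq (ω⁻¹^k) with h | h <;> rw [h] <;> simp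
  rw [map_mul, map_mul, hneg, one_mul, hcard, Nat.cast_pow, map_pow, val_pi, ← pow_mul, ← sd_compl p hp.one_lt f k hk0 hk, pow_add] at hv
  have hz : V.valuation (1 - zt p) ≠ 0 := by
    rw [Valuation.ne_zero_iff, sub_ne_zero]
    exact ((zt_prim p).ne_one hp.one_lt).symm
  apply le_antisymm _ a1
  by_contra hlt
  push Not at hlt
  have hpos : 0 < V.valuation (1 - zt p) ^ sd p (p^f-1-k) := zero_lt_iff.mpr (pow_ne_zero _ hz)
  have h1 := mul_lt_mul_of_pos_right hlt hpos
  have h2 := h1.trans_le (mul_le_mul' (le_refl (V.valuation (gs p (ω⁻¹ ^ k)))) a2)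
  exact absurd hv (ne_of_gt h2)
end

end

section
open Finset

/-- quadratic character on naturals -/
noncomputable def ep (l : ℕ) [Fact l.Prime] (a : ℕ) : ℤ := quadraticChar (ZMod l) (a : ZMod l)

section
variable (l : ℕ) [Fact l.Prime]

lemma ep_mod_mul (k a : ℕ) (hk : l ∣ k) : ep l (a % k) = ep l a := by
  unfold ep; congr 1
  rw [ZMod.natCast_eq_natCast_iff]
  exact (Nat.mod_modEq a k).of_dvd hk

lemma ep_mul (a b : ℕ) : ep l (a * b) = ep l a * ep l b := by
  unfold ep; push_cast; rw [map_mul]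

lemma ep_pow (a b : ℕ) : ep l (a ^ b) = ep l a ^ b := by
  unfold ep; push_cast; rw [map_pow]

lemma ep_zero_iff (a : ℕ) : ep l a = 0 ↔ l ∣ a := by
  unfold ep; rw [quadraticChar_eq_zero_iff, ZMod.natCast_eq_zero_iff]

lemma ep_cases (a : ℕ) (h : ¬ l ∣ a) : ep l a = 1 ∨ ep l a = -1 := by
  unfold ep
  apply quadraticChar_dichotomy
  rwa [Ne, ZMod.natCast_eq_zero_iff]

lemma ep_compl (hl : l % 4 = 3) (k a : ℕ) (hk : l ∣ k) (ha : a ≤ k) : ep l (k - a) = - ep l a := by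
  unfold ep
  rw [Nat.cast_sub ha, (ZMod.natCast_eq_zero_iff k l).mpr hk, zero_sub, ← neg_one_mul, map_mul]
  have : quadraticChar (ZMod l) (-1) = -1 := by
    rw [quadraticChar_neg_one (by rw [ZMod.ringChar_zmod_n]; omega), ZMod.card, ZMod.χ₄_nat_three_mod_four hl]
  rw [this]; ring

lemma sum_compl (hl : l % 4 = 3) (k : ℕ) (hk : l ∣ k) (s : ℤ) (hs : s ≠ 0) {A : Type*} [AddCommMonoid A] (g : ℕ → A) :
    ∑ a ∈ (range k).filter (fun a => ep l a = s), g (k - a) = ∑ a ∈ (range k).filter (fun a => ep l a = -s), g a := by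
  have key : ∀ (s : ℤ), s ≠ 0 → ∀ a ∈ (range k).filter (fun a => ep l a = s), k - a ∈ (range k).filter (fun a => ep l a = -s) := by
    intro s hs a ha
    rw [mem_filter, mem_range] at ha ⊢
    refine ⟨?_, by rw [ep_compl l hl k a hk ha.1.le, ha.2]⟩
    have : a ≠ 0 := by
      rintro rfl
      apply hs; rw [← ha.2, ep_zero_iff]; simp
    omega
  refine sum_bij' (fun a _ => k - a) (fun a _ => k - a) (key s hs) ?_ ?_ ?_ ?_
  · intro a ha
    have := key (-s) (by simpa) a ha
    rwa [neg_neg] at this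
  · intro a ha; rw [mem_filter, mem_range] at ha; omega
  · intro a ha; rw [mem_filter, mem_range] at ha; omega
  · intro a ha; rfl

lemma sum_ep_mul (H2 : l ≠ 2) (K : ℕ) : ∑ a ∈ range (l * K), ep l a * (a : ℤ) = K * ∑ a ∈ range l, ep l a * (a:ℤ) := by
  have h0 : ∑ a ∈ range l, ep l a = 0 := by
    have h1 := sum_range_zmod l (fun a => quadraticChar (ZMod l) a)
    unfold ep
    rw [h1]
    by_cases hl2 : l = 2
    · subst hl2
      exfalso
      exact H2 rfl
    · exact quadraticChar_sum_zero (by rw [ZMod.ringChar_zmod_n]; exact hl2)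
  induction K with
  | zero => simp
  | succ K ih =>
    rw [mul_add, mul_one, sum_range_add, ih]
    have h1 : ∀ x, ep l (l * K + x) = ep l x := by
      intro x; unfold ep; push_cast; simp
    simp_rw [h1]
    push_cast
    simp_rw [mul_add]
    rw [sum_add_distrib, ← sum_mul, h0]
    ring

lemma sum_periodic (P k : ℕ) (w : ℕ → ℤ) (hw : ∀ a, w (P + a) = w a) : ∑ a ∈ range (P * k), w a = k * ∑ a ∈ range P, w a := by
  have hw' : ∀ j a, w (P * j + a) = w a := by
    intro j; induction j with
    | zero => intro a; simp
    | succ j ih => intro a; rw [mul_add, mul_one, add_comm (P*j), add_assoc, hw, ih]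
  induction k with
  | zero => simp
  | succ k ih => 
    rw [mul_add, mul_one, sum_range_add, ih]
    simp_rw [hw']
    push_cast; ring

lemma D_sum (H2 : l ≠ 2) (m t : ℕ) (ht : t < m) : ∑ a ∈ range (l^m), ep l a * ((l^t * a % l^m : ℕ) : ℤ) = l^(m-1) * l^t * ∑ a ∈ range l, ep l a * (a:ℤ) := by
  have hpos : 0 < l := (Fact.out : l.Prime).pos
  have e1 : l^m = l^(m-t) * l^t := by rw [← pow_add]; congr 1; omega
  have e2 : l^(m-t) = l * l^(m-1-t) := by rw [← pow_succ']; congr 1; omega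
  have h1 := sum_periodic (l^(m-t)) (l^t) (fun a => ep l a * ((l^t * a % l^m : ℕ) : ℤ)) (by
    intro a
    have h1 : ep l (l^(m-t) + a) = ep l a := by
      unfold ep; rw [e2]; push_cast; simp
    have h2 : l^t * (l^(m-t) + a) = l^t * a + l^m := by rw [e1]; ring
    simp only [h1, h2, Nat.add_mod_right])
  rw [← e1] at h1
  rw [h1]
  have h2 : ∑ a ∈ range (l^(m-t)), ep l a * ((l^t * a % l^m : ℕ) : ℤ) = l^t * ∑ a ∈ range (l^(m-t)), ep l a * (a : ℤ) := by
    rw [mul_sum]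
    apply sum_congr rfl
    intro a ha
    rw [mem_range] at ha
    rw [Nat.mod_eq_of_lt (by rw [e1, mul_comm]; exact Nat.mul_lt_mul_of_pos_right ha (pow_pos hpos _))]
    push_cast; ring
  rw [h2, e2, sum_ep_mul l H2]
  have e3 : l^(m-1) = l^(m-1-t) * l^t := by rw [← pow_add]; congr 1; omega
  have e3' : (l:ℤ)^(m-1) = l^(m-1-t) * l^t := by exact_mod_cast e3
  rw [e3']
  push_cast; ring

end

section
variable (l : ℕ) [Fact l.Prime] (hl : l % 4 = 3) (m : ℕ) (hm : 1 ≤ m) (p f : ℕ) (hf : 2 * f = Nat.totient (l^m)) (hord : orderOf (p : ZMod (l^m)) = f)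

lemma f_odd (l : ℕ) [Fact l.Prime] (hl : l % 4 = 3) (m : ℕ) (hm : 1 ≤ m) (f : ℕ) (hf : 2 * f = Nat.totient (l^m)) : Odd f := by
  have hp : l.Prime := Fact.out
  rw [Nat.totient_prime_pow hp hm] at hf
  have h1 : Odd (l^(m-1)) := (Nat.odd_iff.mpr (by omega)).pow
  have h2 : f = l^(m-1) * ((l-1)/2) := by
    have : l - 1 = 2 * ((l-1)/2) := by omega
    rw [this] at hf
    have h3 : 2 * f = 2 * (l ^ (m-1) * ((l-1)/2)) := by rw [hf]; ring
    omega
  rw [h2]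
  exact h1.mul (Nat.odd_iff.mpr (by omega))

lemma ep_p (l : ℕ) [Fact l.Prime] (hl : l % 4 = 3) (m : ℕ) (hm : 1 ≤ m) (p f : ℕ) (hf : 2 * f = Nat.totient (l^m)) (hord : orderOf (p : ZMod (l^m)) = f) : ep l p = 1 := by
  have hodd := f_odd l hl m hm f hf
  have h1 : (p : ZMod (l^m))^f = 1 := by rw [← hord]; exact pow_orderOf_eq_one _
  have h2 : ((p^f : ℕ) : ZMod (l^m)) = ((1:ℕ) : ZMod (l^m)) := by push_cast; exact h1
  rw [ZMod.natCast_eq_natCast_iff] at h2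
  have h3 := h2.of_dvd (dvd_pow_self l (by omega : m ≠ 0))
  have h4 : ep l (p^f) = ep l 1 := by
    unfold ep; congr 1; rw [ZMod.natCast_eq_natCast_iff]; exact h3
  have h5 : ep l 1 = 1 := by simp [ep]
  rw [ep_pow, h5] at h4
  have h6 : ¬ l ∣ p := by
    intro h; rw [(ep_zero_iff l p).mpr h, zero_pow (by rintro rfl; simp at hodd)] at h4; omega
  rcases ep_cases l p h6 with h7 | h7
  · exact h7
  · rw [h7, hodd.neg_one_pow] at h4; omega

lemma card_ep (l : ℕ) [Fact l.Prime] (hl : l % 4 = 3) (m : ℕ) (hm : 1 ≤ m) (f : ℕ) (hf : 2 * f = Nat.totient (l^m)) (s : ℤ) (hs : s = 1 ∨ s = -1) :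
    ((range (l^m)).filter (fun a => ep l a = s)).card = f := by
  have hd : l ∣ l^m := dvd_pow_self l (by omega)
  have h1 := sum_compl l hl (l^m) hd 1 one_ne_zero (fun _ => 1)
  rw [← card_eq_sum_ones, ← card_eq_sum_ones] at h1
  have h2 : Nat.totient (l^m) = ((range (l^m)).filter (fun a => ep l a = 1)).card + ((range (l^m)).filter (fun a => ep l a = -1)).card := by
    rw [Nat.totient_eq_card_coprime, ← card_union_of_disjoint]
    · congr 1
      ext a
      simp only [mem_filter, mem_union, mem_range]
      rw [Nat.coprime_pow_left_iff (by omega), (Fact.out : l.Prime).coprime_iff_not_dvd]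
      constructor
      · rintro ⟨h1, h2⟩
        rcases ep_cases l a h2 with h | h <;> simp [h, h1]
      · have := ep_zero_iff l a
        rintro (⟨h1, h2⟩ | ⟨h1, h2⟩) <;> refine ⟨h1, fun h => ?_⟩ <;> rw [this.mpr h] at h2 <;> omega
    · rw [disjoint_filter]; intro a _ h1 h2; omega
  rcases hs with rfl | rfl <;> omega

lemma orbit_image (l : ℕ) [Fact l.Prime] (hl : l % 4 = 3) (m : ℕ) (hm : 1 ≤ m) (p f : ℕ) (hf : 2 * f = Nat.totient (l^m)) (hord : orderOf (p : ZMod (l^m)) = f) (j : ℕ) (hj : ¬ l ∣ j) :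
    Set.InjOn (fun i => (j * p^i) % l^m) (range f : Set ℕ) ∧ (range f).image (fun i => (j * p^i) % l^m) = (range (l^m)).filter (fun a => ep l a = ep l j) := by
  have hd : l ∣ l^m := dvd_pow_self l (by omega)
  have hpr : l.Prime := Fact.out
  have hinj : Set.InjOn (fun i => (j * p^i) % l^m) (range f : Set ℕ) := by
    intro a ha b hb hab
    simp only [coe_range, Set.mem_Iio] at ha hb
    have h1 : j * p^a ≡ j * p^b [MOD l^m] := hab
    have h2 := Nat.ModEq.cancel_left_of_coprime (by
      have : Nat.Coprime (l^m) j := Nat.Coprime.pow_left _ (hpr.coprime_iff_not_dvd.mpr hj)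
      exact this) h1
    rw [← ZMod.natCast_eq_natCast_iff] at h2
    push_cast at h2
    rw [← hord] at ha hb
    exact pow_injOn_Iio_orderOf ha hb h2
  refine ⟨hinj, ?_⟩
  apply eq_of_subset_of_card_le
  · intro a ha
    rw [mem_image] at ha
    obtain ⟨i, hi, rfl⟩ := ha
    rw [mem_filter, mem_range]
    refine ⟨Nat.mod_lt _ (pow_pos hpr.pos _), ?_⟩
    rw [ep_mod_mul l _ _ hd, ep_mul, ep_pow, ep_p l hl m hm p f hf hord]; simp
  · rw [card_ep l hl m hm f hf _ (ep_cases l j hj), card_image_of_injOn hinj, card_range]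

lemma orbit_sum (l : ℕ) [Fact l.Prime] (hl : l % 4 = 3) (m : ℕ) (hm : 1 ≤ m) (p f : ℕ) (hf : 2 * f = Nat.totient (l^m)) (hord : orderOf (p : ZMod (l^m)) = f) (j : ℕ) (hj : ¬ l ∣ j) {A : Type*} [AddCommMonoid A] (g : ℕ → A) :
    ∑ i ∈ range f, g ((j * p^i) % l^m) = ∑ a ∈ (range (l^m)).filter (fun a => ep l a = ep l j), g a := by
  obtain ⟨h1, h2⟩ := orbit_image l hl m hm p f hf hord j hj
  rw [← h2, sum_image h1]

lemma split_ep (l : ℕ) [Fact l.Prime] (k : ℕ) (g : ℕ → ℤ) : ∑ a ∈ range k, ep l a * g a = 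
   ∑ a ∈ (range k).filter (fun a => ep l a = 1), g a - ∑ a ∈ (range k).filter (fun a => ep l a = -1), g a := by
  rw [sum_filter, sum_filter, ← sum_sub_distrib]
  apply sum_congr rfl
  intro a _
  by_cases h : l ∣ a
  · rw [(ep_zero_iff l a).mpr h]; simp
  · rcases ep_cases l a h with h | h <;> simp [h]

lemma orbit_val (l : ℕ) [Fact l.Prime] (hl : l % 4 = 3) (m : ℕ) (hm : 1 ≤ m) (p f : ℕ) (hf : 2 * f = Nat.totient (l^m)) (hord : orderOf (p : ZMod (l^m)) = f) (j : ℕ) (hj : ¬ l ∣ j) (t : ℕ) (ht : t < m) :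
    2 * ∑ i ∈ range f, ((l^t * j * p^i % l^m : ℕ) : ℤ) = l^m * f + ep l j * (l^(m-1) * l^t * ∑ a ∈ range l, ep l a * (a:ℤ)) := by
  have hd : l ∣ l^m := dvd_pow_self l (by omega)
  have h1 := orbit_sum l hl m hm p f hf hord j hj (fun a => ((l^t * a % l^m : ℕ) : ℤ))
  have h2 : ∀ i, l^t * ((j * p^i) % l^m) % l^m = l^t * j * p^i % l^m := by
    intro i; rw [mul_assoc, Nat.mul_mod, Nat.mod_mod, ← Nat.mul_mod]
  simp_rw [h2] at h1
  rw [h1, ← D_sum l (by omega) m t ht, split_ep]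
  have h3 := sum_compl l hl (l^m) hd 1 one_ne_zero (fun a => ((l^t * a % l^m : ℕ) : ℤ))
  have h4 : ∑ a ∈ (range (l^m)).filter (fun a => ep l a = 1), ((l^t * (l^m - a) % l^m : ℕ) : ℤ) = ∑ a ∈ (range (l^m)).filter (fun a => ep l a = 1), ((l:ℤ)^m - ((l^t * a % l^m : ℕ) : ℤ)) := by
    apply sum_congr rfl
    intro a ha
    rw [mem_filter, mem_range] at ha
    have hx : l^t * a % l^m ≠ 0 := by
      intro h
      have h5 := Nat.dvd_of_mod_eq_zero h
      have h6 : l^t * l ∣ l^t * a := by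
        rw [← pow_succ]; exact (pow_dvd_pow l (by omega)).trans h5
      have h7 := Nat.dvd_of_mul_dvd_mul_left (pow_pos (Fact.out : l.Prime).pos _) h6
      have := (ep_zero_iff l a).mpr h7
      omega
    have hlt := Nat.mod_lt (l^t * a) (pow_pos (Fact.out : l.Prime).pos m)
    have h8 : l^t * (l^m - a) % l^m = l^m - l^t * a % l^m := by
      have h9 : l^m - l^t * a % l^m < l^m := Nat.sub_lt (pow_pos (Fact.out : l.Prime).pos m) (Nat.pos_of_ne_zero hx)
      rw [← Nat.mod_eq_of_lt h9]
      have : l^t * (l^m - a) + l^t * a ≡ (l^m - l^t * a % l^m) + l^t * a [MOD l^m] := by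
        have e1 : l^t * (l^m - a) + l^t * a = l^t * l^m := by rw [← mul_add]; congr 1; omega
        have e2 : (l^m - l^t * a % l^m) + l^t * a ≡ (l^m - l^t * a % l^m) + l^t * a % l^m [MOD l^m] := 
          Nat.ModEq.add_left _ (Nat.mod_modEq _ _).symm
        rw [e1]
        refine Nat.ModEq.trans ?_ e2.symm
        rw [Nat.sub_add_cancel hlt.le]
        have e3 : l^t * l^m ≡ 0 [MOD l^m] := (Nat.modEq_zero_iff_dvd).mpr (dvd_mul_left _ _)
        have e4 : l^m ≡ 0 [MOD l^m] := (Nat.modEq_zero_iff_dvd).mpr (dvd_refl _)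
        exact e3.trans e4.symm
      exact Nat.ModEq.add_right_cancel' _ this
    rw [h8, Nat.cast_sub hlt.le]; push_cast; ring
  rw [h4, sum_sub_distrib, sum_const, card_ep l hl m hm f hf 1 (Or.inl rfl)] at h3
  simp only [nsmul_eq_mul] at h3
  rcases ep_cases l j hj with h | h <;> rw [h] <;> linarith
end

end

section
open Finset

lemma S_range (l : ℕ) [Fact l.Prime] : ∑ a ∈ range l, ep l a * (a:ℤ) = ∑ a : ZMod l, quadraticChar (ZMod l) a * (a.val : ℤ) := by
  rw [← sum_range_zmod l (fun a => quadraticChar (ZMod l) a * (a.val : ℤ))]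
  apply sum_congr rfl
  intro a ha
  rw [mem_range] at ha
  rw [ZMod.val_natCast_of_lt ha]; rfl

lemma val_gs (p : ℕ) [Fact p.Prime] {F : Type*} [Field F] [Fintype F] [Algebra (ZMod p) F] 
    (hp2 : p ≠ 2) (f : ℕ) (hcard : Fintype.card F = p ^ f) 
    (l : ℕ) [Fact l.Prime] (hl : l % 4 = 3) (m : ℕ) (hm : 1 ≤ m) (hf : 2 * f = Nat.totient (l^m)) (hord : orderOf (p : ZMod (l^m)) = f)
    (h : ℕ) (σ : ℤ) (hσ : σ = 1 ∨ σ = -1) (hS : ∑ a ∈ range l, ep l a * (a:ℤ) = σ * (l * h))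
    (ρ : MulChar F ℂ) (hρ : orderOf ρ = l^m)
    (V : ValuationSubring ℂ) (hV : V.valuation (p:ℂ) < 1) :
    ∃ s : ℤ, (s = 1 ∨ s = -1) ∧ ∀ t < m, ∃ A : ℕ, 2 * (A:ℤ) = f + s * (l^t * h) ∧ V.valuation (gs p (ρ^(l^t))) = V.valuation (p:ℂ)^A := by
  obtain ⟨ι, ω, hω, hι, hωord, hgen⟩ := teich p F f hcard V hV
  have hpp : p.Prime := Fact.out
  have hlp : l.Prime := Fact.out
  have hMpos : 0 < l^m := pow_pos hlp.pos _
  obtain ⟨k₀, hk₀⟩ := hgen ρ⁻¹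
  have hρ0 : ρ = ω⁻¹ ^ k₀ := by rw [inv_pow, ← hk₀, inv_inv]
  have hdvd : l^m ∣ p^f - 1 := by
    have h2 : ρ^(Fintype.card F - 1) = 1 := by
      rw [hρ0, ← pow_mul, mul_comm, pow_mul, inv_pow, ← hωord, pow_orderOf_eq_one]; simp
    rw [← hρ, ← hcard]
    exact orderOf_dvd_of_pow_eq_one h2
  obtain ⟨n, hn⟩ := hdvd
  have hq1 : 0 < p^f - 1 := by
    have h1 : 1 < Fintype.card F := Fintype.one_lt_card
    rw [hcard] at h1; omega
  have hn0 : 0 < n := by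
    rcases Nat.eq_zero_or_pos n with h | h
    · rw [h] at hn; omega
    · exact h
  have hωinv : orderOf ω⁻¹ = l^m * n := by rw [orderOf_inv, hωord, hcard, hn]
  have hnk : n ∣ k₀ := by
    have h1 : (ω⁻¹)^(k₀ * l^m) = 1 := by rw [pow_mul, ← hρ0, ← hρ, pow_orderOf_eq_one]
    have h2 := orderOf_dvd_of_pow_eq_one h1
    rw [hωinv, mul_comm] at h2
    exact Nat.dvd_of_mul_dvd_mul_right hMpos h2
  obtain ⟨j, rfl⟩ := hnk
  have hj : ¬ l ∣ j := by
    rintro ⟨j', rfl⟩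
    have h1 : ρ^(l^(m-1)) = 1 := by
      rw [hρ0, ← pow_mul]
      have : n * (l * j') * l^(m-1) = orderOf ω⁻¹ * j' := by
        rw [hωinv]
        have : l^m = l * l^(m-1) := by rw [← pow_succ']; congr 1; omega
        rw [this]; ring
      rw [this, pow_mul, pow_orderOf_eq_one, one_pow]
    have h2 := orderOf_dvd_of_pow_eq_one h1
    rw [hρ] at h2
    have := (Nat.pow_dvd_pow_iff_le_right hlp.one_lt).mp h2
    omega
  refine ⟨ep l j * σ, ?_, ?_⟩
  · rcases ep_cases l j hj with h | h <;> rcases hσ with h2 | h2 <;> simp [h, h2]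
  intro t ht
  have hov := orbit_val l hl m hm p f hf hord j hj t ht
  rw [hS] at hov
  set T := ∑ i ∈ range f, (l^t * j * p^i % l^m) with hT
  have hMl : (l:ℤ)^m = l^(m-1) * l := by rw [← pow_succ]; congr 1; omega
  have hov2 : 2 * (T:ℤ) = (l:ℤ)^m * (f + ep l j * σ * (l^t * h)) := by
    rw [hT]; push_cast at hov ⊢; rw [hov, hMl]; ring
  have hlodd : Odd ((l:ℤ)^m) := by
    apply Odd.pow; rw [Int.odd_iff]; omega
  have heven : Even (f + ep l j * σ * (l^t * h) : ℤ) := by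
    have h1 : Even ((l:ℤ)^m * (f + ep l j * σ * (l^t * h))) := by rw [← hov2]; exact even_two_mul _
    rcases Int.even_mul.mp h1 with h2 | h2
    · exact absurd h2 (Int.not_even_iff_odd.mpr hlodd)
    · exact h2
  obtain ⟨A', hA'⟩ := heven
  have hTA : (T:ℤ) = (l:ℤ)^m * A' := by rw [hA'] at hov2; linarith
  have hA0 : 0 ≤ A' := by
    have : (0:ℤ) ≤ (l:ℤ)^m * A' := by rw [← hTA]; positivity
    exact nonneg_of_mul_nonneg_right this (by exact_mod_cast hMpos)
  lift A' to ℕ using hA0 with A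
  refine ⟨A, by rw [hA']; ring, ?_⟩
  have hTA' : T = l^m * A := by exact_mod_cast hTA
  -- the exponent
  set r := l^t * j % l^m with hr
  have hrlt : r < l^m := Nat.mod_lt _ hMpos
  have hr0 : 0 < r := by
    apply Nat.pos_of_ne_zero
    intro h0
    have h5 := Nat.dvd_of_mod_eq_zero h0
    have h6 : l^t * l ∣ l^t * j := by
      rw [← pow_succ]; exact (pow_dvd_pow l (by omega)).trans h5
    exact hj (Nat.dvd_of_mul_dvd_mul_left (pow_pos hlp.pos _) h6)
  have hk : ρ^(l^t) = ω⁻¹ ^ (n * r) := by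
    rw [hρ0, ← pow_mul, pow_eq_pow_iff_modEq, hωinv]
    have : n * j * l^t = n * (l^t * j) := by ring
    rw [this, mul_comm (l^m)]
    exact (Nat.ModEq.mul_left' n (Nat.mod_modEq (l^t*j) (l^m))).symm
  have hklt : n * r < p^f - 1 := by
    rw [hn, mul_comm n]; exact Nat.mul_lt_mul_of_pos_right hrlt hn0
  rw [hk, stick p hp2 f hcard V hV ι ω hω hι hωord (n*r) (Nat.mul_pos hn0 hr0) hklt, val_pi, ← pow_mul]
  congr 1
  have hsd := sd_T p hpp.one_lt f (n*r) hklt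
  have h3 : ∀ i, (n * r * p^i) % (p^f - 1) = n * (l^t * j * p^i % l^m) := by
    intro i
    rw [hn, mul_comm (l^m), mul_assoc, Nat.mul_mod_mul_left, hr, Nat.mod_mul_mod]
  simp_rw [h3] at hsd
  rw [← mul_sum, ← hT, hTA', hn] at hsd
  have : (l^m * n) * sd p (n*r) = (l^m*n) * ((p-1)*A) := by rw [hsd]; ring
  exact Nat.eq_of_mul_eq_mul_left (Nat.mul_pos hMpos hn0) this

end

section
open Finset

lemma integral_of_val (x : ℂ) (h : ∀ V : ValuationSubring ℂ, V.valuation x ≤ 1) : IsIntegral ℤ x := by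
  by_contra hx
  have hcl : IsIntegrallyClosedIn (integralClosure ℤ ℂ).toSubring ℂ :=
    (inferInstance : IsIntegrallyClosedIn (integralClosure ℤ ℂ) ℂ)
  have hx2 : x ∉ (integralClosure ℤ ℂ).toSubring := hx
  obtain ⟨V, -, hV⟩ := Subring.exists_le_valuationSubring_of_isIntegrallyClosedIn hx2
  exact hV ((V.valuation_le_one_iff x).mp (h V))

lemma red_exists (l : ℕ) [Fact l.Prime] : ∃ (k : Type) (_ : Field k) (_ : CharP k l), Nonempty (integralClosure ℤ ℂ →+* k) := by
  have hl : l.Prime := Fact.out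
  have hnu : ¬ IsUnit ((l : integralClosure ℤ ℂ)) := by
    intro hu
    obtain ⟨y, hy⟩ := isUnit_iff_exists_inv.mp hu
    have h1 : (l : ℂ) * (y : ℂ) = 1 := by
      have := congrArg Subtype.val hy
      simpa using this
    have h2 : (y : ℂ) = (((1:ℚ)/l : ℚ) : ℂ) := by
      have : (l : ℂ) ≠ 0 := by exact_mod_cast hl.ne_zero
      push_cast; field_simp; linear_combination h1
    obtain ⟨n, hn⟩ := rat_of_isIntegral_complex ((1:ℚ)/l) (by rw [← h2]; exact y.2)
    have h3 : (1:ℚ) = n * l := by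
      have : (l : ℚ) ≠ 0 := by exact_mod_cast hl.ne_zero
      rw [← hn]; field_simp
    have h4 : (1:ℤ) = n * l := by exact_mod_cast h3
    have h5 : (l:ℤ) ∣ 1 := ⟨n, by linarith⟩
    have h6 : l ∣ 1 := by exact_mod_cast h5
    exact hl.one_lt.ne' (Nat.dvd_one.mp h6)
  obtain ⟨M, hM, hlM⟩ := exists_max_ideal_of_mem_nonunits hnu
  refine ⟨integralClosure ℤ ℂ ⧸ M, Ideal.Quotient.field M, ?_, ⟨Ideal.Quotient.mk M⟩⟩
  letI := Ideal.Quotient.field M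
  obtain ⟨c, hc⟩ := CharP.exists (integralClosure ℤ ℂ ⧸ M)
  have h0 : ((l : ℕ) : integralClosure ℤ ℂ ⧸ M) = 0 := by
    rw [← map_natCast (Ideal.Quotient.mk M)]
    exact Ideal.Quotient.eq_zero_iff_mem.mpr hlM
  have h1 : c ∣ l := (CharP.cast_eq_zero_iff _ c l).mp h0
  rcases (Nat.dvd_prime hl).mp h1 with h2 | h2
  · exact absurd h2 (CharP.char_ne_one (integralClosure ℤ ℂ ⧸ M) c)
  · rw [← h2]; exact hc

lemma h_le (l : ℕ) [Fact l.Prime] (hl : l % 4 = 3) (m : ℕ) (hm : 1 ≤ m) (p f : ℕ) (hf : 2 * f = Nat.totient (l^m)) (hord : orderOf (p : ZMod (l^m)) = f)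
    (h : ℕ) (σ : ℤ) (hσ : σ = 1 ∨ σ = -1) (hS : ∑ a ∈ range l, ep l a * (a:ℤ) = σ * (l * h)) : ∃ e : ℕ, f = h + 2 * e := by
  have hlp : l.Prime := Fact.out
  have key : ∀ j, ¬ l ∣ j → ∃ B : ℤ, 0 ≤ B ∧ 2 * B = f + ep l j * (σ * h) := by
    intro j hj
    have hov := orbit_val l hl m hm p f hf hord j hj 0 (by omega)
    rw [hS] at hov
    have hMl : (l:ℤ)^m = l^(m-1) * l := by rw [← pow_succ]; congr 1; omega
    set T := ∑ i ∈ range f, ((l^0 * j * p^i % l^m : ℕ) : ℤ)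
    have hT0 : 0 ≤ T := sum_nonneg (fun i _ => by positivity)
    have h2 : 2 * T = (l:ℤ)^m * (f + ep l j * (σ * h)) := by rw [hov, hMl]; ring
    have hlodd : Odd ((l:ℤ)^m) := by
      apply Odd.pow; rw [Int.odd_iff]; omega
    have hpos : (0:ℤ) < (l:ℤ)^m := by have := hlp.pos; positivity
    have h1 : Even ((l:ℤ)^m * (f + ep l j * (σ * h))) := by rw [← h2]; exact even_two_mul _
    rcases Int.even_mul.mp h1 with h3 | ⟨B, h3⟩
    · exact absurd h3 (Int.not_even_iff_odd.mpr hlodd)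
    · refine ⟨B, ?_, by linarith⟩
      have : T = (l:ℤ)^m * B := by rw [h3] at h2; linarith
      rw [this] at hT0
      exact nonneg_of_mul_nonneg_right hT0 hpos
  have k1 : ¬ l ∣ 1 := fun h => hlp.one_lt.ne' (Nat.dvd_one.mp h)
  have k2 : ¬ l ∣ l - 1 := fun h => by
    have := Nat.le_of_dvd (by have := hlp.two_le; omega) h
    have := hlp.two_le; omega
  obtain ⟨B1, h1, h2⟩ := key 1 k1
  obtain ⟨B2, h3, h4⟩ := key (l-1) k2
  rw [ep_compl l hl l 1 (dvd_refl _) hlp.one_lt.le] at h4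
  have e1 : ep l 1 = 1 := by simp [ep]
  rw [e1] at h2 h4
  rcases hσ with rfl | rfl
  · exact ⟨B2.toNat, by omega⟩
  · exact ⟨B1.toNat, by omega⟩

end

section
open Finset

/-- membership in the imaginary quadratic field -/
def isQ (l : ℕ) (x : ℂ) : Prop := ∃ r s : ℚ, x = (r : ℂ) + s * (Complex.I * (Real.sqrt (l : ℝ) : ℂ))

section
variable (l : ℕ)

lemma isQ_rat (r : ℚ) : isQ l (r : ℂ) := ⟨r, 0, by simp⟩
lemma isQ_int (r : ℤ) : isQ l (r : ℂ) := ⟨r, 0, by simp⟩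
lemma isQ_nat (r : ℕ) : isQ l (r : ℂ) := ⟨r, 0, by simp⟩
lemma isQ_zero : isQ l 0 := ⟨0, 0, by simp⟩
lemma isQ_one : isQ l 1 := ⟨1, 0, by simp⟩
lemma isQ_add (x y : ℂ) (hx : isQ l x) (hy : isQ l y) : isQ l (x + y) := by
  obtain ⟨r, s, rfl⟩ := hx
  obtain ⟨r', s', rfl⟩ := hy
  exact ⟨r + r', s + s', by push_cast; ring⟩
lemma isQ_mul (x y : ℂ) (hx : isQ l x) (hy : isQ l y) : isQ l (x * y) := by
  obtain ⟨r, s, rfl⟩ := hx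
  obtain ⟨r', s', rfl⟩ := hy
  refine ⟨r * r' - l * s * s', r * s' + s * r', ?_⟩
  push_cast
  linear_combination (s * s' : ℂ) * isq_sq l
lemma isQ_pow (x : ℂ) (hx : isQ l x) (n : ℕ) : isQ l (x ^ n) := by
  induction n with
  | zero => simpa using isQ_one l
  | succ n ih => rw [pow_succ]; exact isQ_mul l _ _ ih hx
lemma isQ_sub (x y : ℂ) (hx : isQ l x) (hy : isQ l y) : isQ l (x - y) := by
  have := isQ_add l x ((-1 : ℤ) * y) hx (isQ_mul l _ _ (isQ_int l (-1)) hy)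
  push_cast at this
  rwa [neg_one_mul, ← sub_eq_add_neg] at this
lemma isQ_inv (hl : 0 < l) (x : ℂ) (hx : isQ l x) : isQ l x⁻¹ := by
  by_cases h0 : x = 0
  · rw [h0, inv_zero]; exact isQ_zero l
  obtain ⟨r, s, rfl⟩ := hx
  have hn : (r^2 + l * s^2 : ℚ) ≠ 0 := by
    intro h
    have h1 : (0:ℚ) < l := by exact_mod_cast hl
    have h2 : r^2 = 0 := by nlinarith [sq_nonneg r, sq_nonneg s, mul_nonneg h1.le (sq_nonneg s)]
    have h3 : s^2 = 0 := by
      rw [h2, zero_add] at h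
      exact (mul_eq_zero.mp h).resolve_left h1.ne'
    apply h0
    rw [pow_eq_zero_iff two_ne_zero] at h2 h3
    simp [h2, h3]
  refine ⟨r / (r^2 + l * s^2), -s / (r^2 + l * s^2), ?_⟩
  have hn' : ((r:ℂ)^2 + l * (s:ℂ)^2) ≠ 0 := by exact_mod_cast hn
  push_cast
  apply inv_eq_of_mul_eq_one_right
  rw [div_mul_eq_mul_div, ← add_div, mul_div_assoc', div_eq_one_iff_eq hn']
  linear_combination (-(s:ℂ)^2) * isq_sq l
lemma isQ_sum {ι : Type*} (S : Finset ι) (g : ι → ℂ) (h : ∀ i ∈ S, isQ l (g i)) : isQ l (∑ i ∈ S, g i) := by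
  classical
  induction S using Finset.induction_on with
  | empty => simpa using isQ_zero l
  | insert a s ha ih =>
    rw [sum_insert ha]
    exact isQ_add l _ _ (h a (mem_insert_self a s)) (ih (fun i hi => h i (mem_insert_of_mem hi)))
end

lemma sum_range_block {A : Type*} [AddCommMonoid A] (l K : ℕ) (g : ℕ → A) : ∑ a ∈ range (l * K), g a = ∑ d ∈ range K, ∑ c ∈ range l, g (l * d + c) := by
  induction K with
  | zero => simp
  | succ K ih => rw [mul_add, mul_one, sum_range_add, ih, sum_range_succ]

lemma geom_root (n : ℕ) (z : ℂ) (hz : z ^ n = 1) : ∑ d ∈ range n, z ^ d = if z = 1 then (n:ℂ) else 0 := by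
  split_ifs with h
  · simp [h]
  · rw [geom_sum_eq h, hz]; simp

lemma ep_sum_root (l : ℕ) [Fact l.Prime] (hl : l % 4 = 3) (z : ℂ) (hz : z ^ l = 1) : isQ l (∑ c ∈ range l, (ep l c : ℂ) * z ^ c) := by
  have hpr : l.Prime := Fact.out
  obtain ⟨k, -, rfl⟩ := (zt_prim l).eq_pow_of_pow_eq_one hz
  have h1 : ∑ c ∈ range l, (ep l c : ℂ) * (zt l ^ k) ^ c = ∑ c : ZMod l, quadC l c * (ZMod.stdAddChar (N := l)) ((k : ZMod l) * c) := by
    rw [← sum_range_zmod l]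
    apply sum_congr rfl
    intro c _
    rw [quadC_apply, ← Nat.cast_mul, std_eq, ZMod.val_natCast, ← pow_mul, ← pow_eq_pow_mod _ (zt_prim l).pow_eq_one]
    rfl
  rw [h1]
  by_cases hk : (k : ZMod l) = 0
  · rw [hk]
    simp only [zero_mul, AddChar.map_zero_eq_one, mul_one]
    simp_rw [quadC_apply]
    rw [← Int.cast_sum, quadraticChar_sum_zero (by rw [ZMod.ringChar_zmod_n]; omega)]
    simpa using isQ_zero l
  · have h2 := gaussSum_mulShift (quadC l) (ZMod.stdAddChar (N := l)) (Units.mk0 _ hk)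
    have h3 : gaussSum (quadC l) ((ZMod.stdAddChar (N := l)).mulShift (k : ZMod l)) = ∑ c : ZMod l, quadC l c * (ZMod.stdAddChar (N := l)) ((k : ZMod l) * c) := rfl
    rw [Units.val_mk0, h3] at h2
    have h4 : gaussSum (quadC l) (ZMod.stdAddChar (N := l)) = Complex.I * (Real.sqrt (l:ℝ) : ℂ) := by
      have := tauC_value l (by omega)
      rw [if_neg (by omega)] at this
      exact this
    rw [h4] at h2
    rcases quadraticChar_dichotomy hk with h5 | h5 <;> rw [quadC_apply, h5] at h2
    · exact ⟨0, 1, by push_cast at h2 ⊢; linear_combination h2⟩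
    · exact ⟨0, -1, by push_cast at h2 ⊢; linear_combination -h2⟩

lemma isQ_orbit (l : ℕ) [Fact l.Prime] (hl : l % 4 = 3) (m : ℕ) (hm : 1 ≤ m) (p f : ℕ) (hf : 2 * f = Nat.totient (l^m)) (hord : orderOf (p : ZMod (l^m)) = f) 
    (z : ℂ) (hz : z ^ (l^m) = 1) : isQ l (∑ i ∈ range f, z ^ (p^i)) := by
  have hpr : l.Prime := Fact.out
  have k1 : ¬ l ∣ 1 := fun h => hpr.one_lt.ne' (Nat.dvd_one.mp h)
  have e1 : ep l 1 = 1 := by simp [ep]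
  have h1 := orbit_sum l hl m hm p f hf hord 1 k1 (fun a => z ^ a)
  simp only [← pow_eq_pow_mod _ hz, one_mul, e1] at h1
  have hM : l^m = l * l^(m-1) := by rw [← pow_succ']; congr 1; omega
  set K := l^(m-1) with hK
  have hzl : (z^l)^K = 1 := by rw [← pow_mul, ← hM, hz]
  have h2 : ∑ a ∈ (range (l^m)).filter (fun a => ep l a = 1), z ^ a = ((1/2 : ℚ) : ℂ) * (∑ a ∈ range (l^m), (ep l a : ℂ)^2 * z^a + ∑ a ∈ range (l^m), (ep l a : ℂ) * z^a) := by
    rw [← sum_add_distrib, mul_sum, sum_filter]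
    apply sum_congr rfl
    intro a _
    by_cases h : l ∣ a
    · rw [(ep_zero_iff l a).mpr h]; simp
    · rcases ep_cases l a h with h | h <;> simp [h]; ring
  rw [h1, h2]
  have hep : ∀ d c, ep l (l * d + c) = ep l c := by
    intro d c; unfold ep; push_cast; simp
  have h3 : ∑ a ∈ range (l^m), (ep l a : ℂ)^2 * z^a = (∑ d ∈ range K, (z^l)^d) * ∑ c ∈ range l, (ep l c : ℂ)^2 * z^c := by
    rw [hM, sum_range_block, sum_mul]
    apply sum_congr rfl; intro d _
    rw [mul_sum]; apply sum_congr rfl; intro c _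
    rw [hep, pow_add, pow_mul]; ring
  have h4 : ∑ a ∈ range (l^m), (ep l a : ℂ) * z^a = (∑ d ∈ range K, (z^l)^d) * ∑ c ∈ range l, (ep l c : ℂ) * z^c := by
    rw [hM, sum_range_block, sum_mul]
    apply sum_congr rfl; intro d _
    rw [mul_sum]; apply sum_congr rfl; intro c _
    rw [hep, pow_add, pow_mul]; ring
  rw [h3, h4, geom_root K _ hzl]
  apply isQ_mul l _ _ (isQ_rat l _)
  split_ifs with h5
  · apply isQ_add
    · apply isQ_mul l _ _ (isQ_nat l _)
      have h6 : ∑ c ∈ range l, (ep l c : ℂ)^2 * z^c = ∑ c ∈ range l, z^c - 1 := by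
        obtain ⟨n, hn⟩ : ∃ n, l = n + 1 := ⟨l - 1, by have := hpr.pos; omega⟩
        have e0 : ep l 0 = 0 := (ep_zero_iff l 0).mpr (dvd_zero _)
        have : ∀ N ≤ n, ∑ c ∈ range (N+1), (ep l c : ℂ)^2 * z^c = ∑ c ∈ range (N+1), z^c - 1 := by
          intro N
          induction N with
          | zero => intro _; simp [e0]
          | succ N ih =>
            intro hN
            rw [sum_range_succ, ih (by omega), sum_range_succ _ (N+1)]
            have : ¬ l ∣ N + 1 := fun h => by
              have := Nat.le_of_dvd (by omega) h
              omega
            rcases ep_cases l _ this with h | h <;> rw [h] <;> push_cast <;> ring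
        have h7 := this n le_rfl
        rw [← hn] at h7
        exact h7
      rw [h6, geom_root l z h5]
      apply isQ_sub l _ _ _ (isQ_one l)
      split_ifs
      · exact isQ_nat l _
      · exact isQ_zero l
    · exact isQ_mul l _ _ (isQ_nat l _) (ep_sum_root l hl z h5)
  · simpa using isQ_zero l

section
variable (p : ℕ) [Fact p.Prime] {F : Type*} [Field F] [Fintype F] [Algebra (ZMod p) F]

lemma gs_base (ρ : MulChar F ℂ) (hρ : ρ ≠ 1) (hb : ∀ c : ZMod p, c ≠ 0 → ρ (algebraMap (ZMod p) F c) = 1) :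
    ((p : ℂ) - 1) * gs p ρ = p * ∑ x : F, if Algebra.trace (ZMod p) F x = 0 then ρ x else 0 := by
  have hpp : p.Prime := Fact.out
  have h1 : ∑ c : ZMod p, ∑ x : F, ρ x * psiC p F (c • x) = p * ∑ x : F, if Algebra.trace (ZMod p) F x = 0 then ρ x else 0 := by
    rw [sum_comm, mul_sum]
    apply sum_congr rfl
    intro x _
    rw [← mul_sum]
    simp_rw [psiC_apply, map_smul, smul_eq_mul]
    rw [AddChar.sum_mulShift _ (ZMod.isPrimitive_stdAddChar p)]
    split_ifs with h
    · rw [ZMod.card]; ring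
    · simp
  rw [← h1]
  have h2 : ∀ c : ZMod p, c ≠ 0 → ∑ x : F, ρ x * psiC p F (c • x) = gs p ρ := by
    intro c hc
    have hc' : algebraMap (ZMod p) F c ≠ 0 := by rwa [Ne, map_eq_zero]
    rw [gs, gaussSum]
    refine Fintype.sum_equiv (Equiv.mulLeft₀ _ hc') _ _ ?_
    intro x
    simp only [Equiv.mulLeft₀_apply, map_mul, hb c hc, one_mul, Algebra.smul_def]
  rw [← add_sum_erase univ _ (mem_univ (0:ZMod p)), sum_congr rfl (fun c hc => h2 c (ne_of_mem_erase hc))]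
  simp only [zero_smul, AddChar.map_zero_eq_one, mul_one, sum_const, card_erase_of_mem (mem_univ (0:ZMod p)), card_univ, ZMod.card]
  rw [MulChar.sum_eq_zero_of_ne_one hρ, zero_add, nsmul_eq_mul, Nat.cast_sub hpp.one_lt.le]; simp

lemma isQ_gs (l : ℕ) [Fact l.Prime] (hl : l % 4 = 3) (m : ℕ) (hm : 1 ≤ m) (f : ℕ) (hf : 2 * f = Nat.totient (l^m)) (hord : orderOf (p : ZMod (l^m)) = f) 
    (ρ : MulChar F ℂ) (hρ : ρ ≠ 1) (hρl : ρ ^ (l^m) = 1) (hb : ∀ c : ZMod p, c ≠ 0 → ρ (algebraMap (ZMod p) F c) = 1) :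
    isQ l (gs p ρ) := by
  classical
  have hpp : p.Prime := Fact.out
  have hodd := f_odd l hl m hm f hf
  have hfpos : f ≠ 0 := by rintro rfl; simp at hodd
  have h1 : ((f * (p - 1 : ℕ) : ℕ) : ℂ) * gs p ρ = p * ∑ x : F, if Algebra.trace (ZMod p) F x = 0 then ∑ i ∈ range f, (ρ x)^(p^i) else 0 := by
    have h2 : ∀ i, ((p : ℂ) - 1) * gs p ρ = p * ∑ x : F, if Algebra.trace (ZMod p) F x = 0 then (ρ x)^(p^i) else 0 := by
      intro i
      have hpi : p^i ≠ 0 := pow_ne_zero _ hpp.ne_zero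
      have hne : ρ^(p^i) ≠ 1 := by
        intro h
        have h3 := orderOf_dvd_of_pow_eq_one h
        have h4 := orderOf_dvd_of_pow_eq_one hρl
        have hnd : ¬ l ∣ p := by
          intro hd
          have := (ep_zero_iff l p).mpr hd
          rw [ep_p l hl m hm p f hf hord] at this
          omega
        have hco : Nat.Coprime (p^i) (l^m) := 
          (Nat.Coprime.pow _ _ ((Fact.out : l.Prime).coprime_iff_not_dvd.mpr hnd).symm)
        have h5 := Nat.eq_one_of_dvd_coprimes hco h3 h4
        exact hρ (orderOf_eq_one_iff.mp h5)
      rw [← gs_frob_pow p ρ i, gs_base p (ρ^(p^i)) hne]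
      · simp_rw [MulChar.pow_apply' _ hpi]
      · intro c hc; rw [MulChar.pow_apply' _ hpi, hb c hc, one_pow]
    have h3 : ∑ i ∈ range f, ((p : ℂ) - 1) * gs p ρ = ∑ i ∈ range f, (p * ∑ x : F, if Algebra.trace (ZMod p) F x = 0 then (ρ x)^(p^i) else 0 : ℂ) := sum_congr rfl (fun i _ => h2 i)
    rw [sum_const, ← mul_sum, sum_comm, card_range, nsmul_eq_mul] at h3
    push_cast
    rw [Nat.cast_sub hpp.one_lt.le]
    rw [mul_assoc]; push_cast; rw [h3]
    congr 1
    apply sum_congr rfl; intro x _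
    split_ifs <;> simp
  have hc0 : ((f * (p - 1 : ℕ) : ℕ) : ℂ) ≠ 0 := by
    have : p - 1 ≠ 0 := by have := hpp.one_lt; omega
    exact_mod_cast Nat.mul_ne_zero hfpos this
  have h4 : gs p ρ = ((((f * (p-1 : ℕ) : ℕ) : ℚ)⁻¹ * p : ℚ) : ℂ) * ∑ x : F, if Algebra.trace (ZMod p) F x = 0 then ∑ i ∈ range f, (ρ x)^(p^i) else 0 := by
    have e : ((((f * (p-1 : ℕ) : ℕ) : ℚ)⁻¹ * p : ℚ) : ℂ) = ((f * (p - 1 : ℕ) : ℕ) : ℂ)⁻¹ * p := by push_cast; rfl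
    rw [e, mul_assoc, ← h1, inv_mul_cancel_left₀ hc0]
  rw [h4]
  apply isQ_mul l _ _ (isQ_rat l _)
  apply isQ_sum
  intro x _
  split_ifs
  · by_cases hx : x = 0
    · have : ∀ i, p^i ≠ 0 := fun i => pow_ne_zero _ hpp.ne_zero
      simp only [hx, MulChar.map_zero, ne_eq, this, not_false_eq_true, zero_pow, sum_const_zero]
      exact isQ_zero l
    · apply isQ_orbit l hl m hm p f hf hord
      have h5 := MulChar.pow_apply_coe ρ (l^m) (Units.mk0 x hx)
      rw [hρl, MulChar.one_apply_coe] at h5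
      exact h5.symm
  · exact isQ_zero l
end

end

section
open Finset

lemma not_l_dvd (l : ℕ) [Fact l.Prime] (hl3 : 3 < l) (hl : l % 4 = 3) (m : ℕ) (hm : 1 ≤ m) (p f : ℕ) (hp : 1 < p) (hf : 2 * f = Nat.totient (l^m)) (hord : orderOf (p : ZMod (l^m)) = f) : ¬ l ∣ p - 1 := by
  have hlp : l.Prime := Fact.out
  intro hd
  have h1 : ((l:ℕ):ℤ) ∣ (p:ℤ) - 1 := by
    have : (((p - 1 : ℕ) : ℤ)) = (p:ℤ) - 1 := by rw [Nat.cast_sub hp.le]; simp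
    rw [← this]; exact_mod_cast hd
  have h2 := dvd_sub_pow_of_dvd_sub h1 (m-1)
  rw [show m - 1 + 1 = m by omega, one_pow] at h2
  have h3 : (p : ZMod (l^m))^(l^(m-1)) = 1 := by
    have h4 := (ZMod.intCast_zmod_eq_zero_iff_dvd ((p:ℤ)^(l^(m-1)) - 1) (l^m)).mpr (by exact_mod_cast h2)
    push_cast at h4
    exact sub_eq_zero.mp h4
  have h4 := orderOf_dvd_of_pow_eq_one h3
  rw [hord] at h4
  have h5 := Nat.le_of_dvd (pow_pos hlp.pos _) h4
  rw [Nat.totient_prime_pow hlp hm] at hf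
  have : l^(m-1) * 4 ≤ l^(m-1) * (l-1) := Nat.mul_le_mul_left _ (by omega)
  have : 0 < l^(m-1) := pow_pos hlp.pos _
  omega

section
variable (p : ℕ) [Fact p.Prime] {F : Type*} [Field F] [Fintype F] [Algebra (ZMod p) F]

lemma base_triv (l : ℕ) [Fact l.Prime] (m : ℕ) (hnd : ¬ l ∣ p - 1) (ρ : MulChar F ℂ) (hρl : ρ ^ (l^m) = 1) :
    ∀ c : ZMod p, c ≠ 0 → ρ (algebraMap (ZMod p) F c) = 1 := by
  intro c hc
  have hc' : algebraMap (ZMod p) F c ≠ 0 := by rwa [Ne, map_eq_zero]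
  have h1 : ρ (algebraMap (ZMod p) F c) ^ (p-1) = 1 := by
    rw [← map_pow, ← map_pow, ZMod.pow_card_sub_one_eq_one hc, map_one, map_one]
  have h2 : ρ (algebraMap (ZMod p) F c) ^ (l^m) = 1 := by
    have h5 := MulChar.pow_apply_coe ρ (l^m) (Units.mk0 _ hc')
    rw [hρl, MulChar.one_apply_coe] at h5
    exact h5.symm
  have hco : Nat.Coprime (p-1) (l^m) := (((Fact.out : l.Prime).coprime_iff_not_dvd.mpr hnd).symm).pow_right _
  exact orderOf_eq_one_iff.mp (Nat.eq_one_of_dvd_coprimes hco (orderOf_dvd_of_pow_eq_one h1) (orderOf_dvd_of_pow_eq_one h2))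

lemma red_gs (l : ℕ) [Fact l.Prime] (m : ℕ) (ρ : MulChar F ℂ) (hρl : ρ ^ (l^m) = 1) 
    {k : Type} [Field k] [CharP k l] (red : integralClosure ℤ ℂ →+* k) : red ⟨gs p ρ, gs_integral p ρ⟩ = -1 := by
  classical
  have h1 : (⟨gs p ρ, gs_integral p ρ⟩ : integralClosure ℤ ℂ) = ∑ x : F, (⟨ρ x, mulChar_integral ρ x⟩ : integralClosure ℤ ℂ) * ⟨psiC p F x, psiC_integral p x⟩ := by
    apply Subtype.ext
    rw [AddSubmonoidClass.coe_finset_sum]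
    rfl
  have h2 : (∑ x : F, (⟨psiC p F x, psiC_integral p x⟩ : integralClosure ℤ ℂ)) = 0 := by
    apply Subtype.ext
    rw [AddSubmonoidClass.coe_finset_sum]
    exact AddChar.sum_eq_zero_of_ne_one (psiC_ne_one p F)
  have h2' := congrArg red h2
  rw [map_sum, map_zero, ← add_sum_erase univ _ (mem_univ (0:F))] at h2'
  rw [h1, map_sum, ← add_sum_erase univ _ (mem_univ (0:F))]
  have h3 : ∀ x : F, x ≠ 0 → red ⟨ρ x, mulChar_integral ρ x⟩ = 1 := by
    intro x hx
    have h4 : (⟨ρ x, mulChar_integral ρ x⟩ : integralClosure ℤ ℂ)^(l^m) = 1 := by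
      apply Subtype.ext
      have h5 := MulChar.pow_apply_coe ρ (l^m) (Units.mk0 x hx)
      rw [hρl, MulChar.one_apply_coe] at h5
      exact h5.symm
    have h5 := congrArg red h4
    rw [map_pow, map_one] at h5
    have h6 : (red ⟨ρ x, mulChar_integral ρ x⟩ - 1)^(l^m) = 0 := by
      rw [sub_pow_char_pow, h5, one_pow, sub_self]
    exact sub_eq_zero.mp (pow_eq_zero_iff (pow_ne_zero _ (Fact.out : l.Prime).ne_zero) |>.mp h6)
  have h7 : (⟨ρ 0, mulChar_integral ρ 0⟩ : integralClosure ℤ ℂ) = 0 := Subtype.ext (MulChar.map_zero ρ)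
  have h8 : (⟨psiC p F 0, psiC_integral p 0⟩ : integralClosure ℤ ℂ) = 1 := Subtype.ext (AddChar.map_zero_eq_one _)
  rw [h8, map_one] at h2'
  rw [h7, zero_mul, map_zero, zero_add]
  refine Eq.trans (sum_congr rfl ?_) (neg_eq_of_add_eq_zero_right h2').symm
  intro x hx
  rw [map_mul, h3 x (ne_of_mem_erase hx), one_mul]

lemma gs_norm (f : ℕ) (hcard : Fintype.card F = p ^ f) (ρ : MulChar F ℂ) (hρ : ρ ≠ 1) : gs p ρ * (starRingEnd ℂ) (gs p ρ) = (p:ℂ)^f := by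
  have h1 := gs_mul_inv p ρ hρ
  rw [gs_conj, mul_left_comm, h1, hcard]
  rcases mulChar_neg_one_sq ρ with h | h <;> rw [h] <;> push_cast <;> ring

lemma val_gs_one (f : ℕ) (hcard : Fintype.card F = p ^ f) (ρ : MulChar F ℂ) (hρ : ρ ≠ 1) (V : ValuationSubring ℂ) (hV : V.valuation (p:ℂ) = 1) :
    V.valuation (gs p ρ) = 1 := by
  have h1 := congrArg V.valuation (gs_mul_inv p ρ hρ)
  have hneg : V.valuation (ρ (-1)) = 1 := by
    rcases mulChar_neg_one_sq ρ with h | h <;> rw [h] <;> simp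
  rw [map_mul, map_mul, hneg, one_mul, hcard, Nat.cast_pow, map_pow, hV, one_pow] at h1
  have h2 : V.valuation (gs p ρ) ≤ 1 := (V.valuation_le_one_iff _).mpr (integral_mem V _ (gs_integral p ρ))
  have h3 : V.valuation (gs p ρ⁻¹) ≤ 1 := (V.valuation_le_one_iff _).mpr (integral_mem V _ (gs_integral p ρ⁻¹))
  apply le_antisymm h2
  calc 1 = V.valuation (gs p ρ) * V.valuation (gs p ρ⁻¹) := h1.symm
    _ ≤ V.valuation (gs p ρ) * 1 := mul_le_mul' le_rfl h3
    _ = _ := mul_one _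

lemma val_p_le (V : ValuationSubring ℂ) : V.valuation (p:ℂ) ≤ 1 := 
  (V.valuation_le_one_iff _).mpr (integral_mem V _ (by simpa using (isIntegral_algebraMap (R := ℤ) (A := ℂ) (x := (p:ℤ)))))
end

end

section
open Finset

lemma quad_norm (l : ℕ) (r s : ℚ) : ((r : ℂ) + s * (Complex.I * (Real.sqrt (l : ℝ) : ℂ))) * (starRingEnd ℂ) ((r : ℂ) + s * (Complex.I * (Real.sqrt (l : ℝ) : ℂ))) = ((r^2 + l * s^2 : ℚ) : ℂ) := by
  rw [map_add, map_mul, isq_conj, map_ratCast, map_ratCast]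
  push_cast
  linear_combination (-(s:ℂ)^2) * isq_sq l

lemma unit_pm (l : ℕ) (hlp : l.Prime) (hl4 : 4 < l) (W : ℂ) (hQ : isQ l W) (hintg : IsIntegral ℤ W) (hn : W * (starRingEnd ℂ) W = 1) : W = 1 ∨ W = -1 := by
  obtain ⟨r, s, rfl⟩ := hQ
  obtain ⟨B, C, hB, hC, -⟩ := quad_int l hlp r s hintg
  rw [quad_norm] at hn
  have hn' : r^2 + l * s^2 = 1 := by exact_mod_cast hn
  have h1 : (B:ℚ)^2 + l * (C:ℚ)^2 = 4 := by rw [← hB, ← hC]; linear_combination 4 * hn'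
  have h2 : B^2 + l * C^2 = 4 := by exact_mod_cast h1
  have hC0 : C = 0 := by
    by_contra h
    have h3 : 0 < C^2 := by positivity
    have h4 : (5:ℤ) ≤ l := by exact_mod_cast hl4
    nlinarith [sq_nonneg B]
  subst hC0
  have hs : s = 0 := by push_cast at hC; linarith
  have hB2 : (B - 2) * (B + 2) = 0 := by linarith
  rcases mul_eq_zero.mp hB2 with h | h
  · left
    have : (B:ℚ) = 2 := by exact_mod_cast (by linarith : B = 2)
    have : r = 1 := by linarith
    simp [this, hs]
  · right
    have : (B:ℚ) = -2 := by exact_mod_cast (by linarith : B = -2)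
    have : r = -1 := by linarith
    simp [this, hs]

section
variable (p : ℕ) [Fact p.Prime] {F : Type*} [Field F] [Fintype F] [Algebra (ZMod p) F]

lemma rho_main (hp2 : p ≠ 2) (f : ℕ) (hcard : Fintype.card F = p ^ f) 
    (l : ℕ) [Fact l.Prime] (hl3 : 3 < l) (hl : l % 4 = 3) (m : ℕ) (hm : 1 ≤ m) (hf : 2 * f = Nat.totient (l^m)) (hord : orderOf (p : ZMod (l^m)) = f)
    (h : ℕ) (σ : ℤ) (hσ : σ = 1 ∨ σ = -1) (hS : ∑ a ∈ range l, ep l a * (a:ℤ) = σ * (l * h))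
    (ρ : MulChar F ℂ) (hρ : orderOf ρ = l^m) (e : ℕ) (he : f = h + 2 * e) :
    ∃ b c : ℤ, 4 * (p:ℤ)^h = b^2 + l * c^2 ∧ b * (p:ℤ)^e ≡ -2 [ZMOD (l:ℤ)] ∧ 
      gs p ρ = (p:ℂ)^e * (((b:ℂ) + c * (Complex.I * (Real.sqrt (l : ℝ) : ℂ)))/2) ∧
      ∀ t < m, gs p (ρ^(l^t)) * (p:ℂ)^(f * ((l^t-1)/2)) = gs p ρ ^ (l^t) := by
  have hpp : p.Prime := Fact.out
  have hlp : l.Prime := Fact.out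
  have hp0 : (p:ℂ) ≠ 0 := by exact_mod_cast hpp.ne_zero
  have hnd := not_l_dvd l hl3 hl m hm p f hpp.one_lt hf hord
  have hρl : ρ^(l^m) = 1 := by rw [← hρ]; exact pow_orderOf_eq_one ρ
  have hρt : ∀ t, (ρ^(l^t))^(l^m) = 1 := by intro t; rw [← pow_mul, mul_comm, pow_mul, hρl, one_pow]
  have hne : ∀ t < m, ρ^(l^t) ≠ 1 := by
    intro t ht h1
    have h2 := orderOf_dvd_of_pow_eq_one h1
    rw [hρ] at h2
    have := (Nat.pow_dvd_pow_iff_le_right hlp.one_lt).mp h2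
    omega
  have hne0 : ρ ≠ 1 := by have := hne 0 (by omega); simpa using this
  have hQ : ∀ t < m, isQ l (gs p (ρ^(l^t))) := fun t ht => 
    isQ_gs p l hl m hm f hf hord _ (hne t ht) (hρt t) (base_triv p l m hnd _ (hρt t))
  have hQ0 : isQ l (gs p ρ) := by have := hQ 0 (by omega); simpa using this
  obtain ⟨k, _, _, ⟨red⟩⟩ := red_exists l
  have hkp : (p:k)^f = 1 := by
    have h1 : (p : ZMod (l^m))^f = 1 := by rw [← hord]; exact pow_orderOf_eq_one _
    have h2 : ((p^f : ℕ) : ZMod (l^m)) = ((1:ℕ) : ZMod (l^m)) := by push_cast; exact h1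
    rw [ZMod.natCast_eq_natCast_iff] at h2
    have h3 := h2.of_dvd (dvd_pow_self l (by omega : m ≠ 0))
    have h4 := (CharP.natCast_eq_natCast k l).mpr h3
    push_cast at h4; exact h4
  -- β
  set β := gs p ρ / (p:ℂ)^e with hβ
  have hGβ : gs p ρ = (p:ℂ)^e * β := by rw [hβ]; field_simp
  have hβint : IsIntegral ℤ β := by
    apply integral_of_val
    intro V
    rcases (val_p_le p V).lt_or_eq with hV | hV
    · obtain ⟨s, hs, hA⟩ := val_gs p hp2 f hcard l hl m hm hf hord h σ hσ hS ρ hρ V hV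
      obtain ⟨A, hA1, hA2⟩ := hA 0 (by omega)
      simp only [pow_zero, pow_one, one_mul] at hA1 hA2
      have hAe : e ≤ A := by
        rcases hs with rfl | rfl <;> omega
      rw [hβ, map_div₀, hA2, map_pow]
      have hv0 : V.valuation (p:ℂ) ≠ 0 := (Valuation.ne_zero_iff _).mpr hp0
      rw [div_le_one₀ (zero_lt_iff.mpr (pow_ne_zero _ hv0))]
      exact pow_le_pow_right_of_le_one' hV.le hAe
    · rw [hβ, map_div₀, val_gs_one p f hcard ρ hne0 V hV, map_pow, hV]; simp
  have hβQ : isQ l β := by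
    rw [hβ, div_eq_mul_inv]
    exact isQ_mul l _ _ hQ0 (isQ_inv l hlp.pos _ (isQ_pow l _ (isQ_nat l p) e))
  obtain ⟨r, s, hrs⟩ := hβQ
  obtain ⟨B, C, hB, hC, -⟩ := quad_int l hlp r s (by rw [← hrs]; exact hβint)
  have hBC : β = ((B:ℂ) + C * (Complex.I * (Real.sqrt (l : ℝ) : ℂ)))/2 := by
    have h1 : (B:ℂ) = 2 * r := by exact_mod_cast hB.symm
    have h2 : (C:ℂ) = 2 * s := by exact_mod_cast hC.symm
    rw [hrs, h1, h2]; ring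
  have hnorm := gs_norm p f hcard ρ hne0
  refine ⟨B, C, ?_, ?_, ?_, ?_⟩
  · rw [hGβ, map_mul, map_pow, Complex.conj_natCast] at hnorm
    have h1 : β * (starRingEnd ℂ) β = (p:ℂ)^h := by
      have h2 : (p:ℂ)^(2*e) * (β * (starRingEnd ℂ) β) = (p:ℂ)^(2*e) * (p:ℂ)^h := by
        rw [← pow_add, add_comm (2*e), ← he, ← hnorm]; ring
      exact mul_left_cancel₀ (pow_ne_zero _ hp0) h2
    rw [hrs, quad_norm] at h1
    have h2 : r^2 + l * s^2 = (p:ℚ)^h := by exact_mod_cast h1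
    have h3 : 4 * (p:ℚ)^h = (B:ℚ)^2 + l * (C:ℚ)^2 := by rw [← hB, ← hC, ← h2]; ring
    exact_mod_cast h3
  · have hconj : (starRingEnd ℂ) (gs p ρ) = gs p ρ⁻¹ := by
      have h1 := base_triv p l m hnd ρ hρl (-1) (by simp)
      rw [map_neg, map_one] at h1
      rw [gs_conj, h1, one_mul]
    have h1 : gs p ρ + gs p ρ⁻¹ = ((B * (p:ℤ)^e : ℤ) : ℂ) := by
      rw [← hconj, hGβ, hBC]
      simp only [map_mul, map_pow, map_add, map_div₀, Complex.conj_natCast, map_intCast, Complex.conj_ofReal, Complex.conj_I, Complex.conj_ofNat]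
      push_cast; ring
    have h2 : (⟨gs p ρ, gs_integral p ρ⟩ : integralClosure ℤ ℂ) + ⟨gs p ρ⁻¹, gs_integral p ρ⁻¹⟩ = ((B * (p:ℤ)^e : ℤ) : integralClosure ℤ ℂ) := by
      apply Subtype.ext
      rw [AddMemClass.coe_add]
      simp only [h1]
      simp
    have h3 := congrArg red h2
    rw [map_add, red_gs p l m ρ hρl red, red_gs p l m ρ⁻¹ (by rw [inv_pow, hρl, inv_one]) red, map_intCast] at h3
    have h4 : ((B * (p:ℤ)^e : ℤ) : k) = ((-2 : ℤ) : k) := by rw [← h3]; push_cast; ring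
    exact (CharP.intCast_eq_intCast k l).mp h4
  · rw [hGβ, hBC]
  · intro t ht
    set L := l^t with hL
    have hLodd : Odd L := (Nat.odd_iff.mpr (by omega : l % 2 = 1)).pow
    obtain ⟨n, hn⟩ := hLodd
    have hn2 : (L - 1)/2 = n := by omega
    rw [hn2]
    have hG't : gs p (ρ^L) ≠ 0 := gs_ne_zero p _ (hne t ht)
    set W := gs p ρ ^ L / (gs p (ρ^L) * (p:ℂ)^(f*n)) with hW
    have hWeq : gs p ρ ^ L = W * (gs p (ρ^L) * (p:ℂ)^(f*n)) := by
      rw [hW, div_mul_cancel₀]; exact mul_ne_zero hG't (pow_ne_zero _ hp0)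
    have hWint : IsIntegral ℤ W := by
      apply integral_of_val
      intro V
      apply le_of_eq
      have hv0 : V.valuation (p:ℂ) ≠ 0 := (Valuation.ne_zero_iff _).mpr hp0
      rcases (val_p_le p V).lt_or_eq with hV | hV
      · obtain ⟨s, hs, hA⟩ := val_gs p hp2 f hcard l hl m hm hf hord h σ hσ hS ρ hρ V hV
        obtain ⟨A, hA1, hA2⟩ := hA 0 (by omega)
        obtain ⟨A', hA1', hA2'⟩ := hA t ht
        simp only [pow_zero, pow_one, one_mul] at hA1 hA2
        rw [← hL] at hA2'
        rw [hW, map_div₀, map_mul, map_pow, map_pow, hA2, hA2', ← pow_mul, ← pow_add]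
        have : A * L = A' + f * n := by
          have h1 : (2:ℤ) * (A * L) = 2 * (A' + f * n) := by
            have hL' : (l:ℤ)^t = L := by rw [hL]; push_cast; rfl
            have hLn : (L:ℤ) = 2 * n + 1 := by exact_mod_cast hn
            rw [hL'] at hA1'
            linear_combination (L:ℤ) * hA1 - hA1' + (f:ℤ) * hLn
          have h2 : (A * L : ℤ) = A' + f * n := by linarith
          exact_mod_cast h2
        rw [this]
        exact div_self (pow_ne_zero _ hv0)
      · rw [hW, map_div₀, map_mul, map_pow, map_pow, val_gs_one p f hcard ρ hne0 V hV, val_gs_one p f hcard _ (hne t ht) V hV, hV]; simp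
    have hWQ : isQ l W := by
      rw [hW, div_eq_mul_inv]
      exact isQ_mul l _ _ (isQ_pow l _ hQ0 _) (isQ_inv l hlp.pos _ (isQ_mul l _ _ (hQ t ht) (isQ_pow l _ (isQ_nat l p) _)))
    have hWn : W * (starRingEnd ℂ) W = 1 := by
      have hnorm' := gs_norm p f hcard _ (hne t ht)
      rw [← hL] at hnorm'
      have : W * (starRingEnd ℂ) W = (gs p ρ * (starRingEnd ℂ) (gs p ρ))^L / ((gs p (ρ^L) * (starRingEnd ℂ) (gs p (ρ^L))) * ((p:ℂ)^(f*n))^2) := by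
        rw [hW, map_div₀, map_pow, map_mul, map_pow, Complex.conj_natCast, mul_pow, div_mul_div_comm]
        congr 1; ring
      rw [this, hnorm, hnorm', ← pow_mul, ← pow_mul, ← pow_add, hn]
      rw [show f * (2 * n + 1) = f + f * n * 2 by ring]
      exact div_self (pow_ne_zero _ hp0)
    rcases unit_pm l hlp (by omega) W hWQ hWint hWn with h1 | h1
    · rw [hWeq, h1, one_mul]
    · exfalso
      rw [h1] at hWeq
      have h2 : (⟨gs p ρ, gs_integral p ρ⟩ : integralClosure ℤ ℂ)^L = (-1) * (⟨gs p (ρ^L), gs_integral p _⟩ * (p : integralClosure ℤ ℂ)^(f*n)) := by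
        apply Subtype.ext
        simpa using hWeq
      have h3 := congrArg red h2
      rw [map_mul, map_mul, map_pow, map_pow, red_gs p l m ρ hρl red, red_gs p l m _ (hρt t) red, map_natCast, map_neg, map_one, pow_mul, hkp, one_pow] at h3
      rw [Odd.neg_one_pow ⟨n, hn⟩] at h3
      have h4 : ((2:ℕ):k) = 0 := by push_cast; linear_combination -h3
      have h5 := (CharP.cast_eq_zero_iff k l 2).mp h4
      have := Nat.le_of_dvd (by norm_num) h5
      omega
end

end

section
open Finset

section
variable (p : ℕ) [Fact p.Prime] {F : Type*} [Field F] [Fintype F] [DecidableEq F] [Algebra (ZMod p) F]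

lemma ringChar_ne_two (hp2 : p ≠ 2) : ringChar F ≠ 2 := by
  haveI : CharP F p := charP_of_injective_algebraMap (algebraMap (ZMod p) F).injective p
  rw [ringChar.eq F p]; exact hp2

lemma dh (hp2 : p ≠ 2) (χ : MulChar F ℂ) (hχ : χ * χ ≠ 1) (h4 : χ 4 = 1) (hη : χ * etaC F ≠ 1) :
    gs p χ * gs p (χ * etaC F) = gs p (etaC F) * gs p (χ * χ) := by
  have hF := ringChar_ne_two p (F := F) hp2
  have h20 : (2:F) ≠ 0 := Ring.two_ne_zero hF
  have hχ1 : χ ≠ 1 := by rintro rfl; simp at hχ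
  have h1 := jacobiSum_mul_nontrivial hχ (psiC p F)
  have h2 := jacobiSum_mul_nontrivial hη (psiC p F)
  have hJ : jacobiSum χ χ = jacobiSum χ (etaC F) := by
    have h5 : jacobiSum χ χ = ∑ y : F, χ (1 - y^2) := by
      unfold jacobiSum
      refine Fintype.sum_equiv ((Equiv.mulLeft₀ 2 h20).trans (Equiv.subLeft 1)) _ _ ?_
      intro x
      simp only [Equiv.trans_apply, Equiv.mulLeft₀_apply, Equiv.subLeft_apply]
      rw [← map_mul, show (1:F) - (1 - 2*x)^2 = 4 * (x * (1-x)) by ring, map_mul χ 4, h4, one_mul]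
    rw [h5, sum_comp_sq hF (fun a => χ (1 - a)), jacobiSum_comm]
    simp_rw [add_mul, one_mul]
    rw [sum_add_distrib]
    have h6 : ∑ a : F, χ (1 - a) = 0 := by
      rw [← MulChar.sum_eq_zero_of_ne_one hχ1]
      exact Fintype.sum_equiv (Equiv.subLeft 1) _ _ (fun x => rfl)
    rw [h6, zero_add]; rfl
  rw [hJ] at h1
  have hg := gs_ne_zero p χ hχ1
  have hg2 := gs_ne_zero p _ hχ
  have hJ0 : jacobiSum χ (etaC F) ≠ 0 := by
    intro h0
    rw [h0, mul_zero] at h1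
    exact hg (mul_self_eq_zero.mp h1.symm)
  apply mul_right_cancel₀ hJ0
  change gs p (χ*χ) * _ = gs p χ * gs p χ at h1
  change gs p (χ * etaC F) * _ = gs p χ * gs p (etaC F) at h2
  linear_combination gs p χ * h2 - gs p (etaC F) * h1

lemma eq_eta (hp2 : p ≠ 2) (η : MulChar F ℂ) (h1 : η ≠ 1) (h2 : η ^ 2 = 1) : η = etaC F := by
  have hF := ringChar_ne_two p (F := F) hp2
  have hsq : ∀ x : F, x ≠ 0 → IsSquare x → η x = 1 := by
    rintro x hx ⟨y, rfl⟩
    have hy : y ≠ 0 := by rintro rfl; simp at hx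
    rw [map_mul, ← sq]
    have h5 := MulChar.pow_apply_coe η 2 (Units.mk0 y hy)
    rw [h2, MulChar.one_apply_coe] at h5
    exact h5.symm
  have hpm : ∀ x : F, x ≠ 0 → η x = 1 ∨ η x = -1 := by
    intro x hx
    apply mul_self_eq_one_iff.mp
    rw [← map_mul]; exact hsq _ (mul_ne_zero hx hx) ⟨x, rfl⟩
  obtain ⟨g, hg⟩ : ∃ g : F, g ≠ 0 ∧ η g ≠ 1 := by
    by_contra hcon
    push Not at hcon
    apply h1
    ext a
    rw [hcon a a.ne_zero, MulChar.one_apply_coe]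
  have hgm : η g = -1 := (hpm g hg.1).resolve_left hg.2
  have hgn : ¬ IsSquare g := fun h => hg.2 (hsq g hg.1 h)
  ext a
  have ha := a.ne_zero
  rw [etaC_apply]
  by_cases hs : IsSquare (a:F)
  · rw [hsq a ha hs, (quadraticChar_one_iff_isSquare ha).mpr hs]; simp
  · have h3 := (quadraticChar_neg_one_iff_not_isSquare).mpr hs
    have h4 := (quadraticChar_neg_one_iff_not_isSquare).mpr hgn
    have h5 : IsSquare ((a:F) * g) := by
      rw [← quadraticChar_one_iff_isSquare (mul_ne_zero ha hg.1), map_mul, h3, h4]; norm_num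
    have h6 := hsq _ (mul_ne_zero ha hg.1) h5
    rw [map_mul, hgm] at h6
    rw [h3]; push_cast; linear_combination -h6

lemma tau_pow (hp2 : p ≠ 2) (g : ℕ) : tauC p ^ (2 * g + 1) = (-1)^((p-1)/2 * g) * (p:ℂ)^g * tauC p := by
  have hpp : p.Prime := Fact.out
  obtain ⟨n, hn⟩ := hpp.odd_of_ne_two hp2
  rw [pow_succ, pow_mul, tauC_sq p n hn, mul_pow, ← pow_mul, show (p-1)/2 = n by omega]

lemma f_parity (l : ℕ) [Fact l.Prime] (m : ℕ) (hm : 1 ≤ m) (f g : ℕ) (hf : 2 * f = Nat.totient (l^m)) (hg : f = 2 * g + 1) :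
    (l % 8 = 3 → g % 2 = (m-1) % 2) ∧ (l % 8 = 7 → g % 2 = m % 2) := by
  have hlp : l.Prime := Fact.out
  rw [Nat.totient_prime_pow hlp hm] at hf
  have key : l % 4 = 3 → ∀ n, l^n % 4 = if n % 2 = 0 then 1 else 3 := by
    intro h n
    induction n with
    | zero => simp
    | succ n ih =>
      rw [pow_succ, Nat.mul_mod, ih, h]
      split_ifs <;> omega
  constructor
  · intro h8
    have h1 := key (by omega) (m-1)
    obtain ⟨d, hd⟩ : ∃ d, l - 1 = 2 * (4 * d + 1) := ⟨l / 8, by omega⟩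
    rw [hd] at hf
    have h2 : f = 4 * (l^(m-1) * d) + l^(m-1) := by linarith
    generalize l^(m-1) * d = X at *
    generalize l^(m-1) = Y at *
    split_ifs at h1 <;> omega
  · intro h8
    have h1 := key (by omega) (m-1)
    obtain ⟨d, hd⟩ : ∃ d, l - 1 = 2 * (4 * d + 3) := ⟨l / 8, by omega⟩
    rw [hd] at hf
    have h2 : f = 4 * (l^(m-1) * d) + 3 * l^(m-1) := by linarith
    generalize l^(m-1) * d = X at *
    generalize l^(m-1) = Y at *
    split_ifs at h1 <;> omega

lemma neg_pow_parity (a x y : ℕ) (h : x % 2 = y % 2) : (-1 : ℂ)^(a * x) = (-1)^(a*y) := by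
  rw [mul_comm a x, mul_comm a y, pow_mul, pow_mul]
  congr 1
  rw [neg_one_pow_eq_pow_mod_two, h, ← neg_one_pow_eq_pow_mod_two]

lemma ep_two (l : ℕ) [Fact l.Prime] : (l % 8 = 3 → ep l 2 = -1) ∧ (l % 8 = 7 → ep l 2 = 1) := by
  have : ∀ h : l ≠ 2, ep l 2 = ZMod.χ₈ l := by
    intro h
    have := quadraticChar_two (F := ZMod l) (by rw [ZMod.ringChar_zmod_n]; exact h)
    rw [ZMod.card] at this
    unfold ep; push_cast; exact this
  constructor <;> intro h <;> rw [this (by omega), ZMod.χ₈_nat_eq_if_mod_eight, h] <;> rw [if_neg (by omega)] <;> simp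
end

end

section
open Finset

lemma ep_one (l : ℕ) [Fact l.Prime] : ep l 1 = 1 := by
  unfold ep; simp

lemma ep_one_add (l : ℕ) [Fact l.Prime] (k : ℕ) (hk : l ∣ k) : ep l (1 + k) = 1 := by
  obtain ⟨d, rfl⟩ := hk
  rw [← ep_mod_mul l l _ (dvd_refl l), Nat.add_mul_mod_self_left, ep_mod_mul l l _ (dvd_refl l), ep_one]

section
variable (p : ℕ) [Fact p.Prime] {F : Type*} [Field F] [Fintype F] [DecidableEq F] [Algebra (ZMod p) F]

lemma gs_res (f : ℕ) (l : ℕ) [Fact l.Prime] (hl : l % 4 = 3) (m : ℕ) (hm : 1 ≤ m)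
    (hf : 2 * f = Nat.totient (l^m)) (hord : orderOf (p : ZMod (l^m)) = f)
    (ρ : MulChar F ℂ) (hρ : ρ ^ (l^m) = 1) (r : ℕ) (hr : ep l r = 1) :
    gs p (ρ ^ r) = gs p ρ := by
  have hlp : l.Prime := Fact.out
  have h1 : ¬ l ∣ 1 := by
    intro h; have := Nat.dvd_one.mp h; omega
  have h2 := (orbit_image l hl m hm p f hf hord 1 h1).2
  have hpos : 0 < l^m := pow_pos hlp.pos m
  have h3 : r % l^m ∈ (range (l^m)).filter (fun a => ep l a = ep l 1) := by
    rw [mem_filter, mem_range]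
    refine ⟨Nat.mod_lt _ hpos, ?_⟩
    rw [ep_mod_mul l _ _ (dvd_pow_self l (by omega)), hr, ep_one]
  rw [← h2, mem_image] at h3
  obtain ⟨i, -, hi⟩ := h3
  rw [one_mul] at hi
  rw [pow_eq_pow_mod r hρ, ← hi, ← pow_eq_pow_mod _ hρ, gs_frob_pow]

lemma chi_main (hp2 : p ≠ 2) (f : ℕ) (hcard : Fintype.card F = p ^ f) (l : ℕ) [Fact l.Prime] (hl3 : 3 < l)
    (hl : l % 4 = 3) (m : ℕ) (hm : 1 ≤ m)
    (hf : 2 * f = Nat.totient (l^m)) (hord : orderOf (p : ZMod (l^m)) = f)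
    (χ : MulChar F ℂ) (hχ : orderOf χ = 2 * l^m) :
    χ ^ (l^m) = etaC F ∧ ∀ t < m,
      (l % 8 = 3 → gs p (χ ^ (l^t)) * (p:ℂ)^f = gs p (etaC F) * gs p ((χ^2)^(l^t))^2) ∧
      (l % 8 = 7 → gs p (χ ^ (l^t)) = gs p (etaC F)) := by
  have hlp : l.Prime := Fact.out
  have hpp : p.Prime := Fact.out
  have hpos : 0 < l^m := pow_pos hlp.pos m
  have hη : χ ^ (l^m) = etaC F := by
    apply eq_eta p hp2
    · exact pow_ne_one_of_lt_orderOf hpos.ne' (by omega)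
    · rw [← pow_mul, mul_comm, ← hχ, pow_orderOf_eq_one]
  refine ⟨hη, ?_⟩
  intro t ht
  have hnd := not_l_dvd l hl3 hl m hm p f hpp.one_lt hf hord
  set ρ' := (χ^2)^(l^t) with hρ'
  set χ' := χ^(l^t) with hχ'
  have hsq : χ' * χ' = ρ' := by rw [hχ', hρ', ← pow_mul, ← pow_add]; congr 1; ring
  have hρ1 : ρ' ≠ 1 := by
    rw [hρ', ← pow_mul]
    apply pow_ne_one_of_lt_orderOf
    · have := pow_pos hlp.pos t; omega
    · rw [hχ]; have := Nat.pow_lt_pow_right hlp.one_lt ht; omega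
  have hρm : ρ' ^ (l^m) = 1 := by
    rw [hρ', ← pow_mul, ← pow_mul, show 2 * (l^t * l^m) = orderOf χ * l^t by rw [hχ]; ring, pow_mul, pow_orderOf_eq_one, one_pow]
  have h20 : (2 : ZMod p) ≠ 0 := by
    have := Ring.two_ne_zero (R := ZMod p) (by rw [ZMod.ringChar_zmod_n]; exact hp2)
    exact this
  have h4 : χ' 4 = 1 := by
    have h5 := base_triv p l m hnd ρ' hρm 2 h20
    rw [← hsq, MulChar.mul_apply, ← map_mul, map_ofNat] at h5
    rw [← h5]; congr 1; norm_num
  have hηsq : etaC F * etaC F = 1 := by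
    rw [← hη, ← pow_add, ← two_mul, ← hχ, pow_orderOf_eq_one]
  have hne : χ' * etaC F ≠ 1 := by
    intro h
    apply hρ1
    rw [← hsq]
    calc χ' * χ' = (χ' * etaC F) * (χ' * etaC F) := by rw [mul_mul_mul_comm, hηsq, mul_one]
      _ = 1 := by rw [h, one_mul]
  have hdh := dh p hp2 χ' (by rw [hsq]; exact hρ1) h4 hne
  rw [hsq] at hdh
  have hg := gs_ne_zero p ρ' hρ1
  have hlodd : Odd (l^(m-t)) := (Nat.odd_iff.mpr (by omega) : Odd l).pow
  obtain ⟨s, hs⟩ := hlodd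
  set r := s + 1 with hr
  have h2r : 2 * r = 1 + l^(m-t) := by omega
  have hrr : χ' * etaC F = ρ' ^ r := by
    rw [hχ', hρ', ← hη, ← pow_add, ← pow_mul, ← pow_mul]
    congr 1
    calc l^t + l^m = l^t * (1 + l^(m-t)) := by rw [mul_add, mul_one, ← pow_add]; congr 2; omega
      _ = 2 * (l^t * r) := by rw [← h2r]; ring
  have hep : ep l 2 * ep l r = 1 := by
    rw [← ep_mul, h2r, ep_one_add l _ (dvd_pow_self l (by omega))]
  have hrle : r ≤ l^m := by
    have : l^(m-t) ≤ l^m := Nat.pow_le_pow_right hlp.pos (by omega)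
    omega
  constructor
  · intro h8
    rw [(ep_two l).1 h8] at hep
    have hr1 : ep l (l^m - r) = 1 := by
      rw [ep_compl l hl _ _ (dvd_pow_self l (by omega)) hrle]; linarith
    have h6 := gs_res p f l hl m hm hf hord ρ' hρm _ hr1
    have hinv : ρ' ^ (l^m - r) = (ρ' ^ r)⁻¹ := by
      rw [eq_inv_iff_mul_eq_one, ← pow_add, Nat.sub_add_cancel hrle, hρm]
    rw [hinv] at h6
    have h7 := gs_mul_inv p (ρ' ^ r) (by rw [← hrr]; exact hne)
    rw [h6, hcard] at h7
    have h8 := base_triv p l m hnd (ρ' ^ r) (by rw [pow_right_comm, hρm, one_pow]) (-1) (by simp)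
    rw [map_neg, map_one] at h8
    rw [h8, one_mul] at h7
    rw [hrr] at hdh
    push_cast at h7
    linear_combination gs p ρ' * hdh - gs p χ' * h7
  · intro h8
    rw [(ep_two l).2 h8, one_mul] at hep
    rw [hrr, gs_res p f l hl m hm hf hord ρ' hρm _ hep] at hdh
    exact mul_right_cancel₀ hg hdh
end

end

lemma order_conv (l : ℕ) [Fact l.Prime] (hl : l % 4 = 3) (m : ℕ) (p f : ℕ) (hp : Odd p)
    (hf : 2 * f = Nat.totient (2 * l^m))
    (hindex : ∃ u : (ZMod (2 * l^m))ˣ, ((u : ZMod (2 * l^m)) = (p : ZMod (2 * l^m))) ∧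
      (Subgroup.zpowers u).index = 2) :
    2 * f = Nat.totient (l^m) ∧ orderOf (p : ZMod (l^m)) = f := by
  have hlp : l.Prime := Fact.out
  have hlodd : Odd (l^m) := (Nat.odd_iff.mpr (by omega) : Odd l).pow
  have hpos : 0 < l^m := pow_pos hlp.pos m
  haveI : NeZero (2 * l^m) := ⟨by omega⟩
  constructor
  · rw [hf, Nat.totient_mul (Nat.coprime_two_left.mpr hlodd), Nat.totient_two, one_mul]
  · obtain ⟨u, hu, hi⟩ := hindex
    have h1 := (Subgroup.zpowers u).card_mul_index
    rw [hi, Nat.card_zpowers, Nat.card_eq_fintype_card, ZMod.card_units_eq_totient, ← hf] at h1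
    have h2 : orderOf u = f := by omega
    rw [← h2, ← orderOf_units, hu]
    apply orderOf_eq_orderOf_iff.mpr
    intro n
    have hiff : ∀ M : ℕ, ((p : ZMod M) ^ n = 1 ↔ p^n ≡ 1 [MOD M]) := by
      intro M
      rw [← ZMod.natCast_eq_natCast_iff]; push_cast; rfl
    rw [hiff, hiff]
    constructor
    · intro h
      apply (Nat.modEq_and_modEq_iff_modEq_mul (Nat.coprime_two_left.mpr hlodd)).mp
      refine ⟨?_, h⟩
      have : Odd (p^n) := hp.pow
      exact Nat.odd_iff.mp this
    · intro h
      exact h.of_mul_left 2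

lemma gaussSumF_eq (p : ℕ) [Fact p.Prime] {F : Type*} [Field F] [Fintype F] [Algebra (ZMod p) F]
    (χ : MulChar F ℂ) : gaussSumF p χ = gs p χ := by
  unfold gaussSumF gs gaussSum
  have h1 : ∀ x : F, psi p x = psiC p F x := by
    intro x
    rw [psiC_eq]
    unfold psi zt
    rw [← Complex.exp_nat_mul]
    congr 1
    ring
  simp_rw [h1]
  symm
  rw [← Finset.sum_subset (Finset.subset_univ (Finset.univ.image (fun x : Fˣ => (x:F))))]
  · rw [Finset.sum_image]
    intro x _ y _ h
    exact Units.ext h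
  · intro x _ hx
    have : x = 0 := by
      by_contra h0
      exact hx (Finset.mem_image.mpr ⟨Units.mk0 x h0, Finset.mem_univ _, rfl⟩)
    rw [this, MulChar.map_zero, zero_mul]

lemma cpow_int' (p : ℕ) (X : ℂ) (z : ℤ) (h : X = z) : (p:ℂ) ^ X = (p:ℂ)^z := by
  rw [h, Complex.cpow_intCast]

/-- Theorem 2.2 of the paper (index 2 Gauss sums, Case D). -/
theorem statement_8 (p₁ m : ℕ) (hp₁ : p₁.Prime) (hp₁gt : 3 < p₁) (hp₁mod : p₁ % 4 = 3)
    (hm : 1 ≤ m) (N : ℕ) (hN : N = 2 * p₁ ^ m)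
    (p : ℕ) (hp : p.Prime) (hpodd : p ≠ 2) (hpne : p ≠ p₁)
    (hindex : ∃ u : (ZMod N)ˣ, ((u : ZMod N) = (p : ZMod N)) ∧
      (Subgroup.zpowers u).index = 2)
    (f : ℕ) (hf : 2 * f = Nat.totient N)
    (F : Type*) [Field F] [Fintype F] [Algebra (ZMod p) F]
    (hcard : Fintype.card F = p ^ f)
    (χ : MulChar F ℂ) (hχ : orderOf χ = N)
    -- `√(p*)`, the principal square root of `(-1)^((p-1)/2)·p` in `ℂ`
    (sqrtpstar : ℂ)
    (hsq : sqrtpstar = if p % 4 = 1 then ((Real.sqrt p : ℝ) : ℂ)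
      else Complex.I * ((Real.sqrt p : ℝ) : ℂ))
    -- `h` is the class number of `ℚ(√-p₁)`
    (K : Type*) [Field K] [NumberField K] (α : K)
    (hα : α ^ 2 = -(p₁ : K)) (hKα : Algebra.adjoin ℚ {α} = ⊤)
    (h : ℕ) (hh : h = NumberField.classNumber K) :
    ∃ b c : ℤ,
      4 * (p : ℤ) ^ h = b ^ 2 + (p₁ : ℤ) * c ^ 2 ∧
      (∃ e : ℕ, f = h + 2 * e ∧ b * (p : ℤ) ^ e ≡ -2 [ZMOD (p₁ : ℤ)]) ∧
      (∀ t : ℕ, t ≤ m - 1 →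
        (p₁ % 8 = 3 →
          gaussSumF p (χ ^ (p₁ ^ t)) =
            (-1 : ℂ) ^ (((p - 1) / 2) * (m - 1)) *
              (p : ℂ) ^ (((((f : ℂ) - 1) / 2) - (h : ℂ) * ((p₁ ^ t : ℕ) : ℂ) : ℂ)) *
                sqrtpstar *
                  (((b : ℂ) + (c : ℂ) * (Complex.I * Real.sqrt (p₁ : ℝ))) / 2) ^
                    (2 * p₁ ^ t)) ∧
        (p₁ % 8 = 7 →
          gaussSumF p (χ ^ (p₁ ^ t)) =
            (-1 : ℂ) ^ (((p - 1) / 2) * m) *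
              (p : ℂ) ^ ((((f : ℂ) - 1) / 2 : ℂ)) * sqrtpstar)) ∧
      (∀ t : ℕ, t ≤ m - 1 →
        gaussSumF p (χ ^ (2 * p₁ ^ t)) =
          (p : ℂ) ^ ((((f : ℂ) - ((p₁ ^ t : ℕ) : ℂ) * (h : ℂ)) / 2 : ℂ)) *
            (((b : ℂ) + (c : ℂ) * (Complex.I * Real.sqrt (p₁ : ℝ))) / 2) ^ (p₁ ^ t)) ∧
      gaussSumF p (χ ^ (p₁ ^ m)) =
        (-1 : ℂ) ^ (((p - 1) / 2) * ((f - 1) / 2)) *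
          (p : ℂ) ^ ((((f : ℂ) - 1) / 2 : ℂ)) * sqrtpstar := by
  subst hN hh
  haveI : Fact p₁.Prime := ⟨hp₁⟩
  haveI : Fact p.Prime := ⟨hp⟩
  obtain ⟨hf', hord⟩ := order_conv p₁ hp₁mod m p f (hp.odd_of_ne_two hpodd) hf hindex
  set h := NumberField.classNumber K with hhdef
  have hcn := class_number_formula p₁ (by omega) hp₁mod K α hα hKα
  obtain ⟨σ, hσ, hS⟩ : ∃ σ : ℤ, (σ = 1 ∨ σ = -1) ∧
      ∑ a ∈ Finset.range p₁, ep p₁ a * (a:ℤ) = σ * ((p₁:ℤ) * (h:ℤ)) := by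
    rw [S_range, hcn]
    rcases abs_choice (∑ a : ZMod p₁, quadraticChar (ZMod p₁) a * (a.val : ℤ)) with h1 | h1
    · exact ⟨1, Or.inl rfl, by rw [h1, one_mul]⟩
    · exact ⟨-1, Or.inr rfl, by rw [h1]; ring⟩
  obtain ⟨e, he⟩ := h_le p₁ hp₁mod m hm p f hf' hord h σ hσ hS
  have hppos : 0 < p₁^m := pow_pos hp₁.pos m
  have hρ : orderOf (χ^2) = p₁^m := by
    rw [orderOf_pow' _ (by norm_num), hχ, Nat.gcd_mul_right_left, Nat.mul_div_cancel_left _ (by norm_num)]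
  obtain ⟨b, c, hbc, hmod, hgs, ht⟩ := rho_main p hpodd f hcard p₁ hp₁gt hp₁mod m hm hf' hord h σ hσ hS (χ^2) hρ e he
  obtain ⟨hη, hmain⟩ := chi_main p hpodd f hcard p₁ hp₁gt hp₁mod m hm hf' hord χ hχ
  obtain ⟨g, hg⟩ := f_odd p₁ hp₁mod m hm f hf'
  obtain ⟨hpar3, hpar7⟩ := f_parity p₁ m hm f g hf' hg
  have hτ : sqrtpstar = tauC p := by rw [hsq, tauC_value p hpodd]
  have hgη : gs p (etaC F) = (-1)^((p-1)/2 * g) * (p:ℂ)^g * sqrtpstar := by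
    rw [hτ, ← tau_pow p hpodd, ← hg]
    exact gauss_eta p hpodd F f hcard ⟨g, hg⟩
  have hp0 : (p:ℂ) ≠ 0 := by exact_mod_cast hp.ne_zero
  have hfg : (((f : ℂ) - 1) / 2 : ℂ) = ((g:ℤ):ℂ) := by rw [hg]; push_cast; ring
  set β : ℂ := ((b : ℂ) + (c : ℂ) * (Complex.I * Real.sqrt (p₁ : ℝ))) / 2 with hβ
  have hρt : ∀ t < m, ∀ k, p₁^t = 2 * k + 1 →
      gs p ((χ^2)^(p₁^t)) = (p:ℂ)^((e:ℤ) - h * k) * β^(p₁^t) := by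
    intro t htm k hk
    have h1 := ht t htm
    rw [hgs] at h1
    have hkk : (p₁^t - 1)/2 = k := by omega
    rw [hkk, mul_pow, ← pow_mul (p:ℂ)] at h1
    apply mul_right_cancel₀ (pow_ne_zero (f * k) hp0)
    rw [h1, mul_right_comm, ← zpow_natCast, ← zpow_natCast (p:ℂ) (f*k), ← zpow_add₀ hp0]
    congr 2
    rw [hk, he]; push_cast; ring
  have hodd : ∀ t, ∃ k, p₁^t = 2 * k + 1 := fun t =>
    (Nat.odd_iff.mpr (by omega) : Odd p₁).pow
  refine ⟨b, c, hbc, ⟨e, he, hmod⟩, ?_, ?_, ?_⟩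
  · intro t htm
    have htm' : t < m := by omega
    obtain ⟨k, hk⟩ := hodd t
    rw [gaussSumF_eq]
    constructor
    · intro h8
      have h1 := (hmain t htm').1 h8
      rw [hρt t htm' k hk, hgη, neg_pow_parity _ _ _ (hpar3 h8)] at h1
      rw [cpow_int' p _ ((g:ℤ) - h * (2 * k + 1)) (by rw [hfg, hk]; push_cast; ring)]
      apply mul_right_cancel₀ (pow_ne_zero f hp0)
      rw [h1, mul_pow, ← zpow_natCast (p:ℂ) f, ← zpow_natCast (p:ℂ) g, ← zpow_natCast ((p:ℂ)^(_:ℤ)) 2,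
        ← zpow_mul, mul_comm 2 (p₁^t), pow_mul β]
      have h2 : (p:ℂ)^(g:ℤ) * (p:ℂ)^(((e:ℤ) - h * k) * (2:ℕ)) = (p:ℂ)^((g:ℤ) - h * (2 * k + 1)) * (p:ℂ)^(f:ℤ) := by
        rw [← zpow_add₀ hp0, ← zpow_add₀ hp0]
        congr 1
        rw [he]; push_cast; ring
      linear_combination ((-1)^((p-1)/2 * (m-1)) * sqrtpstar * (β^(p₁^t))^2) * h2
    · intro h8
      rw [(hmain t htm').2 h8, hgη, neg_pow_parity _ _ _ (hpar7 h8), cpow_int' p _ g hfg, zpow_natCast]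
  · intro t htm
    have htm' : t < m := by omega
    obtain ⟨k, hk⟩ := hodd t
    rw [gaussSumF_eq, pow_mul, hρt t htm' k hk]
    rw [cpow_int' p _ ((e:ℤ) - h * k)]
    rw [hk, he]; push_cast; ring
  · rw [gaussSumF_eq, hη, hgη, cpow_int' p _ g hfg, zpow_natCast, show (f-1)/2 = g by omega]
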